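/- For every Π^{0,0^{(ω)}}_1 set P_ω ⊆ ℕ^ℕ one can effectively find a Π⁰₁ set P₀ ⊆ ℕ^ℕ and a homeomorphism H: P_ω → P₀ such that X ⊕ 0^{(ω)} ≡_T H(X) ⊕ 0^{(ω)} ≡_T H(X)^{(ω)} uniformly for all X ∈ P_ω. -/

import Mathlib

namespace Harrington

open scoped Classical

/-- Codes for oracle Turing machines (partial recursive functionals),
    extending `Nat.Partrec.Code` with an `oracle` constructor. -/
inductive OCode : Type
  | zero : OCode
  | succ : OCode
  | left : OCode
  | right : OCode
  | oracle : OCode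
  | pair : OCode → OCode → OCode
  | comp : OCode → OCode → OCode
  | prec : OCode → OCode → OCode
  | rfind' : OCode → OCode

/-- Evaluation of an oracle code relative to a (total) oracle `A`. -/
def evalo (A : ℕ → ℕ) : OCode → ℕ →. ℕ
  | OCode.zero => pure 0
  | OCode.succ => fun n => Part.some (n + 1)
  | OCode.left => fun n => Part.some (Nat.unpair n).1
  | OCode.right => fun n => Part.some (Nat.unpair n).2
  | OCode.oracle => fun n => Part.some (A n)
  | OCode.pair cf cg => fun n => Nat.pair <$> evalo A cf n <*> evalo A cg n
  | OCode.comp cf cg => fun n => evalo A cg n >>= evalo A cf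
  | OCode.prec cf cg =>
    Nat.unpaired fun a n =>
      n.rec (evalo A cf a) fun y IH => do
        let i ← IH
        evalo A cg (Nat.pair a (Nat.pair y i))
  | OCode.rfind' cf =>
    Nat.unpaired fun a m =>
      (Nat.rfind fun n => (fun x => x = 0) <$> evalo A cf (Nat.pair a (n + m))).map (· + m)

/-- The standard enumeration of oracle codes: `OCode.ofNat e` is the `e`-th oracle machine. -/
def OCode.ofNat : ℕ → OCode
  | 0 => OCode.zero
  | 1 => OCode.succ
  | 2 => OCode.left
  | 3 => OCode.right
  | 4 => OCode.oracle
  | n + 5 =>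
    have hm : n.div2.div2 < n + 5 := by
      have h1 : n.div2.div2 ≤ n := by
        simp only [Nat.div2_val]
        exact le_trans (Nat.div_le_self _ _) (Nat.div_le_self _ _)
      omega
    have _m1 : n.div2.div2.unpair.1 < n + 5 := lt_of_le_of_lt (Nat.unpair_left_le _) hm
    have _m2 : n.div2.div2.unpair.2 < n + 5 := lt_of_le_of_lt (Nat.unpair_right_le _) hm
    match n.bodd, n.div2.bodd with
    | false, false => OCode.pair (OCode.ofNat n.div2.div2.unpair.1) (OCode.ofNat n.div2.div2.unpair.2)
    | false, true  => OCode.comp (OCode.ofNat n.div2.div2.unpair.1) (OCode.ofNat n.div2.div2.unpair.2)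
    | true,  false => OCode.prec (OCode.ofNat n.div2.div2.unpair.1) (OCode.ofNat n.div2.div2.unpair.2)
    | true,  true  => OCode.rfind' (OCode.ofNat n.div2.div2)

/-- The Turing jump `A'` of an oracle `A`:  `A'(e) = 1` if the `e`-th machine with
    oracle `A` halts on input `e`, and `A'(e) = 0` otherwise. -/
noncomputable def jump (A : ℕ → ℕ) : ℕ → ℕ :=
  fun e => if (evalo A (OCode.ofNat e) e).Dom then 1 else 0

/-- Iterated Turing jump `A^{(n)}`. -/
noncomputable def jumpIter (A : ℕ → ℕ) : ℕ → (ℕ → ℕ)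
  | 0 => A
  | n + 1 => jump (jumpIter A n)

/-- The constant zero function (the trivial oracle `0`). -/
def zeroF : ℕ → ℕ := fun _ => 0

/-- The `ω`-jump: `X^{(ω)} = {(i,n) : i ∈ X^{(n)}}`, coded via `Nat.pair` and identified
    with its characteristic function. -/
noncomputable def omegaJump (A : ℕ → ℕ) : ℕ → ℕ :=
  fun m => if jumpIter A m.unpair.2 m.unpair.1 ≠ 0 then 1 else 0

/-- The recursive join `A ⊕ B`. -/
def oplus (A B : ℕ → ℕ) : ℕ → ℕ :=
  fun n => if n % 2 = 0 then A (n / 2) else B (n / 2)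

/-- Code `c` computes the total function `f` from oracle `A`. -/
def computesFn (A : ℕ → ℕ) (c : OCode) (f : ℕ → ℕ) : Prop :=
  ∀ n, evalo A c n = Part.some (f n)

/-- Turing reducibility `X ≤_T A` for points of Baire space. -/
def TRedIn (X A : ℕ → ℕ) : Prop := ∃ c : OCode, computesFn A c X

/-- `X` is arithmetical relative to `Y`: `X ≤_T Y^{(n)}` for some `n`. -/
def ArithIn (X Y : ℕ → ℕ) : Prop := ∃ n : ℕ, TRedIn X (jumpIter Y n)

/-- `X` and `Y` are arithmetically equivalent. -/
def ArithEquiv (X Y : ℕ → ℕ) : Prop := ArithIn X Y ∧ ArithIn Y X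

/-! ### Strings and trees -/

/-- Strings: finite sequences of natural numbers. -/
abbrev Str := List ℕ

/-- The initial segment `X↾n` of a point `X` of Baire space. -/
def initSeg (X : ℕ → ℕ) (n : ℕ) : Str := (List.range n).map X

/-- A tree is a set of strings closed under initial segments. -/
def IsTree (T : Set Str) : Prop := ∀ σ τ : Str, σ <+: τ → τ ∈ T → σ ∈ T

/-- `[T]`, the set of paths through `T`. -/
def paths (T : Set Str) : Set (ℕ → ℕ) := {X | ∀ n, initSeg X n ∈ T}

/-- The characteristic function of a set of strings. -/
noncomputable def chi (T : Set Str) : Str → ℕ := fun σ => if σ ∈ T then 1 else 0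

/-- A set of strings is `A`-recursive: its characteristic function is computable from `A`. -/
def SetRecIn (A : ℕ → ℕ) (T : Set Str) : Prop :=
  ∃ c : OCode, ∀ σ : Str, evalo A c (Encodable.encode σ) = Part.some (chi T σ)

/-- `P ⊆ ℕ^ℕ` is `Π^{0,A}_1` : `P = [T]` for some `A`-recursive tree `T`. -/
def IsPi01In (A : ℕ → ℕ) (P : Set (ℕ → ℕ)) : Prop :=
  ∃ T : Set Str, IsTree T ∧ SetRecIn A T ∧ P = paths T

/-- `P ⊆ ℕ^ℕ` is `Π⁰₁` : `P = [T]` for some recursive tree `T`. -/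
def IsPi01 (P : Set (ℕ → ℕ)) : Prop := IsPi01In zeroF P

/-! ### Treemaps -/

/-- `F` is a treemap on the tree `T`: `F(σ⌢⟨i⟩) ⊇ F(σ)⌢⟨i⟩` whenever `σ⌢⟨i⟩ ∈ T`. -/
def IsTreemapOn (T : Set Str) (F : Str → Str) : Prop :=
  ∀ (σ : Str) (i : ℕ), σ ++ [i] ∈ T → (F σ) ++ [i] <+: F (σ ++ [i])

/-- The image tree `F(T) = {τ : ∃ σ ∈ T, τ ⊆ F(σ)}`. -/
def treeImage (F : Str → Str) (T : Set Str) : Set Str :=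
  {τ | ∃ σ ∈ T, τ <+: F σ}

/-- The map on paths induced by a treemap: `X ↦ ⋃ₙ F(X↾n)`. -/
def pathMap (F : Str → Str) (X : ℕ → ℕ) : ℕ → ℕ :=
  fun i => (F (initSeg X (i + 1))).getD i 0

/-- The string function `F` is `A`-recursive on `T` (restriction of a partial
    `A`-recursive function). -/
def FnRecInOn (A : ℕ → ℕ) (F : Str → Str) (T : Set Str) : Prop :=
  ∃ c : OCode, ∀ σ ∈ T, evalo A c (Encodable.encode σ) = Part.some (Encodable.encode (F σ))

/-- `F` maps `P` homeomorphically onto `Q` (subspace topologies from Baire space). -/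
def HomeoOn (F : (ℕ → ℕ) → (ℕ → ℕ)) (P Q : Set (ℕ → ℕ)) : Prop :=
  Set.BijOn F P Q ∧ ContinuousOn F P ∧
    ∃ G : (ℕ → ℕ) → (ℕ → ℕ), Set.InvOn G F P Q ∧ ContinuousOn G Q

/-- `f X ≡_T g X` uniformly for all `X ∈ P`: the Turing reductions are given by
    fixed indices independent of `X`. -/
def UnifEquivOn (P : Set (ℕ → ℕ)) (f g : (ℕ → ℕ) → (ℕ → ℕ)) : Prop :=
  ∃ c d : OCode, ∀ X ∈ P, computesFn (g X) c (f X) ∧ computesFn (f X) d (g X)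

/-! ### Standard enumerations -/

/-- `W_e^A`: the `e`-th `A`-recursively enumerable set of strings. -/
def WA (A : ℕ → ℕ) (e : ℕ) : Set Str :=
  {σ | (evalo A (OCode.ofNat e) (Encodable.encode σ)).Dom}

/-- `T_e^A = {σ : ∀ n ≤ |σ|, σ↾n ∉ W_e^A}`: the standard enumeration of `Π^{0,A}_1` trees. -/
def TA (A : ℕ → ℕ) (e : ℕ) : Set Str :=
  {σ | ∀ n ≤ σ.length, σ.take n ∉ WA A e}

/-- `P_e^A = [T_e^A]`: the standard enumeration of `Π^{0,A}_1` subsets of Baire space. -/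
def PA (A : ℕ → ℕ) (e : ℕ) : Set (ℕ → ℕ) := paths (TA A e)

/-! ### The arithmetical hierarchy on Baire space -/

/-- Prepend a number to a point of Baire space. -/
def consF (k : ℕ) (X : ℕ → ℕ) : ℕ → ℕ := fun i => Nat.casesOn i k fun j => X j

/-- `Σ⁰ₙ` subsets of Baire space.  `Σ⁰₀` sets are the recursive clopen sets
    (depending computably on a fixed finite initial segment), and
    `Σ⁰ₙ₊₁` sets are obtained from `Π⁰ₙ` sets by existential number quantification. -/
def SigmaN : ℕ → Set (ℕ → ℕ) → Prop
  | 0, P => ∃ (k : ℕ) (f : Str → Bool), Computable f ∧ P = {X | f (initSeg X k) = true}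
  | n + 1, P => ∃ Q : Set (ℕ → ℕ), SigmaN n Qᶜ ∧ P = {X | ∃ k : ℕ, consF k X ∈ Q}

/-- `Π⁰ₙ` subsets of Baire space: complements of `Σ⁰ₙ` sets. -/
def PiN (n : ℕ) (P : Set (ℕ → ℕ)) : Prop := SigmaN n Pᶜ

/-- Arithmetical subsets of Baire space: `Π⁰ₙ` for some `n`. -/
def IsArith (P : Set (ℕ → ℕ)) : Prop := ∃ n : ℕ, PiN n P


section JumpInversion

open Encodable Nat.Partrec

/-! ### Primitive recursive predicates and functions -/

section PrimrecTools

variable {γ β : Type*} [Primcodable γ] [Primcodable β]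

theorem primrecPred_exists_lt {N : γ → ℕ} {R : γ → ℕ → Prop} (hN : Primrec N)
    (hR : PrimrecPred fun x : γ × ℕ => R x.1 x.2) :
    PrimrecPred fun x => ∃ t < N x, R x t := by
  have h : PrimrecRel fun (t : ℕ) (x : γ) => R x t :=
    hR.comp (Primrec.pair Primrec.snd Primrec.fst)
  exact (h.exists_mem_list.comp (Primrec.list_range.comp hN) Primrec.id).of_eq fun x => by simp

theorem primrecPred_forall_lt {N : γ → ℕ} {R : γ → ℕ → Prop} (hN : Primrec N)
    (hR : PrimrecPred fun x : γ × ℕ => R x.1 x.2) :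
    PrimrecPred fun x => ∀ t < N x, R x t := by
  have h : PrimrecRel fun (t : ℕ) (x : γ) => R x t :=
    hR.comp (Primrec.pair Primrec.snd Primrec.fst)
  exact (h.forall_mem_list.comp (Primrec.list_range.comp hN) Primrec.id).of_eq fun x => by simp

theorem primrecPred_exists_le {N : γ → ℕ} {R : γ → ℕ → Prop} (hN : Primrec N)
    (hR : PrimrecPred fun x : γ × ℕ => R x.1 x.2) :
    PrimrecPred fun x => ∃ t ≤ N x, R x t :=
  (primrecPred_exists_lt (Primrec.succ.comp hN) hR).of_eq fun x => by
    simp only [Nat.lt_succ_iff]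

theorem primrecPred_forall_le {N : γ → ℕ} {R : γ → ℕ → Prop} (hN : Primrec N)
    (hR : PrimrecPred fun x : γ × ℕ => R x.1 x.2) :
    PrimrecPred fun x => ∀ t ≤ N x, R x t :=
  (primrecPred_forall_lt (Primrec.succ.comp hN) hR).of_eq fun x => by
    simp only [Nat.lt_succ_iff]

theorem primrecPred_eq {f g : γ → β} (hf : Primrec f) (hg : Primrec g) :
    PrimrecPred fun x => f x = g x := Primrec.eq.comp hf hg

theorem primrecPred_lt {f g : γ → ℕ} (hf : Primrec f) (hg : Primrec g) :
    PrimrecPred fun x => f x < g x := Primrec.nat_lt.comp hf hg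

theorem primrecPred_le {f g : γ → ℕ} (hf : Primrec f) (hg : Primrec g) :
    PrimrecPred fun x => f x ≤ g x := Primrec.nat_le.comp hf hg

theorem primrecPred_imp {p q : γ → Prop} (hp : PrimrecPred p) (hq : PrimrecPred q) :
    PrimrecPred fun x => p x → q x :=
  (hp.not.or hq).of_eq fun x => by tauto

theorem primrecPred_isSome {f : γ → Option β} (hf : Primrec f) :
    PrimrecPred fun x => (f x).isSome :=
  (primrecPred_eq (Primrec.option_isSome.comp hf) (Primrec.const true)).of_eq fun x => by simp

theorem primrecPred_prefix {f g : γ → List β} (hf : Primrec f) (hg : Primrec g) :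
    PrimrecPred fun x => f x <+: g x :=
  (primrecPred_eq hf (Primrec.list_take.comp (Primrec.list_length.comp hf) hg)).of_eq
    fun x => by rw [List.prefix_iff_eq_take]

theorem primrec_take {f : γ → ℕ} {g : γ → List β} (hf : Primrec f) (hg : Primrec g) :
    Primrec fun x => (g x).take (f x) := Primrec.list_take.comp hf hg

theorem primrec_getElem {g : γ → List β} {f : γ → ℕ} (hg : Primrec g) (hf : Primrec f) :
    Primrec fun x => (g x)[f x]? := Primrec.list_getElem?.comp hg hf

theorem primrec_bind {α' : Type*} [Primcodable α'] {f : γ → Option β} {g : γ → β → Option α'}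
    (hf : Primrec f) (hg : Primrec fun x : γ × β => g x.1 x.2) :
    Primrec fun x => (f x).bind (g x) := Primrec.option_bind hf hg

theorem primrec_map {f : γ → List β} {α' : Type*} [Primcodable α'] {g : γ → β → α'}
    (hf : Primrec f) (hg : Primrec fun x : γ × β => g x.1 x.2) :
    Primrec fun x => (f x).map (g x) := Primrec.list_map hf hg

/-- The least `t < N` with `p t`, or `N` if there is none. -/
noncomputable def leastLt (N : ℕ) (p : ℕ → Prop) : ℕ :=
  (List.range N).findIdx fun t => decide (p t)

theorem primrec_leastLt {N : γ → ℕ} {p : γ → ℕ → Prop} (hN : Primrec N)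
    (hp : PrimrecPred fun x : γ × ℕ => p x.1 x.2) : Primrec fun x => leastLt (N x) (p x) :=
  Primrec.list_findIdx (Primrec.list_range.comp hN) hp.decide

theorem not_of_lt_leastLt {N : ℕ} {p : ℕ → Prop} {t : ℕ} (h : t < leastLt N p) : ¬ p t := by
  have := List.not_of_lt_findIdx h
  simpa using this

theorem leastLt_spec {N : ℕ} {p : ℕ → Prop} (h : leastLt N p < N) : p (leastLt N p) := by
  have h2 : (List.range N).findIdx (fun t => decide (p t)) < (List.range N).length := by
    simpa [leastLt] using h
  have := List.findIdx_getElem (w := h2)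
  simpa [leastLt] using this

theorem leastLt_le_of {N : ℕ} {p : ℕ → Prop} {t : ℕ} (h : p t) : leastLt N p ≤ t := by
  by_contra hc
  exact not_of_lt_leastLt (not_le.1 hc) h

theorem leastLt_eq {N : ℕ} {p : ℕ → Prop} {t : ℕ} (ht : t ≤ N) (h : p t)
    (h' : ∀ s < t, ¬ p s) : leastLt N p = t := by
  refine le_antisymm (leastLt_le_of h) ?_
  by_contra hc
  exact h' _ (not_le.1 hc) (leastLt_spec (lt_of_lt_of_le (not_le.1 hc) ht))

theorem leastLt_succ_le {N : ℕ} {p : ℕ → Prop} (h : ∃ t ≤ N, p t) :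
    leastLt (N + 1) p ≤ N ∧ p (leastLt (N + 1) p) ∧ ∀ s < leastLt (N + 1) p, ¬ p s := by
  obtain ⟨t, ht, hp⟩ := h
  have h1 : leastLt (N + 1) p ≤ N := (leastLt_le_of hp).trans ht
  exact ⟨h1, leastLt_spec (Nat.lt_succ_of_le h1), fun s hs => not_of_lt_leastLt hs⟩

end PrimrecTools

/-! ### Initial segments -/

section InitSeg

@[simp] theorem length_initSeg (X : ℕ → ℕ) (n : ℕ) : (initSeg X n).length = n := by
  simp [initSeg]

@[simp] theorem initSeg_zero (X : ℕ → ℕ) : initSeg X 0 = [] := by simp [initSeg]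

theorem initSeg_succ (X : ℕ → ℕ) (n : ℕ) : initSeg X (n + 1) = initSeg X n ++ [X n] := by
  simp [initSeg, List.range_succ]

@[simp] theorem take_initSeg (X : ℕ → ℕ) (m n : ℕ) :
    (initSeg X n).take m = initSeg X (min m n) := by
  simp [initSeg, ← List.map_take, List.take_range]

theorem take_initSeg_le (X : ℕ → ℕ) {m n : ℕ} (h : m ≤ n) :
    (initSeg X n).take m = initSeg X m := by simp [h]

theorem getElem?_initSeg (X : ℕ → ℕ) (n i : ℕ) :
    (initSeg X n)[i]? = if i < n then some (X i) else none := by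
  split_ifs with h <;> simp [initSeg, h]

theorem getElem?_initSeg_lt (X : ℕ → ℕ) {n i : ℕ} (h : i < n) :
    (initSeg X n)[i]? = some (X i) := by rw [getElem?_initSeg, if_pos h]

theorem getElem?_initSeg_eq_some {X : ℕ → ℕ} {n i v : ℕ} :
    (initSeg X n)[i]? = some v ↔ i < n ∧ X i = v := by
  rw [getElem?_initSeg]; split_ifs with h <;> simp [h]

theorem initSeg_prefix (X : ℕ → ℕ) {m n : ℕ} (h : m ≤ n) : initSeg X m <+: initSeg X n := by
  rw [← take_initSeg_le X h]; exact List.take_prefix _ _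

theorem prefix_initSeg_iff {X : ℕ → ℕ} {n : ℕ} {σ : Str} :
    σ <+: initSeg X n ↔ σ.length ≤ n ∧ σ = initSeg X σ.length := by
  constructor
  · intro h
    have h1 : σ.length ≤ n := by simpa using h.length_le
    exact ⟨h1, by rw [List.prefix_iff_eq_take.1 h]; simp [h1]⟩
  · rintro ⟨h1, h2⟩
    rw [h2]; exact initSeg_prefix X h1

theorem eq_initSeg_iff {X : ℕ → ℕ} {σ : Str} :
    σ = initSeg X σ.length ↔ ∀ i v, σ[i]? = some v → X i = v := by
  constructor
  · intro h i v hv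
    rw [h] at hv
    exact (getElem?_initSeg_eq_some.1 hv).2
  · intro h
    refine List.ext_getElem? fun i => ?_
    rcases lt_or_ge i σ.length with hi | hi
    · rw [getElem?_initSeg_lt X hi, List.getElem?_eq_getElem hi,
        h i _ (List.getElem?_eq_getElem hi)]
    · rw [List.getElem?_eq_none hi, List.getElem?_eq_none (by simpa using hi)]

theorem initSeg_congr {X Y : ℕ → ℕ} {n : ℕ} (h : ∀ i < n, X i = Y i) :
    initSeg X n = initSeg Y n := by
  refine List.map_congr_left fun i hi => h i (List.mem_range.1 hi)

theorem eq_of_initSeg_eq {X Y : ℕ → ℕ} {n : ℕ} (h : initSeg X n = initSeg Y n) :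
    ∀ i < n, X i = Y i := fun i hi => by
  have := congrArg (·[i]?) h
  rw [getElem?_initSeg_lt X hi, getElem?_initSeg_lt Y hi] at this
  exact Option.some.inj this

theorem primrec_initSeg_zeroF : Primrec (initSeg zeroF) :=
  primrec_map Primrec.list_range (Primrec.const 0)

/-- The list of the values of `f` below `N`, cut off at the first undefined one. -/
def tab (N : ℕ) (f : ℕ → Option ℕ) : Str :=
  (List.range ((List.range N).findIdx fun j => (f j).isNone)).map fun j => (f j).getD 0

theorem primrec_tab {γ : Type*} [Primcodable γ] {N : γ → ℕ} {f : γ → ℕ → Option ℕ}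
    (hN : Primrec N) (hf : Primrec fun x : γ × ℕ => f x.1 x.2) :
    Primrec fun x => tab (N x) (f x) := by
  refine primrec_map (Primrec.list_range.comp (Primrec.list_findIdx
    (Primrec.list_range.comp hN) ?_)) (Primrec.option_getD.comp hf (Primrec.const 0))
  exact (Primrec.not.comp (Primrec.option_isSome.comp hf)).of_eq fun x => by simp

theorem length_tab_le (N : ℕ) (f : ℕ → Option ℕ) : (tab N f).length ≤ N := by
  have := List.findIdx_le_length (xs := List.range N) (p := fun j => (f j).isNone)
  simpa [tab] using this

theorem isSome_of_lt_length_tab {N : ℕ} {f : ℕ → Option ℕ} {j : ℕ}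
    (h : j < (tab N f).length) : (f j).isSome := by
  have h' : j < (List.range N).findIdx fun j => (f j).isNone := by simpa [tab] using h
  have := List.not_of_lt_findIdx h'
  simpa using this

theorem getElem?_tab {N : ℕ} {f : ℕ → Option ℕ} {j : ℕ} (h : j < (tab N f).length) :
    (tab N f)[j]? = f j := by
  have h' := isSome_of_lt_length_tab h
  have h2 : (tab N f)[j]? = some ((f j).getD 0) := by
    have h3 : j < (List.range N).findIdx fun j => (f j).isNone := by simpa [tab] using h
    simp only [tab, List.getElem?_map]
    rw [List.getElem?_range h3]; rfl
  rw [h2]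
  obtain ⟨v, hv⟩ := Option.isSome_iff_exists.1 h'
  simp [hv]

theorem tab_eq_initSeg {N : ℕ} {f : ℕ → Option ℕ} {X : ℕ → ℕ}
    (h : ∀ j v, f j = some v → X j = v) : tab N f = initSeg X (tab N f).length := by
  rw [eq_initSeg_iff]
  intro i v hv
  have hi : i < (tab N f).length := by
    by_contra hc
    rw [List.getElem?_eq_none (not_lt.1 hc)] at hv
    cases hv
  exact h i v (by rw [← getElem?_tab hi, hv])

theorem le_length_tab {N m : ℕ} {f : ℕ → Option ℕ} (hm : m ≤ N)
    (h : ∀ j < m, (f j).isSome) : m ≤ (tab N f).length := by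
  by_contra hc
  push Not at hc
  have hL : (tab N f).length = (List.range N).findIdx fun j => (f j).isNone := by simp [tab]
  have h2 : (List.range N).findIdx (fun j => (f j).isNone) < (List.range N).length := by
    rw [← hL]; simp; omega
  have h3 := List.findIdx_getElem (w := h2)
  simp only [List.getElem_range, ← hL] at h3
  have := h _ hc
  rw [Option.isNone_iff_eq_none] at h3
  simp [h3] at this

end InitSeg

/-! ### Approximations of functions by finite strings -/

open Filter in
/-- The strings `s k` are initial segments of `f` whose lengths tend to infinity. -/
def Approx (s : ℕ → Str) (f : ℕ → ℕ) : Prop :=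
  (∀ k, s k = initSeg f (s k).length) ∧ ∀ m, ∀ᶠ k in atTop, m ≤ (s k).length

section Approx
open Filter

theorem approx_initSeg (f : ℕ → ℕ) : Approx (initSeg f) f :=
  ⟨fun k => by simp, fun m => by
    filter_upwards [eventually_ge_atTop m] with k hk; simpa using hk⟩

theorem Approx.sound {s : ℕ → Str} {f : ℕ → ℕ} (h : Approx s f) {k i v : ℕ}
    (hv : (s k)[i]? = some v) : f i = v :=
  eq_initSeg_iff.1 (h.1 k) i v hv

theorem Approx.complete {s : ℕ → Str} {f : ℕ → ℕ} (h : Approx s f) (i : ℕ) :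
    ∀ᶠ k in atTop, (s k)[i]? = some (f i) := by
  filter_upwards [h.2 (i + 1)] with k hk
  rw [h.1 k]
  exact getElem?_initSeg_lt f hk

theorem approx_tab {N : ℕ → ℕ} {F : ℕ → ℕ → Option ℕ} {f : ℕ → ℕ}
    (hN : ∀ m, ∀ᶠ k in atTop, m ≤ N k) (h1 : ∀ k j v, F k j = some v → f j = v)
    (h2 : ∀ j, ∀ᶠ k in atTop, (F k j).isSome) : Approx (fun k => tab (N k) (F k)) f := by
  refine ⟨fun k => tab_eq_initSeg (h1 k), fun m => ?_⟩
  have h3 : ∀ᶠ k in atTop, ∀ j ∈ Finset.range m, (F k j).isSome :=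
    (Finset.eventually_all _).2 fun j _ => h2 j
  filter_upwards [hN m, h3] with k hk hk3
  exact le_length_tab hk fun j hj => hk3 j (Finset.mem_range.2 hj)

theorem Approx.exists_take {s : ℕ → Str} {f : ℕ → ℕ} (h : Approx s f) (m : ℕ) :
    ∀ᶠ k in atTop, (s k).take m = initSeg f m := by
  filter_upwards [h.2 m] with k hk
  rw [h.1 k]; simp [hk]

end Approx

/-! ### Codes -/

section Codes

theorem exists_code_of_partrec {α β : Type*} [Primcodable α] [Primcodable β] {f : α →. β}
    (hf : Partrec f) : ∃ c : Code, ∀ a, c.eval (encode a) = (f a).map encode := by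
  obtain ⟨c, hc⟩ := Code.exists_code.1 hf
  exact ⟨c, fun a => by rw [hc]; simp⟩

theorem exists_code_of_computable {α β : Type*} [Primcodable α] [Primcodable β] {f : α → β}
    (hf : Computable f) : ∃ c : Code, ∀ a, c.eval (encode a) = Part.some (encode (f a)) := by
  obtain ⟨c, hc⟩ := exists_code_of_partrec hf.partrec
  exact ⟨c, fun a => by rw [hc]; simp⟩

theorem exists_evaln_of_mem {c : Code} {n v : ℕ} (h : v ∈ c.eval n) :
    ∃ k0, ∀ k ≥ k0, Code.evaln k c n = some v := by
  obtain ⟨k, hk⟩ := Code.evaln_complete.1 h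
  exact ⟨k, fun k' hk' => Code.evaln_mono hk' hk⟩

theorem primrec_evaln {γ : Type*} [Primcodable γ] {k : γ → ℕ} {c : γ → Code} {n : γ → ℕ}
    (hk : Primrec k) (hc : Primrec c) (hn : Primrec n) :
    Primrec fun x => Code.evaln (k x) (c x) (n x) :=
  Code.primrec_evaln.comp (Primrec.pair (Primrec.pair hk hc) hn)

/-- Semidecidable relations are uniformly indexed by natural numbers. -/
theorem exists_index {α β : Type*} [Primcodable α] [Primcodable β] {V : α → β → Prop}
    (hV : PrimrecPred fun x : α × β => V x.1 x.2) :
    ∃ p : α → ℕ, Primrec p ∧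
      ∀ x z, ((Denumerable.ofNat Code (p x)).eval (encode z)).Dom ↔ V x z := by
  have h1 : Primrec fun x : α × β => if V x.1 x.2 then some 0 else none :=
    Primrec.ite hV (Primrec.const _) (Primrec.const _)
  have h2 : Partrec fun x : α × β => ((if V x.1 x.2 then some 0 else none : Option ℕ) : Part ℕ) :=
    h1.to_comp.ofOption
  obtain ⟨c, hc⟩ := exists_code_of_partrec h2
  refine ⟨fun x => encode (Code.curry c (encode x)), ?_, fun x z => ?_⟩
  · exact Primrec.encode.comp (Code.primrec₂_curry.comp (Primrec.const c) Primrec.encode)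
  · rw [Denumerable.ofNat_encode, Code.eval_curry, ← Encodable.encode_prod_val, hc]
    by_cases h : V x z <;> simp [h]

theorem evalo_comp (A : ℕ → ℕ) (c d : OCode) (n : ℕ) :
    evalo A (OCode.comp c d) n = (evalo A d n).bind fun m => evalo A c m := rfl

theorem evalo_pair (A : ℕ → ℕ) (c d : OCode) (n : ℕ) :
    evalo A (OCode.pair c d) n =
      (evalo A c n).bind fun a => (evalo A d n).bind fun b => Part.some (Nat.pair a b) := by
  have : evalo A (OCode.pair c d) n = ((evalo A c n).map Nat.pair).bind fun f => (evalo A d n).map f := rfl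
  rw [this, Part.bind_map]
  simp only [Part.bind_some_eq_map]

theorem evalo_prec_zero (A : ℕ → ℕ) (c d : OCode) (a : ℕ) :
    evalo A (OCode.prec c d) (Nat.pair a 0) = evalo A c a := by
  simp [evalo]

theorem evalo_prec_succ (A : ℕ → ℕ) (c d : OCode) (a n : ℕ) :
    evalo A (OCode.prec c d) (Nat.pair a (n + 1)) =
      (evalo A (OCode.prec c d) (Nat.pair a n)).bind fun i =>
        evalo A d (Nat.pair a (Nat.pair n i)) := by
  simp only [evalo, Nat.unpaired, Nat.unpair_pair]
  rfl

theorem mem_evalo_rfind' (A : ℕ → ℕ) (c : OCode) (a m v : ℕ) :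
    v ∈ evalo A (OCode.rfind' c) (Nat.pair a m) ↔ m ≤ v ∧ 0 ∈ evalo A c (Nat.pair a v) ∧
      ∀ i, m ≤ i → i < v → ∃ u, u ≠ 0 ∧ u ∈ evalo A c (Nat.pair a i) := by
  simp only [evalo, Nat.unpaired, Nat.unpair_pair]
  rw [Part.mem_map_iff]
  constructor
  · rintro ⟨k, hk, rfl⟩
    obtain ⟨h1, h2⟩ := Nat.mem_rfind.1 hk
    obtain ⟨u, hu, hu'⟩ := (Part.mem_map_iff _).1 h1
    refine ⟨by omega, by simp_all, fun i hi hik => ?_⟩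
    obtain ⟨u, hu, hu'⟩ := (Part.mem_map_iff _).1 (h2 (m := i - m) (by omega))
    exact ⟨u, by simpa using hu', by rwa [Nat.sub_add_cancel hi] at hu⟩
  · rintro ⟨h0, h1, h2⟩
    refine ⟨v - m, Nat.mem_rfind.2 ⟨?_, fun {i} hi => ?_⟩, by omega⟩
    · exact (Part.mem_map_iff _).2 ⟨0, by rwa [Nat.sub_add_cancel h0], by simp⟩
    · obtain ⟨u, hu, hu'⟩ := h2 (i + m) (by omega) (by omega)
      exact (Part.mem_map_iff _).2 ⟨u, hu', by simpa using hu⟩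

/-- Inclusion of the ordinary codes into the oracle codes. -/
def emb : Code → OCode
  | Code.zero => OCode.zero
  | Code.succ => OCode.succ
  | Code.left => OCode.left
  | Code.right => OCode.right
  | Code.pair a b => OCode.pair (emb a) (emb b)
  | Code.comp a b => OCode.comp (emb a) (emb b)
  | Code.prec a b => OCode.prec (emb a) (emb b)
  | Code.rfind' a => OCode.rfind' (emb a)

theorem evalo_emb (A : ℕ → ℕ) (c : Code) : evalo A (emb c) = c.eval := by
  induction c with
  | zero => rfl
  | succ => rfl
  | left => rfl
  | right => rfl
  | pair a b ha hb => simp only [emb, evalo, Code.eval, ha, hb]; rfl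
  | comp a b ha hb => simp only [emb, evalo, Code.eval, ha, hb]; rfl
  | prec a b ha hb => simp only [emb, evalo, Code.eval, ha, hb]; rfl
  | rfind' a ha => simp only [emb, evalo, Code.eval, ha]; rfl

theorem eval_comp (c d : Code) (n : ℕ) :
    (Code.comp c d).eval n = (d.eval n).bind fun m => c.eval m := rfl

theorem eval_pair (c d : Code) (n : ℕ) :
    (Code.pair c d).eval n =
      (c.eval n).bind fun a => (d.eval n).bind fun b => Part.some (Nat.pair a b) := by
  simp only [← evalo_emb zeroF]
  exact evalo_pair zeroF (emb c) (emb d) n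

theorem eval_prec_zero' (c d : Code) (a : ℕ) :
    (Code.prec c d).eval (Nat.pair a 0) = c.eval a := Code.eval_prec_zero ..

theorem eval_prec_succ' (c d : Code) (a n : ℕ) :
    (Code.prec c d).eval (Nat.pair a (n + 1)) =
      ((Code.prec c d).eval (Nat.pair a n)).bind fun i =>
        d.eval (Nat.pair a (Nat.pair n i)) := by
  rw [Code.eval_prec_succ]; rfl

theorem mem_eval_rfind' (c : Code) (a m v : ℕ) :
    v ∈ (Code.rfind' c).eval (Nat.pair a m) ↔ m ≤ v ∧ 0 ∈ c.eval (Nat.pair a v) ∧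
      ∀ i, m ≤ i → i < v → ∃ u, u ≠ 0 ∧ u ∈ c.eval (Nat.pair a i) := by
  simp only [← evalo_emb zeroF]
  exact mem_evalo_rfind' zeroF (emb c) a m v

theorem exists_ocode_of_computable {α β : Type*} [Primcodable α] [Primcodable β] {f : α → β}
    (hf : Computable f) :
    ∃ c : OCode, ∀ A a, evalo A c (encode a) = Part.some (encode (f a)) := by
  obtain ⟨c, hc⟩ := exists_code_of_computable hf
  exact ⟨emb c, fun A a => by rw [evalo_emb, hc]⟩

theorem evalo_comp_of {A : ℕ → ℕ} {c d : OCode} {n m : ℕ} (h : evalo A d n = Part.some m) :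
    evalo A (OCode.comp c d) n = evalo A c m := by
  rw [evalo_comp, h, Part.bind_some]

theorem evalo_pair_of {A : ℕ → ℕ} {c d : OCode} {n m k : ℕ} (h : evalo A c n = Part.some m)
    (h' : evalo A d n = Part.some k) :
    evalo A (OCode.pair c d) n = Part.some (Nat.pair m k) := by
  rw [evalo_pair, h, Part.bind_some, h', Part.bind_some]

/-- The initial segments of the oracle are uniformly computable from it. -/
theorem exists_ocode_initSeg :
    ∃ c : OCode, ∀ A a s, evalo A c (Nat.pair a s) = Part.some (encode (initSeg A s)) := by
  obtain ⟨e0, h0⟩ := exists_ocode_of_computable (α := ℕ) (β := Str)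
    (f := fun _ => []) (Computable.const _)
  obtain ⟨ec, hc⟩ := exists_ocode_of_computable (α := Str × ℕ) (β := Str)
    (f := fun x => x.1 ++ [x.2])
    (Primrec.list_append.comp Primrec.fst
      (Primrec.list_cons.comp Primrec.snd (Primrec.const []))).to_comp
  set d : OCode := OCode.comp ec (OCode.pair (OCode.comp OCode.right OCode.right)
      (OCode.comp OCode.oracle (OCode.comp OCode.left OCode.right))) with hd
  have hstep : ∀ A a s l, evalo A d (Nat.pair a (Nat.pair s (encode (l : Str)))) =
      Part.some (encode (l ++ [A s])) := by
    intro A a s l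
    have := hc A (l, A s)
    rw [Encodable.encode_prod_val] at this
    rw [hd, evalo_comp_of (m := Nat.pair (encode l) (encode (A s))) (evalo_pair_of ?_ ?_), this]
    · rw [evalo_comp]; simp [evalo]
    · rw [evalo_comp, evalo_comp]; simp [evalo]
  refine ⟨OCode.prec e0 d, fun A a s => ?_⟩
  induction s with
  | zero =>
    rw [evalo_prec_zero]
    exact h0 A a
  | succ s ih => rw [evalo_prec_succ, ih, Part.bind_some, hstep, initSeg_succ]

/-- Unbounded search through the initial segments of the oracle. -/
theorem exists_ocode_search {ψ : Str → ℕ → Option ℕ} (hψ : Computable₂ ψ) :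
    ∃ c : OCode, ∀ A m, (∀ v ∈ evalo A c m, ∃ s, ψ (initSeg A s) m = some v) ∧
      ((evalo A c m).Dom ↔ ∃ s, (ψ (initSeg A s) m).isSome) := by
  obtain ⟨seg, hseg⟩ := exists_ocode_initSeg
  obtain ⟨e1, h1⟩ := exists_ocode_of_computable (α := ℕ × Str) (β := ℕ)
    (f := fun x => bif (ψ x.2 x.1).isSome then 0 else 1)
    (Computable.cond (Primrec.option_isSome.to_comp.comp
      (hψ.comp Computable.snd Computable.fst)) (Computable.const _) (Computable.const _))
  obtain ⟨e2, h2⟩ := exists_ocode_of_computable (α := ℕ × Str) (β := ℕ)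
    (f := fun x => (ψ x.2 x.1).getD 0)
    (Computable.option_getD (hψ.comp Computable.snd Computable.fst) (Computable.const _))
  set pr : OCode := OCode.pair OCode.left seg with hpr
  have hprv : ∀ A m s, evalo A pr (Nat.pair m s) = Part.some (encode (m, initSeg A s)) := by
    intro A m s
    rw [hpr, evalo_pair_of (m := m) (k := encode (initSeg A s)), Encodable.encode_prod_val]
    · rfl
    · simp [evalo]
    · exact hseg A m s
  have hf1 : ∀ A m s, evalo A (OCode.comp e1 pr) (Nat.pair m s) =
      Part.some (bif (ψ (initSeg A s) m).isSome then 0 else 1) := by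
    intro A m s
    rw [evalo_comp_of (hprv A m s), h1]; rfl
  set f : OCode := OCode.comp (OCode.rfind' (OCode.comp e1 pr))
    (OCode.pair (emb Code.id) OCode.zero) with hf
  have hfm : ∀ A m s, s ∈ evalo A f m ↔ (ψ (initSeg A s) m).isSome ∧
      ∀ i < s, ¬ (ψ (initSeg A i) m).isSome := by
    intro A m s
    rw [hf, evalo_comp_of (m := Nat.pair m 0)
      (evalo_pair_of (by rw [evalo_emb]; simp) rfl), mem_evalo_rfind']
    simp only [hf1, Part.mem_some_iff, Nat.zero_le, true_and, forall_const]
    refine and_congr ?_ (forall_congr' fun i => imp_congr_right fun _ => ?_)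
    · cases (ψ (initSeg A s) m).isSome <;> simp
    · cases (ψ (initSeg A i) m).isSome <;> simp
  have hout : ∀ A m s, evalo A (OCode.comp e2 pr) (Nat.pair m s) =
      Part.some ((ψ (initSeg A s) m).getD 0) := fun A m s => by
    rw [evalo_comp_of (hprv A m s), h2]; rfl
  set c : OCode := OCode.comp (OCode.comp e2 pr) (OCode.pair (emb Code.id) f) with hcdef
  have hc : ∀ A m v, v ∈ evalo A c m ↔
      ∃ s ∈ evalo A f m, v = (ψ (initSeg A s) m).getD 0 := by
    intro A m v
    rw [hcdef, evalo_comp, evalo_pair, evalo_emb, Code.eval_id, Part.bind_some, Part.bind_assoc]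
    simp only [Part.bind_some, hout, Part.mem_bind_iff, Part.mem_some_iff]
  refine ⟨c, fun A m => ⟨fun v hv => ?_, fun h => ?_, fun h => ?_⟩⟩
  · obtain ⟨s, hs, rfl⟩ := (hc A m v).1 hv
    obtain ⟨u, hu⟩ := Option.isSome_iff_exists.1 ((hfm A m s).1 hs).1
    exact ⟨s, by simp [hu]⟩
  · obtain ⟨v, hv⟩ := Part.dom_iff_mem.1 h
    obtain ⟨s, hs, -⟩ := (hc A m v).1 hv
    exact ⟨s, ((hfm A m s).1 hs).1⟩
  · exact Part.dom_iff_mem.2 ⟨_, (hc A m _).2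
      ⟨Nat.find h, (hfm A m _).2 ⟨Nat.find_spec h, fun i hi => Nat.find_min h hi⟩, rfl⟩⟩

/-- A uniform family of finite approximations computed from the oracle yields a reduction. -/
theorem exists_ocode_of_approx {ι : Type*} {D : Set ι} {g f : ι → ℕ → ℕ} {S : Str → Str}
    (hS : Computable S) (h : ∀ x ∈ D, Approx (fun k => S (initSeg (g x) k)) (f x)) :
    ∃ c : OCode, ∀ x ∈ D, computesFn (g x) c (f x) := by
  obtain ⟨c, hc⟩ := exists_ocode_search (ψ := fun σ m => (S σ)[m]?)
    (Primrec.list_getElem?.to_comp.comp (hS.comp Computable.fst) Computable.snd)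
  refine ⟨c, fun x hx m => ?_⟩
  have h_dom := (hc (g x) m).2.2 (by
    obtain ⟨s, hs⟩ := ((h x hx).complete m).exists
    exact ⟨s, by simp only [hs, Option.isSome_some]⟩)
  obtain ⟨v, hv⟩ := Part.dom_iff_mem.1 h_dom
  obtain ⟨s, hs⟩ := (hc (g x) m).1 v hv
  rw [(h x hx).sound hs]
  exact Part.eq_some_iff.2 hv

end Codes

/-! ### Oracle machines with finite oracles -/

section FiniteOracle

open Filter

theorem exists_lookup : ∃ c : Code, ∀ (σ : Str) n,
    c.eval (Nat.pair (encode σ) n) = (σ[n]? : Part ℕ) := by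
  have h : Partrec fun x : Str × ℕ => ((x.1[x.2]? : Option ℕ) : Part ℕ) :=
    Primrec.list_getElem?.to_comp.ofOption
  obtain ⟨c, hc⟩ := exists_code_of_partrec h
  refine ⟨c, fun σ n => ?_⟩
  have := hc (σ, n)
  rw [Encodable.encode_prod_val] at this
  exact this.trans (Part.map_id' (fun _ => rfl) _)

/-- Maps `⟨a, b, n⟩` to `⟨⟨a, b⟩, n⟩`. -/
def assocL : Code :=
  Code.pair (Code.pair Code.left (Code.comp Code.left Code.right))
    (Code.comp Code.right Code.right)

/-- Maps `⟨⟨a, b⟩, n⟩` to `⟨a, b, n⟩`. -/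
def assocR : Code :=
  Code.pair (Code.comp Code.left Code.left)
    (Code.pair (Code.comp Code.right Code.left) Code.right)

theorem eval_assocL (a b n : ℕ) :
    assocL.eval (Nat.pair a (Nat.pair b n)) = Part.some (Nat.pair (Nat.pair a b) n) := by
  simp only [assocL, eval_pair, eval_comp]
  simp [Code.eval]

theorem eval_assocR (a b n : ℕ) :
    assocR.eval (Nat.pair (Nat.pair a b) n) = Part.some (Nat.pair a (Nat.pair b n)) := by
  simp only [assocR, eval_pair, eval_comp]
  simp [Code.eval]

/-- The oracle code `c`, run with a finite string (given as part of the input) as oracle. -/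
noncomputable def tr : OCode → Code
  | OCode.zero => Code.zero
  | OCode.succ => Code.comp Code.succ Code.right
  | OCode.left => Code.comp Code.left Code.right
  | OCode.right => Code.comp Code.right Code.right
  | OCode.oracle => exists_lookup.choose
  | OCode.pair c d => Code.pair (tr c) (tr d)
  | OCode.comp c d => Code.comp (tr c) (Code.pair Code.left (tr d))
  | OCode.prec c d => Code.comp (Code.prec (tr c) (Code.comp (tr d) assocR)) assocL
  | OCode.rfind' c => Code.comp (Code.rfind' (Code.comp (tr c) assocR)) assocL

theorem mem_eval_tr_comp {c d : OCode} {s n v : ℕ} :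
    v ∈ (tr (OCode.comp c d)).eval (Nat.pair s n) ↔
      ∃ u ∈ (tr d).eval (Nat.pair s n), v ∈ (tr c).eval (Nat.pair s u) := by
  have h : ∀ m, (Code.left).eval m = Part.some m.unpair.1 := fun m => rfl
  simp only [tr, eval_comp, eval_pair, h, Part.bind_some, Part.bind_assoc, Nat.unpair_pair,
    Part.mem_bind_iff]

theorem mem_eval_tr_pair {c d : OCode} {s n v : ℕ} :
    v ∈ (tr (OCode.pair c d)).eval (Nat.pair s n) ↔
      ∃ a ∈ (tr c).eval (Nat.pair s n), ∃ b ∈ (tr d).eval (Nat.pair s n), v = Nat.pair a b := by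
  simp only [tr, eval_pair, Part.mem_bind_iff, Part.mem_some_iff]

theorem eval_tr_prec_zero {c d : OCode} {s a : ℕ} :
    (tr (OCode.prec c d)).eval (Nat.pair s (Nat.pair a 0)) = (tr c).eval (Nat.pair s a) := by
  simp only [tr, eval_comp (Code.prec _ _), eval_assocL, Part.bind_some, eval_prec_zero']

theorem mem_eval_tr_prec_succ {c d : OCode} {s a n v : ℕ} :
    v ∈ (tr (OCode.prec c d)).eval (Nat.pair s (Nat.pair a (n + 1))) ↔
      ∃ i ∈ (tr (OCode.prec c d)).eval (Nat.pair s (Nat.pair a n)),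
        v ∈ (tr d).eval (Nat.pair s (Nat.pair a (Nat.pair n i))) := by
  simp only [tr, eval_comp (Code.prec _ _), eval_assocL, Part.bind_some, eval_prec_succ',
    eval_comp (tr d), eval_assocR, Part.mem_bind_iff]

theorem mem_eval_tr_rfind' {c : OCode} {s a m v : ℕ} :
    v ∈ (tr (OCode.rfind' c)).eval (Nat.pair s (Nat.pair a m)) ↔
      m ≤ v ∧ 0 ∈ (tr c).eval (Nat.pair s (Nat.pair a v)) ∧
      ∀ i, m ≤ i → i < v → ∃ u, u ≠ 0 ∧ u ∈ (tr c).eval (Nat.pair s (Nat.pair a i)) := by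
  simp only [tr, eval_comp (Code.rfind' _), eval_assocL, Part.bind_some, mem_eval_rfind',
    eval_comp (tr c), eval_assocR]

theorem mem_evalo_prec_succ (A : ℕ → ℕ) (c d : OCode) (a n v : ℕ) :
    v ∈ evalo A (OCode.prec c d) (Nat.pair a (n + 1)) ↔
      ∃ i ∈ evalo A (OCode.prec c d) (Nat.pair a n),
        v ∈ evalo A d (Nat.pair a (Nat.pair n i)) := by
  rw [evalo_prec_succ, Part.mem_bind_iff]

theorem exists_pair_eq (n : ℕ) : ∃ a b, n = Nat.pair a b :=
  ⟨n.unpair.1, n.unpair.2, (Nat.pair_unpair n).symm⟩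

theorem tr_sound (A : ℕ → ℕ) (s : ℕ) (c : OCode) : ∀ n v,
    v ∈ (tr c).eval (Nat.pair (encode (initSeg A s)) n) → v ∈ evalo A c n := by
  induction c with
  | zero => intro n v h; exact h
  | succ => intro n v h; simp only [tr, eval_comp] at h; simpa [Code.eval, evalo] using h
  | left => intro n v h; simp only [tr, eval_comp] at h; simpa [Code.eval, evalo] using h
  | right => intro n v h; simp only [tr, eval_comp] at h; simpa [Code.eval, evalo] using h
  | oracle =>
    intro n v h
    rw [tr, exists_lookup.choose_spec, Part.mem_ofOption] at h
    have := (getElem?_initSeg_eq_some.1 h).2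
    simp [evalo, this]
  | pair c d hc hd =>
    intro n v h
    obtain ⟨a, ha, b, hb, rfl⟩ := mem_eval_tr_pair.1 h
    rw [evalo_pair]
    exact Part.mem_bind (hc _ _ ha) (Part.mem_bind (hd _ _ hb) (Part.mem_some _))
  | comp c d hc hd =>
    intro n v h
    obtain ⟨u, hu, hv⟩ := mem_eval_tr_comp.1 h
    rw [evalo_comp]
    exact Part.mem_bind (hd _ _ hu) (hc _ _ hv)
  | prec c d hc hd =>
    intro n
    obtain ⟨a, n, rfl⟩ := exists_pair_eq n
    induction n with
    | zero =>
      intro v h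
      rw [eval_tr_prec_zero] at h
      rw [evalo_prec_zero]
      exact hc _ _ h
    | succ n ih =>
      intro v h
      obtain ⟨i, hi, hv⟩ := mem_eval_tr_prec_succ.1 h
      exact (mem_evalo_prec_succ ..).2 ⟨i, ih _ hi, hd _ _ hv⟩
  | rfind' c hc =>
    intro n v h
    obtain ⟨a, n, rfl⟩ := exists_pair_eq n
    obtain ⟨h0, h1, h2⟩ := mem_eval_tr_rfind'.1 h
    refine (mem_evalo_rfind' ..).2 ⟨h0, hc _ _ h1, fun i hi hiv => ?_⟩
    obtain ⟨u, hu, hu'⟩ := h2 i hi hiv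
    exact ⟨u, hu, hc _ _ hu'⟩

theorem tr_complete (A : ℕ → ℕ) (c : OCode) : ∀ n v, v ∈ evalo A c n →
    ∀ᶠ s in atTop, v ∈ (tr c).eval (Nat.pair (encode (initSeg A s)) n) := by
  induction c with
  | zero => intro n v h; exact .of_forall fun s => h
  | succ =>
    intro n v h
    refine .of_forall fun s => ?_
    simp only [tr, eval_comp]; simpa [Code.eval, evalo] using h
  | left =>
    intro n v h
    refine .of_forall fun s => ?_
    simp only [tr, eval_comp]; simpa [Code.eval, evalo] using h
  | right =>
    intro n v h
    refine .of_forall fun s => ?_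
    simp only [tr, eval_comp]; simpa [Code.eval, evalo] using h
  | oracle =>
    intro n v h
    filter_upwards [eventually_gt_atTop n] with s hs
    rw [tr, exists_lookup.choose_spec, Part.mem_ofOption, getElem?_initSeg_lt A hs]
    simpa [evalo, eq_comm] using h
  | pair c d hc hd =>
    intro n v h
    rw [evalo_pair] at h
    simp only [Part.mem_bind_iff, Part.mem_some_iff] at h
    obtain ⟨a, ha, b, hb, rfl⟩ := h
    filter_upwards [hc _ _ ha, hd _ _ hb] with s h1 h2
    exact mem_eval_tr_pair.2 ⟨a, h1, b, h2, rfl⟩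
  | comp c d hc hd =>
    intro n v h
    rw [evalo_comp, Part.mem_bind_iff] at h
    obtain ⟨u, hu, hv⟩ := h
    filter_upwards [hd _ _ hu, hc _ _ hv] with s h1 h2
    exact mem_eval_tr_comp.2 ⟨u, h1, h2⟩
  | prec c d hc hd =>
    intro n
    obtain ⟨a, n, rfl⟩ := exists_pair_eq n
    induction n with
    | zero =>
      intro v h
      rw [evalo_prec_zero] at h
      filter_upwards [hc _ _ h] with s hs
      rwa [eval_tr_prec_zero]
    | succ n ih =>
      intro v h
      obtain ⟨i, hi, hv⟩ := (mem_evalo_prec_succ ..).1 h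
      filter_upwards [ih _ hi, hd _ _ hv] with s h1 h2
      exact mem_eval_tr_prec_succ.2 ⟨i, h1, h2⟩
  | rfind' c hc =>
    intro n v h
    obtain ⟨a, m, rfl⟩ := exists_pair_eq n
    obtain ⟨h0, h1, h2⟩ := (mem_evalo_rfind' ..).1 h
    have h3 : ∀ᶠ s in atTop, ∀ i ∈ Finset.Ico m v, ∃ u, u ≠ 0 ∧
        u ∈ (tr c).eval (Nat.pair (encode (initSeg A s)) (Nat.pair a i)) := by
      refine (Finset.eventually_all _).2 fun i hi => ?_
      obtain ⟨hi1, hi2⟩ := Finset.mem_Ico.1 hi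
      obtain ⟨u, hu, hu'⟩ := h2 i hi1 hi2
      filter_upwards [hc _ _ hu'] with s hs
      exact ⟨u, hu, hs⟩
    filter_upwards [hc _ _ h1, h3] with s hs1 hs3
    exact mem_eval_tr_rfind'.2 ⟨h0, hs1, fun i hi hiv => hs3 i (Finset.mem_Ico.2 ⟨hi, hiv⟩)⟩

/-- One step of the enumeration of the codes `tr (OCode.ofNat k)`, by course-of-values
recursion. -/
noncomputable def trStep (l : List Code) : Option Code :=
  if l.length = 0 then some (tr OCode.zero)
  else if l.length = 1 then some (tr OCode.succ)
  else if l.length = 2 then some (tr OCode.left)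
  else if l.length = 3 then some (tr OCode.right)
  else if l.length = 4 then some (tr OCode.oracle)
  else
    let n := l.length - 5
    let m := n.div2.div2
    let c := l.getD m Code.zero
    let c1 := l.getD m.unpair.1 Code.zero
    let c2 := l.getD m.unpair.2 Code.zero
    some (bif n.bodd then
      (bif n.div2.bodd then Code.comp (Code.rfind' (Code.comp c assocR)) assocL
       else Code.comp (Code.prec c1 (Code.comp c2 assocR)) assocL)
      else (bif n.div2.bodd then Code.comp c1 (Code.pair Code.left c2) else Code.pair c1 c2))

theorem primrec_trStep : Primrec trStep := by
  have hl : Primrec fun l : List Code => l.length - 5 :=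
    Primrec.nat_sub.comp Primrec.list_length (Primrec.const 5)
  have hm : Primrec fun l : List Code => (l.length - 5).div2.div2 :=
    Primrec.nat_div2.comp (Primrec.nat_div2.comp hl)
  have hc : Primrec fun l : List Code => l.getD (l.length - 5).div2.div2 Code.zero :=
    (Primrec.list_getD _).comp Primrec.id hm
  have hc1 : Primrec fun l : List Code =>
      l.getD (l.length - 5).div2.div2.unpair.1 Code.zero :=
    (Primrec.list_getD _).comp Primrec.id (Primrec.fst.comp (Primrec.unpair.comp hm))
  have hc2 : Primrec fun l : List Code =>
      l.getD (l.length - 5).div2.div2.unpair.2 Code.zero :=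
    (Primrec.list_getD _).comp Primrec.id (Primrec.snd.comp (Primrec.unpair.comp hm))
  have hlen : ∀ k, PrimrecPred fun l : List Code => l.length = k := fun k =>
    primrecPred_eq Primrec.list_length (Primrec.const k)
  refine Primrec.ite (hlen 0) (Primrec.const _) <| Primrec.ite (hlen 1) (Primrec.const _) <|
    Primrec.ite (hlen 2) (Primrec.const _) <| Primrec.ite (hlen 3) (Primrec.const _) <|
    Primrec.ite (hlen 4) (Primrec.const _) <| Primrec.option_some.comp <|
    Primrec.cond (Primrec.nat_bodd.comp hl)
      (Primrec.cond (Primrec.nat_bodd.comp (Primrec.nat_div2.comp hl)) ?_ ?_)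
      (Primrec.cond (Primrec.nat_bodd.comp (Primrec.nat_div2.comp hl)) ?_ ?_)
  · exact Code.primrec₂_comp.comp (Code.primrec_rfind'.comp
      (Code.primrec₂_comp.comp hc (Primrec.const _))) (Primrec.const _)
  · exact Code.primrec₂_comp.comp (Code.primrec₂_prec.comp hc1
      (Code.primrec₂_comp.comp hc2 (Primrec.const _))) (Primrec.const _)
  · exact Code.primrec₂_comp.comp hc1 (Code.primrec₂_pair.comp (Primrec.const _) hc2)
  · exact Code.primrec₂_pair.comp hc1 hc2

theorem trStep_spec (k : ℕ) :
    trStep ((List.range k).map fun i => tr (OCode.ofNat i)) = some (tr (OCode.ofNat k)) := by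
  match k with
  | 0 => simp [trStep, OCode.ofNat]
  | 1 => simp [trStep, OCode.ofNat]
  | 2 => simp [trStep, OCode.ofNat]
  | 3 => simp [trStep, OCode.ofNat]
  | 4 => simp [trStep, OCode.ofNat]
  | n + 5 =>
    have hm : n.div2.div2 < n + 5 := by
      have h1 : n.div2.div2 ≤ n := by
        simp only [Nat.div2_val]
        exact le_trans (Nat.div_le_self _ _) (Nat.div_le_self _ _)
      omega
    have hget : ∀ j < n + 5, ((List.range (n + 5)).map fun i => tr (OCode.ofNat i)).getD j
        Code.zero = tr (OCode.ofNat j) := fun j hj => by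
      rw [List.getD_eq_getElem?_getD, List.getElem?_map, List.getElem?_range hj]; rfl
    have h1 := hget _ hm
    have h2 := hget _ (lt_of_le_of_lt (Nat.unpair_left_le n.div2.div2) hm)
    have h3 := hget _ (lt_of_le_of_lt (Nat.unpair_right_le n.div2.div2) hm)
    have h4 : ((List.range (n + 5)).map fun i => tr (OCode.ofNat i)).length - 5 = n := by simp
    have h5 : ∀ j < 5, ((List.range (n + 5)).map fun i => tr (OCode.ofNat i)).length ≠ j := by
      intro j hj; simp; omega
    rw [trStep, if_neg (h5 0 (by omega)), if_neg (h5 1 (by omega)), if_neg (h5 2 (by omega)),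
      if_neg (h5 3 (by omega)), if_neg (h5 4 (by omega))]
    simp only [h4, h1, h2, h3]
    rw [OCode.ofNat]
    cases n.bodd <;> cases n.div2.bodd <;> simp [tr]

theorem primrec_tr_ofNat : Primrec fun k => tr (OCode.ofNat k) := by
  have := Primrec.nat_strong_rec (fun (_ : Unit) k => tr (OCode.ofNat k))
    (g := fun _ l => trStep l) (primrec_trStep.comp Primrec.snd) (fun _ k => trStep_spec k)
  exact this.comp (Primrec.const ()) Primrec.id

end FiniteOracle

/-! ### Finite approximations to the jump -/

section JumpIndex

open Filter

/-- The `k`-th machine is seen to halt on input `k` using the finite oracle `σ`. -/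
def Halts (k : ℕ) (σ : Str) : Prop :=
  ∃ t ≤ σ.length,
    (Code.evaln σ.length (tr (OCode.ofNat k)) (Nat.pair (encode (σ.take t)) k)).isSome

theorem primrecPred_halts {γ : Type*} [Primcodable γ] {k : γ → ℕ} {σ : γ → Str}
    (hk : Primrec k) (hσ : Primrec σ) : PrimrecPred fun x => Halts (k x) (σ x) := by
  have hf : Primrec fun x : γ × ℕ => x.1 := Primrec.fst
  refine primrecPred_exists_le (Primrec.list_length.comp hσ) (primrecPred_isSome
    (primrec_evaln (Primrec.list_length.comp (hσ.comp hf))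
      (primrec_tr_ofNat.comp (hk.comp hf)) (Primrec₂.natPair.comp
        (Primrec.encode.comp (primrec_take Primrec.snd (hσ.comp hf))) (hk.comp hf))))

theorem isSome_evaln_mono {k k' : ℕ} {c : Code} {n : ℕ} (h : k ≤ k')
    (hk : (Code.evaln k c n).isSome) : (Code.evaln k' c n).isSome := by
  obtain ⟨v, hv⟩ := Option.isSome_iff_exists.1 hk
  exact Option.isSome_iff_exists.2 ⟨v, Code.evaln_mono h hv⟩

theorem dom_of_isSome_evaln {k : ℕ} {c : Code} {n : ℕ} (hk : (Code.evaln k c n).isSome) :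
    (c.eval n).Dom := by
  obtain ⟨v, hv⟩ := Option.isSome_iff_exists.1 hk
  exact Part.dom_iff_mem.2 ⟨v, Code.evaln_sound hv⟩

theorem eventually_isSome_evaln {c : Code} {n : ℕ} (h : (c.eval n).Dom) :
    ∀ᶠ k in atTop, (Code.evaln k c n).isSome := by
  obtain ⟨v, hv⟩ := Part.dom_iff_mem.1 h
  obtain ⟨k0, hk0⟩ := exists_evaln_of_mem hv
  filter_upwards [eventually_ge_atTop k0] with k hk
  simp [hk0 k hk]

theorem take_of_prefix {σ ρ : Str} (h : σ <+: ρ) {t : ℕ} (ht : t ≤ σ.length) :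
    ρ.take t = σ.take t := by
  obtain ⟨r, rfl⟩ := h
  exact List.take_append_of_le_length ht

theorem Halts.mono {k : ℕ} {σ ρ : Str} (h : Halts k σ) (hp : σ <+: ρ) : Halts k ρ := by
  obtain ⟨t, ht, h⟩ := h
  refine ⟨t, ht.trans hp.length_le, ?_⟩
  rw [take_of_prefix hp ht]
  exact isSome_evaln_mono hp.length_le h

theorem jump_eq_one_iff_halts (A : ℕ → ℕ) (k : ℕ) :
    jump A k = 1 ↔ ∃ s, Halts k (initSeg A s) := by
  have h : jump A k = 1 ↔ (evalo A (OCode.ofNat k) k).Dom := by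
    unfold jump; split_ifs with h <;> simp [h]
  rw [h]
  constructor
  · intro h
    obtain ⟨v, hv⟩ := Part.dom_iff_mem.1 h
    obtain ⟨t, ht⟩ := (tr_complete A _ k v hv).exists
    obtain ⟨s, hs, hst⟩ := ((eventually_isSome_evaln (Part.dom_iff_mem.2 ⟨v, ht⟩)).and
      (eventually_ge_atTop t)).exists
    exact ⟨s, t, by simpa using hst, by simpa [hst] using hs⟩
  · rintro ⟨s, t, ht, h⟩
    rw [take_initSeg] at h
    obtain ⟨v, hv⟩ := Part.dom_iff_mem.1 (dom_of_isSome_evaln h)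
    exact Part.dom_iff_mem.2 ⟨v, tr_sound A _ _ k v hv⟩

theorem jump_eq_zero_or_one (A : ℕ → ℕ) (k : ℕ) : jump A k = 0 ∨ jump A k = 1 := by
  unfold jump; split_ifs <;> simp

theorem jump_eq_zero_iff (A : ℕ → ℕ) (k : ℕ) : jump A k = 0 ↔ ¬ jump A k = 1 := by
  rcases jump_eq_zero_or_one A k with h | h <;> simp [h]

theorem ocode_ofNat_add_five {n m : ℕ} (h : n / 4 = m) :
    OCode.ofNat (n + 5) = match n.bodd, n.div2.bodd with
    | false, false => OCode.pair (OCode.ofNat m.unpair.1) (OCode.ofNat m.unpair.2)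
    | false, true => OCode.comp (OCode.ofNat m.unpair.1) (OCode.ofNat m.unpair.2)
    | true, false => OCode.prec (OCode.ofNat m.unpair.1) (OCode.ofNat m.unpair.2)
    | true, true => OCode.rfind' (OCode.ofNat m) := by
  have h2 : n.div2.div2 = m := by rw [Nat.div2_val, Nat.div2_val]; omega
  rw [OCode.ofNat]
  simp only [h2]

theorem bodd_eq_decide (n : ℕ) : n.bodd = decide (n % 2 = 1) := by
  rw [Nat.mod_two_of_bodd]; cases n.bodd <;> rfl

theorem ocode_ofNat_comp (a b : ℕ) :
    OCode.ofNat (4 * Nat.pair a b + 2 + 5) = OCode.comp (OCode.ofNat a) (OCode.ofNat b) := by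
  rw [ocode_ofNat_add_five (m := Nat.pair a b) (by omega), bodd_eq_decide, bodd_eq_decide,
    Nat.div2_val, decide_eq_false (by omega), decide_eq_true (by omega)]
  simp only [Nat.unpair_pair]

theorem ocode_ofNat_pair (a b : ℕ) :
    OCode.ofNat (4 * Nat.pair a b + 5) = OCode.pair (OCode.ofNat a) (OCode.ofNat b) := by
  rw [ocode_ofNat_add_five (m := Nat.pair a b) (by omega), bodd_eq_decide, bodd_eq_decide,
    Nat.div2_val, decide_eq_false (by omega), decide_eq_false (by omega)]
  simp only [Nat.unpair_pair]

theorem ocode_ofNat_prec (a b : ℕ) :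
    OCode.ofNat (4 * Nat.pair a b + 1 + 5) = OCode.prec (OCode.ofNat a) (OCode.ofNat b) := by
  rw [ocode_ofNat_add_five (m := Nat.pair a b) (by omega), bodd_eq_decide, bodd_eq_decide,
    Nat.div2_val, decide_eq_true (by omega), decide_eq_false (by omega)]
  simp only [Nat.unpair_pair]

theorem ocode_ofNat_rfind' (m : ℕ) :
    OCode.ofNat (4 * m + 3 + 5) = OCode.rfind' (OCode.ofNat m) := by
  rw [ocode_ofNat_add_five (m := m) (by omega), bodd_eq_decide, bodd_eq_decide,
    Nat.div2_val, decide_eq_true (by omega), decide_eq_true (by omega)]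

theorem ocode_ofNat_surjective : Function.Surjective OCode.ofNat := by
  intro c
  induction c with
  | zero => exact ⟨0, by rw [OCode.ofNat]⟩
  | succ => exact ⟨1, by rw [OCode.ofNat]⟩
  | left => exact ⟨2, by rw [OCode.ofNat]⟩
  | right => exact ⟨3, by rw [OCode.ofNat]⟩
  | oracle => exact ⟨4, by rw [OCode.ofNat]⟩
  | pair c d hc hd =>
    obtain ⟨a, rfl⟩ := hc; obtain ⟨b, rfl⟩ := hd; exact ⟨_, ocode_ofNat_pair a b⟩
  | comp c d hc hd =>
    obtain ⟨a, rfl⟩ := hc; obtain ⟨b, rfl⟩ := hd; exact ⟨_, ocode_ofNat_comp a b⟩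
  | prec c d hc hd =>
    obtain ⟨a, rfl⟩ := hc; obtain ⟨b, rfl⟩ := hd; exact ⟨_, ocode_ofNat_prec a b⟩
  | rfind' c hc => obtain ⟨a, rfl⟩ := hc; exact ⟨_, ocode_ofNat_rfind' a⟩

/-- A number of an oracle code computing the constant function with value `x`. -/
def constNum : ℕ → ℕ
  | 0 => 0
  | x + 1 => 4 * Nat.pair 1 (constNum x) + 2 + 5

theorem evalo_constNum (A : ℕ → ℕ) (x n : ℕ) :
    evalo A (OCode.ofNat (constNum x)) n = Part.some x := by
  induction x with
  | zero => simp [constNum, OCode.ofNat]; rfl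
  | succ x ih =>
    rw [constNum, ocode_ofNat_comp, evalo_comp_of ih]
    simp [OCode.ofNat, evalo]

theorem primrec_constNum : Primrec constNum := by
  have h : Primrec fun y : ℕ × ℕ => 4 * Nat.pair 1 y.2 + 2 + 5 :=
    Primrec.nat_add.comp (Primrec.nat_add.comp (Primrec.nat_mul.comp (Primrec.const 4)
      (Primrec₂.natPair.comp (Primrec.const 1) Primrec.snd)) (Primrec.const 2)) (Primrec.const 5)
  refine (Primrec.nat_rec' (f := id) (g := fun _ : ℕ => 0)
    (h := fun _ y => 4 * Nat.pair 1 y.2 + 2 + 5) Primrec.id (Primrec.const 0)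
      (h.comp Primrec.snd)).of_eq fun n => ?_
  induction n with
  | zero => rfl
  | succ n ih => simp only [id] at ih ⊢; rw [constNum, ← ih]

/-- Relations that are semidecidable in the oracle are uniformly many-one reducible to its
jump. -/
theorem exists_jump_index {α : Type*} [Primcodable α] {V : α → Str → Prop}
    (hV : PrimrecPred fun x : α × Str => V x.1 x.2) :
    ∃ q : α → ℕ, Primrec q ∧ ∀ A x, jump A (q x) = 1 ↔ ∃ s, V x (initSeg A s) := by
  have h1 : Primrec₂ fun (σ : Str) (n : ℕ) =>
      (decode (α := α) n).bind fun x => if V x σ then some 0 else none := by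
    refine primrec_bind (Primrec.decode.comp Primrec.snd) (Primrec.ite
      (hV.comp (f := fun y : (Str × ℕ) × α => (y.2, y.1.1)) ?_)
      (Primrec.const _) (Primrec.const _))
    exact Primrec.pair Primrec.snd (Primrec.fst.comp Primrec.fst)
  obtain ⟨c, hc⟩ := exists_ocode_search h1.to_comp
  obtain ⟨m, rfl⟩ := ocode_ofNat_surjective c
  refine ⟨fun x => 4 * Nat.pair m (constNum (encode x)) + 2 + 5, ?_, fun A x => ?_⟩
  · exact Primrec.nat_add.comp (Primrec.nat_add.comp (Primrec.nat_mul.comp (Primrec.const 4)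
      (Primrec₂.natPair.comp (Primrec.const m) (primrec_constNum.comp Primrec.encode)))
      (Primrec.const 2)) (Primrec.const 5)
  · have : ∀ k, jump A k = 1 ↔ (evalo A (OCode.ofNat k) k).Dom := fun k => by
      unfold jump; split_ifs with h <;> simp [h]
    rw [this, ocode_ofNat_comp, evalo_comp_of (evalo_constNum A _ _), (hc A _).2]
    refine exists_congr fun s => ?_
    by_cases h : V x (initSeg A s) <;> simp [h]

/-- The `p`-th semidecidable event has been verified at the pair of strings `υ, α`. -/
def Ev (p : ℕ) (υ α : Str) : Prop :=
  ∃ t ≤ υ.length, (Code.evaln υ.length (Denumerable.ofNat Code p)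
    (encode (υ.take t, α.take t))).isSome

theorem primrecPred_ev {γ : Type*} [Primcodable γ] {p : γ → ℕ} {υ α : γ → Str}
    (hp : Primrec p) (hυ : Primrec υ) (hα : Primrec α) :
    PrimrecPred fun x => Ev (p x) (υ x) (α x) := by
  have hf : Primrec fun x : γ × ℕ => x.1 := Primrec.fst
  exact primrecPred_exists_le (Primrec.list_length.comp hυ) (primrecPred_isSome
    (primrec_evaln (Primrec.list_length.comp (hυ.comp hf))
      ((Primrec.ofNat Code).comp (hp.comp hf)) (Primrec.encode.comp
        (Primrec.pair (primrec_take Primrec.snd (hυ.comp hf))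
          (primrec_take Primrec.snd (hα.comp hf))))))

/-- `Ev` with a total second component. -/
def EvA (A : ℕ → ℕ) (p : ℕ) (υ : Str) : Prop := Ev p υ (initSeg A υ.length)

theorem ev_initSeg {A : ℕ → ℕ} {p : ℕ} {υ : Str} {s : ℕ} (hs : υ.length ≤ s) :
    Ev p υ (initSeg A s) ↔ EvA A p υ := by
  refine exists_congr fun t => and_congr_right fun ht => ?_
  rw [take_initSeg_le A ht, take_initSeg_le A (ht.trans hs)]

theorem evA_def {A : ℕ → ℕ} {p : ℕ} {υ : Str} : EvA A p υ ↔ ∃ t ≤ υ.length,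
    (Code.evaln υ.length (Denumerable.ofNat Code p)
      (encode (υ.take t, initSeg A t))).isSome := by
  refine exists_congr fun t => and_congr_right fun ht => ?_
  rw [take_initSeg_le A ht]

theorem EvA.mono {A : ℕ → ℕ} {p : ℕ} {υ ρ : Str} (h : EvA A p υ) (hp : υ <+: ρ) :
    EvA A p ρ := by
  rw [evA_def] at h ⊢
  obtain ⟨t, ht, h⟩ := h
  refine ⟨t, ht.trans hp.length_le, ?_⟩
  rw [take_of_prefix hp ht]
  exact isSome_evaln_mono hp.length_le h

theorem exists_evA_iff {A Y : ℕ → ℕ} {p : ℕ} : (∃ s, EvA A p (initSeg Y s)) ↔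
    ∃ t, ((Denumerable.ofNat Code p).eval (encode (initSeg Y t, initSeg A t))).Dom := by
  simp only [evA_def, length_initSeg]
  constructor
  · rintro ⟨s, t, ht, h⟩
    rw [take_initSeg_le Y ht] at h
    exact ⟨t, dom_of_isSome_evaln h⟩
  · rintro ⟨t, h⟩
    obtain ⟨s, hs, hts⟩ := ((eventually_isSome_evaln h).and (eventually_ge_atTop t)).exists
    exact ⟨s, t, hts, by rwa [take_initSeg_le Y hts]⟩

theorem exists_le_dom_of_evA {A Y : ℕ → ℕ} {p s : ℕ} (h : EvA A p (initSeg Y s)) :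
    ∃ t ≤ s, ((Denumerable.ofNat Code p).eval (encode (initSeg Y t, initSeg A t))).Dom := by
  simp only [evA_def, length_initSeg] at h
  obtain ⟨t, ht, h⟩ := h
  rw [take_initSeg_le Y ht] at h
  exact ⟨t, ht, dom_of_isSome_evaln h⟩

theorem exists_forceIndex : ∃ q : ℕ × Str → ℕ, Primrec q ∧ ∀ A x,
    jump A (q x) = 1 ↔ ∃ ρ, x.2 <+: ρ ∧ EvA A x.1 ρ := by
  have hV : PrimrecPred fun x : (ℕ × Str) × Str => ∃ c ≤ x.2.length,
      x.1.2 <+: Denumerable.ofNat Str c ∧ Ev x.1.1 (Denumerable.ofNat Str c) x.2 := by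
    refine primrecPred_exists_le (Primrec.list_length.comp Primrec.snd) (.and ?_ ?_)
    · exact primrecPred_prefix (Primrec.snd.comp (Primrec.fst.comp Primrec.fst))
        ((Primrec.ofNat Str).comp Primrec.snd)
    · exact primrecPred_ev (Primrec.fst.comp (Primrec.fst.comp Primrec.fst))
        ((Primrec.ofNat Str).comp Primrec.snd) (Primrec.snd.comp Primrec.fst)
  obtain ⟨q, hq, h⟩ := exists_jump_index (V := fun (x : ℕ × Str) σ => ∃ c ≤ σ.length,
      x.2 <+: Denumerable.ofNat Str c ∧ Ev x.1 (Denumerable.ofNat Str c) σ) hV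
  refine ⟨q, hq, fun A x => (h A x).trans ?_⟩
  have hlen : ∀ ρ : Str, ρ.length ≤ encode ρ := fun ρ => Encodable.length_le_encode ρ
  constructor
  · rintro ⟨s, c, hc, h1, h2⟩
    refine ⟨_, h1, (ev_initSeg ?_).1 h2⟩
    have := hlen (Denumerable.ofNat Str c)
    rw [Denumerable.encode_ofNat] at this
    simp only [length_initSeg] at hc
    exact this.trans hc
  · rintro ⟨ρ, h1, h2⟩
    refine ⟨encode ρ, encode ρ, by simp, ?_⟩
    rw [Denumerable.ofNat_encode]
    exact ⟨h1, (ev_initSeg (hlen ρ)).2 h2⟩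

theorem exists_evIndex : ∃ q : ℕ × Str → ℕ, Primrec q ∧ ∀ A x,
    jump A (q x) = 1 ↔ EvA A x.1 x.2 := by
  have hV : PrimrecPred fun x : (ℕ × Str) × Str => x.1.2.length ≤ x.2.length ∧
      Ev x.1.1 x.1.2 x.2 :=
    .and (primrecPred_le (Primrec.list_length.comp (Primrec.snd.comp Primrec.fst))
      (Primrec.list_length.comp Primrec.snd)) (primrecPred_ev
        (Primrec.fst.comp Primrec.fst) (Primrec.snd.comp Primrec.fst) Primrec.snd)
  obtain ⟨q, hq, h⟩ := exists_jump_index (V := fun (x : ℕ × Str) σ =>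
    x.2.length ≤ σ.length ∧ Ev x.1 x.2 σ) hV
  refine ⟨q, hq, fun A x => (h A x).trans ?_⟩
  simp only [length_initSeg]
  constructor
  · rintro ⟨s, h1, h2⟩; exact (ev_initSeg h1).1 h2
  · intro h; exact ⟨_, le_rfl, h⟩

theorem exists_entryIndex : ∃ q : ℕ × ℕ → ℕ, Primrec q ∧ ∀ A x,
    jump A (q x) = 1 ↔ A x.1 = x.2 := by
  have hV : PrimrecPred fun x : (ℕ × ℕ) × Str => x.2[x.1.1]? = some x.1.2 :=
    primrecPred_eq (primrec_getElem Primrec.snd (Primrec.fst.comp Primrec.fst))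
      (Primrec.option_some.comp (Primrec.snd.comp Primrec.fst))
  obtain ⟨q, hq, h⟩ := exists_jump_index (V := fun (x : ℕ × ℕ) (σ : Str) =>
    σ[x.1]? = some x.2) hV
  refine ⟨q, hq, fun A x => (h A x).trans ?_⟩
  simp only [getElem?_initSeg_eq_some]
  exact ⟨fun ⟨s, _, h⟩ => h, fun h => ⟨x.1 + 1, by simp, h⟩⟩

/-- An event index decided by the jump. -/
theorem exists_domIndex : ∃ q : ℕ → ℕ, Primrec q ∧ ∀ A p, jump A (q p) = 1 ↔
    ∃ t, ((Denumerable.ofNat Code p).eval (encode (initSeg A t))).Dom := by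
  have hV : PrimrecPred fun x : ℕ × Str => ∃ t ≤ x.2.length,
      (Code.evaln x.2.length (Denumerable.ofNat Code x.1) (encode (x.2.take t))).isSome := by
    have hf : Primrec fun x : (ℕ × Str) × ℕ => x.1 := Primrec.fst
    exact primrecPred_exists_le (Primrec.list_length.comp Primrec.snd) (primrecPred_isSome
      (primrec_evaln (Primrec.list_length.comp (Primrec.snd.comp hf))
        ((Primrec.ofNat Code).comp (Primrec.fst.comp hf)) (Primrec.encode.comp
          (primrec_take Primrec.snd (Primrec.snd.comp hf)))))
  obtain ⟨q, hq, h⟩ := exists_jump_index (V := fun (p : ℕ) (σ : Str) => ∃ t ≤ σ.length,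
      (Code.evaln σ.length (Denumerable.ofNat Code p) (encode (σ.take t))).isSome) hV
  refine ⟨q, hq, fun A p => (h A p).trans ?_⟩
  simp only [length_initSeg]
  constructor
  · rintro ⟨s, t, ht, h⟩
    rw [take_initSeg_le A ht] at h
    exact ⟨t, dom_of_isSome_evaln h⟩
  · rintro ⟨t, h⟩
    obtain ⟨s, hs, hts⟩ := ((eventually_isSome_evaln h).and (eventually_ge_atTop t)).exists
    exact ⟨s, t, hts, by rwa [take_initSeg_le A hts]⟩

noncomputable def qE : ℕ × Str → ℕ := exists_forceIndex.choose
noncomputable def qD : ℕ × Str → ℕ := exists_evIndex.choose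
noncomputable def qV : ℕ × ℕ → ℕ := exists_entryIndex.choose

theorem primrec_qE : Primrec qE := exists_forceIndex.choose_spec.1
theorem primrec_qD : Primrec qD := exists_evIndex.choose_spec.1
theorem primrec_qV : Primrec qV := exists_entryIndex.choose_spec.1

theorem jump_qE (A : ℕ → ℕ) (p : ℕ) (τ : Str) :
    jump A (qE (p, τ)) = 1 ↔ ∃ ρ, τ <+: ρ ∧ EvA A p ρ := exists_forceIndex.choose_spec.2 A (p, τ)
theorem jump_qD (A : ℕ → ℕ) (p : ℕ) (τ : Str) :
    jump A (qD (p, τ)) = 1 ↔ EvA A p τ := exists_evIndex.choose_spec.2 A (p, τ)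
theorem jump_qV (A : ℕ → ℕ) (i v : ℕ) :
    jump A (qV (i, v)) = 1 ↔ A i = v := exists_entryIndex.choose_spec.2 A (i, v)

end JumpIndex

/-! ### Treemaps forcing the jump -/

section Forcing

open Filter

/-- The approximation to the jump obtained from a finite part of the oracle. -/
noncomputable def apx (α : Str) : Str :=
  (List.range α.length).map fun i => if Halts i α then 1 else 0

theorem primrec_apx : Primrec apx :=
  primrec_map (Primrec.list_range.comp Primrec.list_length) (Primrec.ite
    (primrecPred_halts Primrec.snd Primrec.fst) (Primrec.const 1) (Primrec.const 0))

theorem take_apx_initSeg (A : ℕ → ℕ) (k : ℕ) :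
    ∀ᶠ b in atTop, (apx (initSeg A b)).take k = initSeg (jump A) k := by
  have h1 : ∀ᶠ b in atTop, ∀ i ∈ Finset.range k,
      (if Halts i (initSeg A b) then 1 else 0) = jump A i := by
    refine (Finset.eventually_all _).2 fun i _ => ?_
    rcases jump_eq_zero_or_one A i with h | h
    · refine Eventually.of_forall fun b => ?_
      rw [h, if_neg]
      intro hb
      have := (jump_eq_one_iff_halts A i).2 ⟨b, hb⟩
      omega
    · obtain ⟨s, hs⟩ := (jump_eq_one_iff_halts A i).1 h
      filter_upwards [eventually_ge_atTop s] with b hb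
      rw [h, if_pos (hs.mono (initSeg_prefix A hb))]
  filter_upwards [h1, eventually_ge_atTop k] with b hb hk
  simp only [apx, length_initSeg, ← List.map_take, List.take_range, min_eq_left hk]
  exact List.map_congr_left fun i hi => hb i (by simpa using hi)

/-- The extension of `τ` made at stage `k`: for `k ≥ n` this is an extension at which the
event `k - n` is verified, if there is one according to `β`. -/
noncomputable def ext (n : ℕ) (β : Str) (k : ℕ) (τ : Str) : Option Str :=
  if k < n then some τ else (β[qE (k - n, τ)]?).bind fun v =>
    if v = 0 then some τ else (some (leastLt β.length fun c =>
      τ <+: Denumerable.ofNat Str c ∧ ¬ β[qD (k - n, Denumerable.ofNat Str c)]? = some 0)).bind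
      fun c => if τ <+: Denumerable.ofNat Str c ∧
          β[qD (k - n, Denumerable.ofNat Str c)]? = some 1 then
        some (Denumerable.ofNat Str c) else none

theorem primrec_ext {γ : Type*} [Primcodable γ] {n k : γ → ℕ} {β τ : γ → Str}
    (hn : Primrec n) (hβ : Primrec β) (hk : Primrec k) (hτ : Primrec τ) :
    Primrec fun x => ext (n x) (β x) (k x) (τ x) := by
  have hp : Primrec fun x => k x - n x := Primrec.nat_sub.comp hk hn
  refine Primrec.ite (primrecPred_lt hk hn) (Primrec.option_some.comp hτ) (primrec_bind
    (primrec_getElem hβ (primrec_qE.comp (Primrec.pair hp hτ))) ?_)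
  have hf : Primrec fun y : γ × ℕ => y.1 := Primrec.fst
  refine Primrec.ite (primrecPred_eq Primrec.snd (Primrec.const 0))
    (Primrec.option_some.comp (hτ.comp hf)) (primrec_bind (Primrec.option_some.comp
      (primrec_leastLt (Primrec.list_length.comp (hβ.comp hf)) (.and ?_ (.not ?_)))) ?_)
  · exact primrecPred_prefix (hτ.comp (hf.comp Primrec.fst))
      ((Primrec.ofNat Str).comp Primrec.snd)
  · exact primrecPred_eq (primrec_getElem (hβ.comp (hf.comp Primrec.fst)) (primrec_qD.comp
      (Primrec.pair (hp.comp (hf.comp Primrec.fst)) ((Primrec.ofNat Str).comp Primrec.snd))))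
      (Primrec.const _)
  · have hg : Primrec fun y : (γ × ℕ) × ℕ => y.1.1 := hf.comp Primrec.fst
    refine Primrec.ite (.and (primrecPred_prefix (hτ.comp hg)
      ((Primrec.ofNat Str).comp Primrec.snd)) (primrecPred_eq (primrec_getElem (hβ.comp hg)
        (primrec_qD.comp (Primrec.pair (hp.comp hg) ((Primrec.ofNat Str).comp Primrec.snd))))
        (Primrec.const _))) (Primrec.option_some.comp ((Primrec.ofNat Str).comp Primrec.snd))
      (Primrec.const _)

theorem prefix_of_ext {n k : ℕ} {β τ ρ : Str} (h : ext n β k τ = some ρ) : τ <+: ρ := by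
  unfold ext at h
  split_ifs at h with h1
  · simp only [Option.some.injEq] at h; rw [h]
  · obtain ⟨v, -, h⟩ := Option.bind_eq_some_iff.1 h
    split_ifs at h with h2
    · simp only [Option.some.injEq] at h; rw [h]
    · simp only [Option.bind_some] at h
      split_ifs at h with h3
      simp only [Option.some.injEq] at h
      rw [← h]; exact h3.1

/-- The extension made at stage `k` according to the true jump of `A`. -/
noncomputable def extT (A : ℕ → ℕ) (n k : ℕ) (τ : Str) : Str :=
  if k < n then τ else
    if h : ∃ c, τ <+: Denumerable.ofNat Str c ∧ EvA A (k - n) (Denumerable.ofNat Str c) then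
      Denumerable.ofNat Str (Nat.find h) else τ

theorem extT_of_lt (A : ℕ → ℕ) {n k : ℕ} (h : k < n) (τ : Str) : extT A n k τ = τ := if_pos h

theorem prefix_extT (A : ℕ → ℕ) (n k : ℕ) (τ : Str) : τ <+: extT A n k τ := by
  unfold extT
  split_ifs with h1 h2
  · exact List.prefix_refl _
  · exact (Nat.find_spec h2).1
  · exact List.prefix_refl _

theorem evA_extT {A : ℕ → ℕ} {n k : ℕ} {τ ρ : Str} (hk : n ≤ k) (hρ : τ <+: ρ)
    (h : EvA A (k - n) ρ) : EvA A (k - n) (extT A n k τ) := by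
  have h2 : ∃ c, τ <+: Denumerable.ofNat Str c ∧ EvA A (k - n) (Denumerable.ofNat Str c) :=
    ⟨encode ρ, by simpa using ⟨hρ, h⟩⟩
  rw [extT, if_neg (by omega), dif_pos h2]
  exact (Nat.find_spec h2).2

theorem jump_qD_zero {A : ℕ → ℕ} {p : ℕ} {τ : Str} :
    jump A (qD (p, τ)) = 0 ↔ ¬ EvA A p τ := by rw [jump_eq_zero_iff, jump_qD]

theorem ext_sound {A : ℕ → ℕ} {n m k : ℕ} {τ ρ : Str}
    (h : ext n (initSeg (jump A) m) k τ = some ρ) : ρ = extT A n k τ := by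
  unfold ext at h
  unfold extT
  split_ifs at h with h1
  · rw [if_pos h1]; simpa using h.symm
  rw [if_neg h1]
  obtain ⟨v, hv, h⟩ := Option.bind_eq_some_iff.1 h
  rw [getElem?_initSeg_eq_some] at hv
  split_ifs at h with h2
  · have h3 := hv.2.trans h2
    rw [jump_eq_zero_iff, jump_qE] at h3
    rw [dif_neg]
    · simpa using h.symm
    · rintro ⟨c, hc⟩; exact h3 ⟨_, hc⟩
  · simp only [Option.bind_some] at h
    set c := leastLt (initSeg (jump A) m).length fun c => τ <+: Denumerable.ofNat Str c ∧
      ¬ (initSeg (jump A) m)[qD (k - n, Denumerable.ofNat Str c)]? = some 0 with hc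
    split_ifs at h with h3
    have h4 := h3.2
    rw [getElem?_initSeg_eq_some, jump_qD] at h4
    have hex : ∃ c, τ <+: Denumerable.ofNat Str c ∧ EvA A (k - n) (Denumerable.ofNat Str c) :=
      ⟨c, h3.1, h4.2⟩
    rw [dif_pos hex]
    have : Nat.find hex = c := by
      rw [Nat.find_eq_iff]
      refine ⟨⟨h3.1, h4.2⟩, fun b hb hbc => ?_⟩
      refine not_of_lt_leastLt (hc ▸ hb) ⟨hbc.1, fun h5 => ?_⟩
      rw [getElem?_initSeg_eq_some, jump_qD_zero] at h5
      exact h5.2 hbc.2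
    rw [this]; simpa using h.symm

theorem getElem?_of_take_eq {β : Str} {B : ℕ → ℕ} {m i : ℕ} (h : β.take m = initSeg B m)
    (hi : i < m) : β[i]? = some (B i) := by
  rw [← List.getElem?_take_of_lt hi, h, getElem?_initSeg_lt B hi]

theorem le_length_of_take_eq {β : Str} {B : ℕ → ℕ} {m : ℕ} (h : β.take m = initSeg B m) :
    m ≤ β.length := by
  have := congrArg List.length h
  simp only [List.length_take, length_initSeg] at this
  omega

theorem take_eq_mono {β : Str} {B : ℕ → ℕ} {m k : ℕ} (h : β.take m = initSeg B m)
    (hk : k ≤ m) : β.take k = initSeg B k := by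
  rw [← take_initSeg_le B hk, ← h, List.take_take, min_eq_left hk]

theorem ext_complete (A : ℕ → ℕ) (n k : ℕ) (τ : Str) : ∃ m0, ∀ β : Str,
    β.take m0 = initSeg (jump A) m0 → ext n β k τ = some (extT A n k τ) := by
  by_cases h1 : k < n
  · exact ⟨0, fun β _ => by rw [ext, extT, if_pos h1, if_pos h1]⟩
  by_cases hex : ∃ c, τ <+: Denumerable.ofNat Str c ∧ EvA A (k - n) (Denumerable.ofNat Str c)
  · set c := Nat.find hex with hc
    have hb : ∃ m, ∀ b ≤ c, qD (k - n, Denumerable.ofNat Str b) < m := by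
      refine ⟨((Finset.range (c + 1)).sup fun b => qD (k - n, Denumerable.ofNat Str b)) + 1,
        fun b hb => Nat.lt_succ_of_le (Finset.le_sup (f := fun b =>
          qD (k - n, Denumerable.ofNat Str b)) (by simpa using Nat.lt_succ_of_le hb))⟩
    obtain ⟨m1, hm1⟩ := hb
    refine ⟨max (max m1 (c + 1)) (qE (k - n, τ) + 1), fun β hβ => ?_⟩
    have h2 : β[qE (k - n, τ)]? = some 1 := by
      rw [getElem?_of_take_eq hβ (by omega), (jump_qE A _ _).2]
      exact ⟨_, Nat.find_spec hex⟩
    have h3 : ∀ b ≤ c, β[qD (k - n, Denumerable.ofNat Str b)]? =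
        some (jump A (qD (k - n, Denumerable.ofNat Str b))) := fun b hb =>
      getElem?_of_take_eq hβ (by have := hm1 b hb; omega)
    have h4 : leastLt β.length (fun c => τ <+: Denumerable.ofNat Str c ∧
        ¬ β[qD (k - n, Denumerable.ofNat Str c)]? = some 0) = c := by
      refine leastLt_eq (by have := le_length_of_take_eq hβ; omega) ⟨(Nat.find_spec hex).1, ?_⟩ ?_
      · rw [h3 _ le_rfl, Option.some_inj, jump_qD_zero]
        exact not_not.2 (Nat.find_spec hex).2
      · rintro b hb ⟨h5, h6⟩
        rw [h3 _ hb.le, Option.some_inj, jump_qD_zero, not_not] at h6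
        exact Nat.find_min hex hb ⟨h5, h6⟩
    rw [ext, extT, if_neg h1, if_neg h1, h2, dif_pos hex, Option.bind_some, if_neg one_ne_zero,
      h4, Option.bind_some, if_pos]
    refine ⟨(Nat.find_spec hex).1, ?_⟩
    rw [h3 _ le_rfl, (jump_qD A _ _).2 (Nat.find_spec hex).2]
  · refine ⟨qE (k - n, τ) + 1, fun β hβ => ?_⟩
    have h2 : β[qE (k - n, τ)]? = some 0 := by
      rw [getElem?_of_take_eq hβ (by omega), Option.some_inj, jump_eq_zero_iff, jump_qE]
      rintro ⟨ρ, hρ⟩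
      exact hex ⟨encode ρ, by simpa using hρ⟩
    rw [ext, extT, if_neg h1, if_neg h1, h2, dif_neg hex, Option.bind_some, if_pos rfl]

/-- The treemap built from the approximation `β` to the jump, following the selector `sel`. -/
noncomputable def treeG (n : ℕ) (β : Str) (sel : ℕ → Str → Option ℕ) : ℕ → Option Str
  | 0 => some []
  | k + 1 => (treeG n β sel k).bind fun τ => (sel k τ).bind fun a => ext n β k (τ ++ [a])

theorem primrec_treeG {γ : Type*} [Primcodable γ] {n k : γ → ℕ} {β : γ → Str}
    {sel : γ → ℕ → Str → Option ℕ} (hn : Primrec n) (hβ : Primrec β)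
    (hs : Primrec fun x : γ × (ℕ × Str) => sel x.1 x.2.1 x.2.2) (hk : Primrec k) :
    Primrec fun x => treeG (n x) (β x) (sel x) (k x) := by
  refine (Primrec.nat_rec' (f := k) (g := fun _ : γ => some ([] : Str))
    (h := fun x y => y.2.bind fun τ => (sel x y.1 τ).bind fun a => ext (n x) (β x) y.1 (τ ++ [a]))
    hk (Primrec.const _) ?_).of_eq fun x => ?_
  · have hx : Primrec fun z : (γ × (ℕ × Option Str)) × Str => z.1.1 :=
      Primrec.fst.comp Primrec.fst
    have hj : Primrec fun z : (γ × (ℕ × Option Str)) × Str => z.1.2.1 :=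
      Primrec.fst.comp (Primrec.snd.comp Primrec.fst)
    refine primrec_bind (Primrec.snd.comp Primrec.snd) (primrec_bind
      (hs.comp (Primrec.pair hx (Primrec.pair hj Primrec.snd)))
      (primrec_ext (hn.comp (hx.comp Primrec.fst)) (hβ.comp (hx.comp Primrec.fst))
        (hj.comp Primrec.fst) (Primrec.list_append.comp (Primrec.snd.comp Primrec.fst)
          (Primrec.list_cons.comp Primrec.snd (Primrec.const [])))))
  · induction k x with
    | zero => rfl
    | succ j ih => simp only at ih ⊢; rw [treeG, ← ih]

theorem treeG_succ_eq_some {n k : ℕ} {β ρ : Str} {sel : ℕ → Str → Option ℕ}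
    (h : treeG n β sel (k + 1) = some ρ) : ∃ τ a, treeG n β sel k = some τ ∧ sel k τ = some a ∧
      τ ++ [a] <+: ρ := by
  obtain ⟨τ, h1, h⟩ := Option.bind_eq_some_iff.1 h
  obtain ⟨a, h2, h⟩ := Option.bind_eq_some_iff.1 h
  exact ⟨τ, a, h1, h2, prefix_of_ext h⟩

theorem treeG_of_le {n k : ℕ} {β ρ : Str} {sel : ℕ → Str → Option ℕ}
    (h : treeG n β sel k = some ρ) {j : ℕ} (hj : j ≤ k) :
    ∃ τ, treeG n β sel j = some τ ∧ τ <+: ρ := by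
  induction k generalizing ρ with
  | zero => obtain rfl : j = 0 := by omega
            exact ⟨ρ, h, List.prefix_refl _⟩
  | succ k ih =>
    rcases Nat.lt_or_ge j (k + 1) with hj' | hj'
    · obtain ⟨τ, a, h1, -, h2⟩ := treeG_succ_eq_some h
      obtain ⟨τ', h3, h4⟩ := ih h1 (by omega)
      exact ⟨τ', h3, h4.trans ((List.prefix_append _ _).trans h2)⟩
    · obtain rfl : j = k + 1 := by omega
      exact ⟨ρ, h, List.prefix_refl _⟩

/-- The image of `X↾k` under the true treemap. -/
noncomputable def treeF (A : ℕ → ℕ) (n : ℕ) (X : ℕ → ℕ) : ℕ → Str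
  | 0 => []
  | k + 1 => extT A n k (treeF A n X k ++ [X k])

theorem treeF_append_prefix (A : ℕ → ℕ) (n : ℕ) (X : ℕ → ℕ) (k : ℕ) :
    treeF A n X k ++ [X k] <+: treeF A n X (k + 1) := prefix_extT A n k _

theorem treeF_prefix (A : ℕ → ℕ) (n : ℕ) (X : ℕ → ℕ) {j k : ℕ} (h : j ≤ k) :
    treeF A n X j <+: treeF A n X k := by
  induction k, h using Nat.le_induction with
  | base => exact List.prefix_refl _
  | succ k _ ih =>
    exact ih.trans ((List.prefix_append _ _).trans (treeF_append_prefix A n X k))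

theorem le_length_treeF (A : ℕ → ℕ) (n : ℕ) (X : ℕ → ℕ) (k : ℕ) :
    k ≤ (treeF A n X k).length := by
  induction k with
  | zero => omega
  | succ k ih =>
    have := (treeF_append_prefix A n X k).length_le
    simp only [List.length_append, List.length_singleton] at this
    omega

theorem treeF_of_le (A : ℕ → ℕ) {n : ℕ} (X : ℕ → ℕ) {k : ℕ} (h : k ≤ n) :
    treeF A n X k = initSeg X k := by
  induction k with
  | zero => rfl
  | succ k ih => rw [treeF, extT_of_lt A (by omega), ih (by omega), initSeg_succ]

theorem treeF_congr (A : ℕ → ℕ) (n : ℕ) {X X' : ℕ → ℕ} {k : ℕ} (h : ∀ i < k, X i = X' i) :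
    treeF A n X k = treeF A n X' k := by
  induction k with
  | zero => rfl
  | succ k ih => rw [treeF, treeF, ih fun i hi => h i (by omega), h k (by omega)]

theorem treeG_sound {A : ℕ → ℕ} {n m k : ℕ} {X : ℕ → ℕ} {sel : ℕ → Str → Option ℕ} {τ : Str}
    (hs : ∀ j < k, ∀ a, sel j (treeF A n X j) = some a → X j = a)
    (h : treeG n (initSeg (jump A) m) sel k = some τ) : τ = treeF A n X k := by
  induction k generalizing τ with
  | zero => simpa [treeG, treeF] using h.symm
  | succ k ih =>
    obtain ⟨ρ, h1, h⟩ := Option.bind_eq_some_iff.1 h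
    obtain ⟨a, h2, h⟩ := Option.bind_eq_some_iff.1 h
    obtain rfl := ih (fun j hj => hs j (by omega)) h1
    rw [ext_sound h, ← hs k (by omega) a h2, treeF]

theorem treeG_complete (A : ℕ → ℕ) (n : ℕ) (X : ℕ → ℕ) (k : ℕ) : ∃ m0, ∀ (β : Str)
    (sel : ℕ → Str → Option ℕ), β.take m0 = initSeg (jump A) m0 →
    (∀ j < k, sel j (treeF A n X j) = some (X j)) → treeG n β sel k = some (treeF A n X k) := by
  induction k with
  | zero => exact ⟨0, fun _ _ _ _ => rfl⟩
  | succ k ih =>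
    obtain ⟨m1, h1⟩ := ih
    obtain ⟨m2, h2⟩ := ext_complete A n k (treeF A n X k ++ [X k])
    refine ⟨max m1 m2, fun β sel hβ hs => ?_⟩
    rw [treeG, h1 β sel (take_eq_mono hβ (le_max_left _ _)) fun j hj => hs j (by omega),
      Option.bind_some, hs k (by omega), Option.bind_some, treeF,
      h2 β (take_eq_mono hβ (le_max_right _ _))]

/-- The image of `X` under the true treemap. -/
noncomputable def treeY (A : ℕ → ℕ) (n : ℕ) (X : ℕ → ℕ) (i : ℕ) : ℕ :=
  (treeF A n X (i + 1)).getD i 0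

theorem treeF_eq_initSeg (A : ℕ → ℕ) (n : ℕ) (X : ℕ → ℕ) (k : ℕ) :
    treeF A n X k = initSeg (treeY A n X) (treeF A n X k).length := by
  rw [eq_initSeg_iff]
  intro i v hv
  have h1 : i < (treeF A n X (i + 1)).length := le_length_treeF A n X (i + 1)
  have h2 : (treeF A n X (i + 1))[i]? = some v := by
    rcases le_total k (i + 1) with h | h
    · obtain ⟨r, hr⟩ := treeF_prefix A n X h
      have hi : i < (treeF A n X k).length := by
        by_contra hc
        rw [List.getElem?_eq_none (not_lt.1 hc)] at hv
        exact absurd hv (by simp)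
      rw [← hr, List.getElem?_append_left hi]
      exact hv
    · obtain ⟨r, hr⟩ := treeF_prefix A n X h
      rw [← hr, List.getElem?_append_left h1] at hv
      exact hv
  rw [treeY, List.getD_eq_getElem?_getD, h2, Option.getD_some]

theorem treeY_length (A : ℕ → ℕ) (n : ℕ) (X : ℕ → ℕ) (k : ℕ) :
    treeY A n X (treeF A n X k).length = X k := by
  have h := treeF_append_prefix A n X k
  rw [treeF_eq_initSeg A n X (k + 1), prefix_initSeg_iff] at h
  obtain ⟨h1, h2⟩ := h
  have := eq_initSeg_iff.1 h2 (treeF A n X k).length (X k) (by simp)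
  exact this

theorem treeY_of_lt (A : ℕ → ℕ) {n : ℕ} (X : ℕ → ℕ) {i : ℕ} (h : i < n) :
    treeY A n X i = X i := by
  rw [treeY, treeF_of_le A X h, List.getD_eq_getElem?_getD, getElem?_initSeg_lt X (by omega),
    Option.getD_some]

theorem evA_treeF {A : ℕ → ℕ} {n p : ℕ} {X : ℕ → ℕ} {ρ : Str}
    (hρ : treeF A n X (n + p) ++ [X (n + p)] <+: ρ) (h : EvA A p ρ) :
    EvA A p (treeF A n X (n + p + 1)) := by
  have := evA_extT (A := A) (n := n) (k := n + p) (by omega) hρ (by simpa using h)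
  rwa [Nat.add_sub_cancel_left] at this

theorem evA_treeF_of_exists {A : ℕ → ℕ} {n p : ℕ} {X : ℕ → ℕ}
    (h : ∃ s, EvA A p (initSeg (treeY A n X) s)) : EvA A p (treeF A n X (n + p + 1)) := by
  obtain ⟨s, h⟩ := h
  set L := (treeF A n X (n + p) ++ [X (n + p)]).length with hL
  refine evA_treeF (ρ := initSeg (treeY A n X) (max s L)) ?_
    (h.mono (initSeg_prefix _ (le_max_left _ _)))
  have h2 := treeF_append_prefix A n X (n + p)
  rw [treeF_eq_initSeg A n X (n + p + 1), prefix_initSeg_iff] at h2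
  rw [prefix_initSeg_iff]
  exact ⟨le_max_right _ _, h2.2⟩

/-- The true decoding of the treemap. -/
noncomputable def decF (A : ℕ → ℕ) (n : ℕ) (Y : ℕ → ℕ) : ℕ → Str
  | 0 => []
  | k + 1 => extT A n k (decF A n Y k ++ [Y (decF A n Y k).length])

/-- The preimage of `Y` under the true treemap, if there is one. -/
noncomputable def decX (A : ℕ → ℕ) (n : ℕ) (Y : ℕ → ℕ) (k : ℕ) : ℕ := Y (decF A n Y k).length

theorem treeF_decX (A : ℕ → ℕ) (n : ℕ) (Y : ℕ → ℕ) (k : ℕ) :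
    treeF A n (decX A n Y) k = decF A n Y k := by
  induction k with
  | zero => rfl
  | succ k ih => rw [treeF, ih, decF, decX]

theorem decX_treeY (A : ℕ → ℕ) (n : ℕ) (X : ℕ → ℕ) : decX A n (treeY A n X) = X := by
  have : ∀ k, decF A n (treeY A n X) k = treeF A n X k := fun k => by
    induction k with
    | zero => rfl
    | succ k ih => rw [decF, ih, treeY_length, treeF]
  ext k
  rw [decX, this, treeY_length]

/-- If arbitrarily long approximations map into `Y`, then `Y` is in the range. -/
theorem treeY_decX {A : ℕ → ℕ} {n : ℕ} {Y : ℕ → ℕ}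
    (h : ∀ k, decF A n Y k = initSeg Y (decF A n Y k).length) : treeY A n (decX A n Y) = Y := by
  ext i
  have h1 := treeF_decX A n Y (i + 1)
  have h2 := le_length_treeF A n (decX A n Y) (i + 1)
  rw [treeY, List.getD_eq_getElem?_getD, h1, h, getElem?_initSeg_lt, Option.getD_some]
  rw [← h1]; exact h2

end Forcing

/-! ### One step of the construction -/

section Step

open Filter

theorem primrecPred_exists_option {γ β : Type*} [Primcodable γ] [Primcodable β]
    {f : γ → Option β} {R : γ → β → Prop} (hf : Primrec f)
    (hR : PrimrecPred fun x : γ × β => R x.1 x.2) :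
    PrimrecPred fun x => ∃ b, f x = some b ∧ R x b := by
  refine (primrecPred_isSome (primrec_bind hf
    (g := fun x b => if R x b then some b else none) (Primrec.ite hR
      (Primrec.option_some.comp Primrec.snd) (Primrec.const none)))).of_eq fun x => ?_
  cases f x with
  | none => simp
  | some b => by_cases h : R x b <;> simp [h]

/-- The selector following the string `σ`. -/
def encS (σ : Str) : ℕ → Str → Option ℕ := fun k _ => σ[k]?

/-- The selector reading off the string `υ`. -/
def decS (υ : Str) : ℕ → Str → Option ℕ := fun _ τ => υ[τ.length]?

theorem primrec_treeG_encS {γ : Type*} [Primcodable γ] {n k : γ → ℕ} {β σ : γ → Str}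
    (hn : Primrec n) (hβ : Primrec β) (hσ : Primrec σ) (hk : Primrec k) :
    Primrec fun x => treeG (n x) (β x) (encS (σ x)) (k x) :=
  primrec_treeG hn hβ (primrec_getElem (hσ.comp Primrec.fst)
    (Primrec.fst.comp Primrec.snd)) hk

theorem primrec_treeG_decS {γ : Type*} [Primcodable γ] {n k : γ → ℕ} {β υ : γ → Str}
    (hn : Primrec n) (hβ : Primrec β) (hυ : Primrec υ) (hk : Primrec k) :
    Primrec fun x => treeG (n x) (β x) (decS (υ x)) (k x) :=
  primrec_treeG hn hβ (primrec_getElem (hυ.comp Primrec.fst)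
    (Primrec.list_length.comp (Primrec.snd.comp Primrec.snd))) hk

/-- At the strings `υ, α` there is evidence for a string of length `a` accepted by `e` at level
`n + 1` whose image is compatible with `υ`. -/
def Accepts (e : Code) (n a : ℕ) (υ α : Str) : Prop :=
  ∃ c ≤ υ.length, (Denumerable.ofNat Str c).length = a ∧
    Code.evaln υ.length e (encode ((apx α).take a, n + 1, Denumerable.ofNat Str c)) = some 1 ∧
    ∃ τ, treeG n (apx α) (encS (Denumerable.ofNat Str c)) a = some τ ∧ τ <+: υ

theorem primrecPred_accepts {γ : Type*} [Primcodable γ] {e : γ → Code} {n a : γ → ℕ}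
    {υ α : γ → Str} (he : Primrec e) (hn : Primrec n) (ha : Primrec a) (hυ : Primrec υ)
    (hα : Primrec α) : PrimrecPred fun x => Accepts (e x) (n x) (a x) (υ x) (α x) := by
  have hf : Primrec fun y : γ × ℕ => y.1 := Primrec.fst
  have hc : Primrec fun y : γ × ℕ => Denumerable.ofNat Str y.2 :=
    (Primrec.ofNat Str).comp Primrec.snd
  refine primrecPred_exists_le (Primrec.list_length.comp hυ) (.and ?_ (.and ?_ ?_))
  · exact primrecPred_eq (Primrec.list_length.comp hc) (ha.comp hf)
  · exact primrecPred_eq (primrec_evaln (Primrec.list_length.comp (hυ.comp hf)) (he.comp hf)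
      (Primrec.encode.comp (Primrec.pair (primrec_take (ha.comp hf)
        (primrec_apx.comp (hα.comp hf))) (Primrec.pair (Primrec.succ.comp (hn.comp hf)) hc))))
      (Primrec.const _)
  · exact primrecPred_exists_option (primrec_treeG_encS (hn.comp hf)
      (primrec_apx.comp (hα.comp hf)) hc (ha.comp hf))
      (primrecPred_prefix Primrec.snd (hυ.comp (hf.comp Primrec.fst)))

theorem exists_acceptIndex : ∃ p : Code × ℕ × ℕ → ℕ, Primrec p ∧
    ∀ (x : Code × ℕ × ℕ) (z : Str × Str), ((Denumerable.ofNat Code (p x)).eval (encode z)).Dom ↔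
      Accepts x.1 x.2.1 x.2.2 z.1 z.2 :=
  exists_index (V := fun (x : Code × ℕ × ℕ) (z : Str × Str) =>
    Accepts x.1 x.2.1 x.2.2 z.1 z.2) (primrecPred_accepts (Primrec.fst.comp Primrec.fst)
      (Primrec.fst.comp (Primrec.snd.comp Primrec.fst))
      (Primrec.snd.comp (Primrec.snd.comp Primrec.fst))
      (Primrec.fst.comp Primrec.snd) (Primrec.snd.comp Primrec.snd))

/-- An index of the event `Accepts`. -/
noncomputable def acc : Code × ℕ × ℕ → ℕ := exists_acceptIndex.choose

theorem primrec_acc : Primrec acc := exists_acceptIndex.choose_spec.1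

theorem dom_acc_iff {e : Code} {n a : ℕ} {υ α : Str} :
    ((Denumerable.ofNat Code (acc (e, n, a))).eval (encode (υ, α))).Dom ↔ Accepts e n a υ α :=
  exists_acceptIndex.choose_spec.2 (e, n, a) (υ, α)

/-- All the events `Accepts` that are decided by stage `j` have happened. -/
def Ready (e : Code) (n j : ℕ) (υ α : Str) : Prop :=
  ∀ a ≤ j, n + acc (e, n, a) ≤ j → ∃ t ≤ υ.length, Accepts e n a (υ.take t) (α.take t)

theorem primrecPred_ready {γ : Type*} [Primcodable γ] {e : γ → Code} {n j : γ → ℕ}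
    {υ α : γ → Str} (he : Primrec e) (hn : Primrec n) (hj : Primrec j) (hυ : Primrec υ)
    (hα : Primrec α) : PrimrecPred fun x => Ready (e x) (n x) (j x) (υ x) (α x) := by
  have hf : Primrec fun y : γ × ℕ => y.1 := Primrec.fst
  have hg : Primrec fun y : (γ × ℕ) × ℕ => y.1.1 := hf.comp Primrec.fst
  refine primrecPred_forall_le hj (primrecPred_imp (primrecPred_le (Primrec.nat_add.comp
    (hn.comp hf) (primrec_acc.comp (Primrec.pair (he.comp hf) (Primrec.pair (hn.comp hf)
      Primrec.snd)))) (hj.comp hf)) (primrecPred_exists_le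
    (Primrec.list_length.comp (hυ.comp hf)) (primrecPred_accepts (he.comp hg) (hn.comp hg)
      (Primrec.snd.comp Primrec.fst) (primrec_take Primrec.snd (hυ.comp hg))
      (primrec_take Primrec.snd (hα.comp hg)))))

theorem ready_initSeg {e : Code} {n j b : ℕ} {Y A : ℕ → ℕ} :
    Ready e n j (initSeg Y b) (initSeg A b) ↔ ∀ a ≤ j, n + acc (e, n, a) ≤ j →
      ∃ t ≤ b, Accepts e n a (initSeg Y t) (initSeg A t) := by
  refine forall_congr' fun a => imp_congr_right fun _ => imp_congr_right fun _ => ?_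
  rw [length_initSeg]
  refine exists_congr fun t => and_congr_right fun ht => ?_
  rw [take_initSeg_le Y ht, take_initSeg_le A ht]

/-- The least length at which `Ready` holds. -/
noncomputable def wait (e : Code) (n j : ℕ) (υ α : Str) : ℕ :=
  leastLt (υ.length + 1) fun b => Ready e n j (υ.take b) (α.take b)

theorem primrec_wait {γ : Type*} [Primcodable γ] {e : γ → Code} {n j : γ → ℕ}
    {υ α : γ → Str} (he : Primrec e) (hn : Primrec n) (hj : Primrec j) (hυ : Primrec υ)
    (hα : Primrec α) : Primrec fun x => wait (e x) (n x) (j x) (υ x) (α x) := by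
  have hf : Primrec fun y : γ × ℕ => y.1 := Primrec.fst
  exact primrec_leastLt (Primrec.succ.comp (Primrec.list_length.comp hυ))
    (primrecPred_ready (he.comp hf) (hn.comp hf) (hj.comp hf)
      (primrec_take Primrec.snd (hυ.comp hf)) (primrec_take Primrec.snd (hα.comp hf)))

/-- The map from level `n + 1` to level `n`. -/
noncomputable def down (e : Code) (A : ℕ → ℕ) (n : ℕ) (X : ℕ → ℕ) (j : ℕ) : ℕ :=
  if j < n then X j else Nat.pair (treeY A n X j)
    (wait e n j (treeF A n X (j + 1)) (initSeg A (treeF A n X (j + 1)).length))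

theorem wait_treeF {e : Code} {A X : ℕ → ℕ} {n j : ℕ}
    (h : ∃ b, Ready e n j (initSeg (treeY A n X) b) (initSeg A b)) :
    Ready e n j (initSeg (treeY A n X) (wait e n j (treeF A n X (j + 1))
      (initSeg A (treeF A n X (j + 1)).length))) (initSeg A (wait e n j (treeF A n X (j + 1))
      (initSeg A (treeF A n X (j + 1)).length))) ∧
    ∀ b < wait e n j (treeF A n X (j + 1)) (initSeg A (treeF A n X (j + 1)).length),
      ¬ Ready e n j (initSeg (treeY A n X) b) (initSeg A b) := by
  obtain ⟨b0, h⟩ := h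
  rw [ready_initSeg] at h
  set M := (treeF A n X (j + 1)).length with hM
  have hF : ∀ b ≤ M, (treeF A n X (j + 1)).take b = initSeg (treeY A n X) b := fun b hb => by
    rw [treeF_eq_initSeg A n X (j + 1), take_initSeg_le _ hb]
  have hA : ∀ b ≤ M, (initSeg A M).take b = initSeg A b := fun b hb => take_initSeg_le _ hb
  have hex : ∃ b ≤ M, Ready e n j ((treeF A n X (j + 1)).take b) ((initSeg A M).take b) := by
    refine ⟨M, le_rfl, ?_⟩
    rw [hF M le_rfl, hA M le_rfl, ready_initSeg]
    intro a ha hp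
    obtain ⟨t, -, ht⟩ := h a ha hp
    have h1 := evA_treeF_of_exists (exists_evA_iff.2 ⟨t, dom_acc_iff.2 ht⟩)
    rw [treeF_eq_initSeg] at h1
    obtain ⟨t', ht', h2⟩ := exists_le_dom_of_evA h1
    exact ⟨t', ht'.trans (treeF_prefix A n X (by omega)).length_le, dom_acc_iff.1 h2⟩
  obtain ⟨h1, h2, h3⟩ := leastLt_succ_le hex
  refine ⟨?_, fun b hb => ?_⟩
  · rwa [hF _ h1, hA _ h1] at h2
  · have hb' : b ≤ M := hb.le.trans h1
    have := h3 b hb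
    rwa [hF _ hb', hA _ hb'] at this

/-- The projection of a point of level `n` to the image of the treemap. -/
def proj (n : ℕ) (W : ℕ → ℕ) (j : ℕ) : ℕ := if j < n then W j else (W j).unpair.1

/-- The string version of `proj`. -/
def projS (n : ℕ) (τ : Str) : Str :=
  (List.range τ.length).map fun j => if j < n then τ.getD j 0 else (τ.getD j 0).unpair.1

theorem primrec_projS {γ : Type*} [Primcodable γ] {n : γ → ℕ} {τ : γ → Str}
    (hn : Primrec n) (hτ : Primrec τ) : Primrec fun x => projS (n x) (τ x) := by
  have hg : Primrec fun y : γ × ℕ => (τ y.1).getD y.2 0 :=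
    (Primrec.list_getD 0).comp (hτ.comp Primrec.fst) Primrec.snd
  exact primrec_map (Primrec.list_range.comp (Primrec.list_length.comp hτ)) (Primrec.ite
    (primrecPred_lt Primrec.snd (hn.comp Primrec.fst)) hg
    (Primrec.fst.comp (Primrec.unpair.comp hg)))

theorem getD_initSeg {W : ℕ → ℕ} {j k : ℕ} (h : j < k) : (initSeg W k).getD j 0 = W j := by
  rw [List.getD_eq_getElem?_getD, getElem?_initSeg_lt W h, Option.getD_some]

theorem projS_initSeg (n : ℕ) (W : ℕ → ℕ) (k : ℕ) :
    projS n (initSeg W k) = initSeg (proj n W) k := by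
  rw [projS, length_initSeg]
  refine List.map_congr_left fun j hj => ?_
  rw [getD_initSeg (List.mem_range.1 hj), proj]

theorem getD_take {τ : Str} {j m : ℕ} (h : j < m) : (τ.take m).getD j 0 = τ.getD j 0 := by
  rw [List.getD_eq_getElem?_getD, List.getElem?_take_of_lt h, List.getD_eq_getElem?_getD]

theorem projS_take (n : ℕ) (τ : Str) (m : ℕ) : projS n (τ.take m) = (projS n τ).take m := by
  rw [projS, projS, ← List.map_take, List.take_range, List.length_take]
  refine List.map_congr_left fun j hj => ?_
  rw [getD_take]
  have := List.mem_range.1 hj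
  omega

theorem proj_down (e : Code) (A : ℕ → ℕ) (n : ℕ) (X : ℕ → ℕ) :
    proj n (down e A n X) = treeY A n X := by
  ext j
  by_cases h : j < n
  · rw [proj, if_pos h, down, if_pos h, treeY_of_lt A X h]
  · rw [proj, if_neg h, down, if_neg h, Nat.unpair_pair]

theorem down_of_lt (e : Code) (A : ℕ → ℕ) {n : ℕ} (X : ℕ → ℕ) {j : ℕ} (h : j < n) :
    down e A n X j = X j := if_pos h

theorem unpair_down (e : Code) (A : ℕ → ℕ) {n : ℕ} (X : ℕ → ℕ) {j : ℕ} (h : ¬ j < n) :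
    (down e A n X j).unpair.2 =
      wait e n j (treeF A n X (j + 1)) (initSeg A (treeF A n X (j + 1)).length) := by
  rw [down, if_neg h, Nat.unpair_pair]

theorem down_congr (e : Code) (A : ℕ → ℕ) (n : ℕ) {X X' : ℕ → ℕ} {j : ℕ}
    (h : ∀ i ≤ j, X i = X' i) : down e A n X j = down e A n X' j := by
  have h1 : treeF A n X (j + 1) = treeF A n X' (j + 1) :=
    treeF_congr A n fun i hi => h i (by omega)
  rw [down, down, treeY, treeY, h1, h j le_rfl]

theorem down_injective (e : Code) (A : ℕ → ℕ) (n : ℕ) : Function.Injective (down e A n) := by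
  intro X X' h
  rw [← decX_treeY A n X, ← decX_treeY A n X', ← proj_down e, ← proj_down e, h]

/-- The trees of the construction, relative to a side condition `w` and a program `e` for the
trees of the higher levels. -/
def Tree (w : ℕ → Str → Str → Prop) (e : Code) (n : ℕ) (α τ : Str) : Prop :=
  (τ.length < n ∨ w n α (τ.take n)) ∧ ∀ j < τ.length, j < n ∨
    (τ.length < (τ.getD j 0).unpair.2 ∨
      (Ready e n j ((projS n τ).take (τ.getD j 0).unpair.2) (α.take (τ.getD j 0).unpair.2) ∧
        ∀ b < (τ.getD j 0).unpair.2, ¬ Ready e n j ((projS n τ).take b) (α.take b)))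

theorem primrecPred_tree {w : ℕ → Str → Str → Prop}
    (hw : PrimrecPred fun x : ℕ × Str × Str => w x.1 x.2.1 x.2.2)
    {γ : Type*} [Primcodable γ] {e : γ → Code} {n : γ → ℕ} {α τ : γ → Str}
    (he : Primrec e) (hn : Primrec n) (hα : Primrec α) (hτ : Primrec τ) :
    PrimrecPred fun x => Tree w (e x) (n x) (α x) (τ x) := by
  have hf : Primrec fun y : γ × ℕ => y.1 := Primrec.fst
  have hg : Primrec fun y : (γ × ℕ) × ℕ => y.1.1 := hf.comp Primrec.fst
  have hb : Primrec fun y : γ × ℕ => ((τ y.1).getD y.2 0).unpair.2 :=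
    Primrec.snd.comp (Primrec.unpair.comp ((Primrec.list_getD 0).comp (hτ.comp hf) Primrec.snd))
  refine .and (.or (primrecPred_lt (Primrec.list_length.comp hτ) hn) (hw.comp
    (Primrec.pair hn (Primrec.pair hα (primrec_take hn hτ))))) (primrecPred_forall_lt
    (Primrec.list_length.comp hτ) (.or (primrecPred_lt Primrec.snd (hn.comp hf))
      (.or (primrecPred_lt (Primrec.list_length.comp (hτ.comp hf)) hb) (.and ?_
        (primrecPred_forall_lt hb (.not ?_))))))
  · exact primrecPred_ready (he.comp hf) (hn.comp hf) Primrec.snd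
      (primrec_take hb (primrec_projS (hn.comp hf) (hτ.comp hf)))
      (primrec_take hb (hα.comp hf))
  · exact primrecPred_ready (he.comp hg) (hn.comp hg) (Primrec.snd.comp Primrec.fst)
      (primrec_take Primrec.snd (primrec_projS (hn.comp hg) (hτ.comp hg)))
      (primrec_take Primrec.snd (hα.comp hg))

theorem Tree.take {w : ℕ → Str → Str → Prop}
    (hw : ∀ n α ξ m, w n α ξ → w n (α.take m) ξ) {e : Code} {n : ℕ} {α τ : Str}
    (h : Tree w e n α τ) (m : ℕ) : Tree w e n (α.take m) (τ.take m) := by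
  obtain ⟨h1, h2⟩ := h
  constructor
  · rcases lt_or_ge (τ.take m).length n with h | h
    · exact .inl h
    · rw [List.length_take] at h
      refine .inr ?_
      rw [List.take_take, min_eq_left (by omega)]
      exact hw _ _ _ _ (h1.resolve_left (by omega))
  · intro j hj
    rw [List.length_take] at hj
    rw [getD_take (by omega), projS_take]
    refine (h2 j (by omega)).imp_right fun h3 => ?_
    rcases lt_or_ge (τ.take m).length (τ.getD j 0).unpair.2 with h | h
    · exact .inl h
    · rw [List.length_take] at h
      refine .inr ?_
      obtain ⟨h4, h5⟩ := h3.resolve_left (by omega)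
      refine ⟨?_, fun b hb => ?_⟩
      · rw [List.take_take, List.take_take, min_eq_left (by omega)]; exact h4
      · rw [List.take_take, List.take_take, min_eq_left (by omega)]; exact h5 b hb

theorem exists_treeCode {w : ℕ → Str → Str → Prop}
    (hw : PrimrecPred fun x : ℕ × Str × Str => w x.1 x.2.1 x.2.2) :
    ∃ e : Code, ∀ α n τ, e.eval (encode ((α, n, τ) : Str × ℕ × Str)) =
      Part.some (if Tree w e n α τ then 1 else 0) := by
  have h1 : Primrec₂ fun (e : Code) (m : ℕ) =>
      if Tree w e (Denumerable.ofNat (Str × ℕ × Str) m).2.1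
        (Denumerable.ofNat (Str × ℕ × Str) m).1 (Denumerable.ofNat (Str × ℕ × Str) m).2.2
      then 1 else 0 := by
    have hz : Primrec fun y : Code × ℕ => Denumerable.ofNat (Str × ℕ × Str) y.2 :=
      (Primrec.ofNat _).comp Primrec.snd
    exact Primrec.ite (primrecPred_tree hw Primrec.fst (Primrec.fst.comp (Primrec.snd.comp hz))
      (Primrec.fst.comp hz) (Primrec.snd.comp (Primrec.snd.comp hz)))
      (Primrec.const 1) (Primrec.const 0)
  obtain ⟨e, he⟩ := Code.fixed_point₂ h1.to_comp.partrec₂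
  refine ⟨e, fun α n τ => ?_⟩
  rw [he]
  simp

theorem ready_iff_of_tree {w : ℕ → Str → Str → Prop} {e : Code} {n : ℕ} {A W : ℕ → ℕ} {m j : ℕ}
    (hj : j < m) (hnj : n ≤ j) (hm : (W j).unpair.2 ≤ m)
    (h : Tree w e n (initSeg A m) (initSeg W m)) :
    Ready e n j (initSeg (proj n W) (W j).unpair.2) (initSeg A (W j).unpair.2) ∧
      ∀ b < (W j).unpair.2, ¬ Ready e n j (initSeg (proj n W) b) (initSeg A b) := by
  have h1 := (h.2 j (by simpa using hj)).resolve_left (by omega)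
  rw [getD_initSeg hj, length_initSeg, projS_initSeg] at h1
  obtain ⟨h2, h3⟩ := h1.resolve_left (by omega)
  rw [take_initSeg_le _ hm, take_initSeg_le _ hm] at h2
  refine ⟨h2, fun b hb => ?_⟩
  have := h3 b hb
  rwa [take_initSeg_le _ (by omega), take_initSeg_le _ (by omega)] at this

theorem tree_down {w : ℕ → Str → Str → Prop} (hw : ∀ n α ξ m, w n α ξ → w n (α.take m) ξ)
    {e : Code} (he : ∀ α n τ, e.eval (encode ((α, n, τ) : Str × ℕ × Str)) =
      Part.some (if Tree w e n α τ then 1 else 0))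
    {A X : ℕ → ℕ} {n m : ℕ} (h : Tree w e (n + 1) (initSeg (jump A) m) (initSeg X m))
    (hX : w n (initSeg A m) (initSeg X n)) :
    Tree w e n (initSeg A m) (initSeg (down e A n X) m) := by
  constructor
  · rw [length_initSeg]
    rcases lt_or_ge m n with hm | hm
    · exact .inl hm
    · refine .inr ?_
      rwa [take_initSeg_le _ hm, initSeg_congr fun i hi => down_of_lt e A X hi]
  · intro j hj
    rw [length_initSeg] at hj ⊢
    refine or_iff_not_imp_left.2 fun hjn => ?_
    rw [getD_initSeg hj, projS_initSeg, proj_down, unpair_down e A X hjn]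
    have hex : ∃ b, Ready e n j (initSeg (treeY A n X) b) (initSeg A b) := by
      have key : ∀ a ≤ j, ∀ᶠ t in atTop,
          Accepts e n a (initSeg (treeY A n X) t) (initSeg A t) := by
        intro a ha
        have hT := h.take hw a
        rw [take_initSeg_le _ (by omega), take_initSeg_le _ (by omega)] at hT
        have h1 : 1 ∈ e.eval (encode (initSeg (jump A) a, n + 1, initSeg X a)) := by
          rw [he, if_pos hT]; exact Part.mem_some 1
        obtain ⟨k0, hk0⟩ := exists_evaln_of_mem h1
        obtain ⟨m0, hm0⟩ := treeG_complete A n X a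
        filter_upwards [eventually_ge_atTop k0, eventually_ge_atTop (encode (initSeg X a)),
          eventually_ge_atTop (treeF A n X a).length, take_apx_initSeg A a,
          take_apx_initSeg A m0] with t h2 h3 h4 h5 h6
        refine ⟨encode (initSeg X a), by simpa using h3, by simp, ?_, treeF A n X a, ?_, ?_⟩
        · rw [Denumerable.ofNat_encode, h5, length_initSeg]; exact hk0 t h2
        · rw [Denumerable.ofNat_encode]
          exact hm0 _ _ h6 fun i hi => getElem?_initSeg_lt X hi
        · rw [prefix_initSeg_iff]; exact ⟨h4, treeF_eq_initSeg A n X a⟩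
      obtain ⟨b, hb⟩ := ((Finset.eventually_all (Finset.range (j + 1))).2
        fun a ha => key a (by simpa [Nat.lt_succ_iff] using ha)).exists
      refine ⟨b, ready_initSeg.2 fun a ha _ => ⟨b, le_rfl, hb a (by simpa [Nat.lt_succ_iff] using ha)⟩⟩
    obtain ⟨h1, h2⟩ := wait_treeF hex
    refine or_iff_not_imp_left.2 fun hb => ⟨?_, fun b hw => ?_⟩
    · rwa [take_initSeg_le _ (by omega), take_initSeg_le _ (by omega)]
    · rw [take_initSeg_le _ (by omega), take_initSeg_le _ (by omega)]; exact h2 b hw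

/-- `W` is a path through the tree of level `n`. -/
def Lev (w : ℕ → Str → Str → Prop) (e : Code) (A : ℕ → ℕ) (n : ℕ) (W : ℕ → ℕ) : Prop :=
  ∀ m, Tree w e n (initSeg A m) (initSeg W m)

theorem Lev.ready {w : ℕ → Str → Str → Prop} {e : Code} {A W : ℕ → ℕ} {n : ℕ}
    (h : Lev w e A n W) {j : ℕ} (hj : n ≤ j) :
    Ready e n j (initSeg (proj n W) (W j).unpair.2) (initSeg A (W j).unpair.2) ∧
      ∀ b < (W j).unpair.2, ¬ Ready e n j (initSeg (proj n W) b) (initSeg A b) :=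
  ready_iff_of_tree (m := max (j + 1) (W j).unpair.2) (by omega) hj (by omega) (h _)

theorem Lev.up {w : ℕ → Str → Str → Prop} (hw : ∀ n α ξ m, w n α ξ → w n (α.take m) ξ)
    {e : Code} (he : ∀ α n τ, e.eval (encode ((α, n, τ) : Str × ℕ × Str)) =
      Part.some (if Tree w e n α τ then 1 else 0))
    {A W : ℕ → ℕ} {n : ℕ} (h : Lev w e A n W) :
    Lev w e (jump A) (n + 1) (decX A n (proj n W)) ∧ down e A n (decX A n (proj n W)) = W := by
  set Y := proj n W with hY
  set X := decX A n Y with hX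
  have acc_data : ∀ a, ∃ t σ, a ≤ t ∧ σ.length = a ∧
      Tree w e (n + 1) ((apx (initSeg A t)).take a) σ ∧
      ∃ τ, treeG n (apx (initSeg A t)) (encS σ) a = some τ ∧ τ <+: initSeg Y t := by
    intro a
    have hr := (h.ready (j := max a (n + acc (e, n, a))) (by omega)).1
    obtain ⟨t, -, c, hc, h1, h2, h3⟩ := ready_initSeg.1 hr a (by omega) (by omega)
    refine ⟨t, Denumerable.ofNat Str c, ?_, h1, ?_, h3⟩
    · have := Encodable.length_le_encode (Denumerable.ofNat Str c)
      rw [Denumerable.encode_ofNat] at this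
      simp only [length_initSeg] at hc
      omega
    · have h4 := Code.evaln_sound (Option.mem_def.2 h2)
      rw [he] at h4
      by_contra hc
      rw [if_neg hc] at h4
      simp at h4
  have key : ∀ k, ∃ B, ∀ a ≥ B, ∀ t σ, a ≤ t → σ.length = a → ∀ τ,
      treeG n (apx (initSeg A t)) (encS σ) a = some τ → τ <+: initSeg Y t →
      treeG n (apx (initSeg A t)) (encS σ) k = some (treeF A n X k) ∧
        σ.take k = initSeg X k := by
    intro k
    induction k with
    | zero => exact ⟨0, fun _ _ _ _ _ _ _ _ _ => ⟨rfl, by simp⟩⟩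
    | succ k ih =>
      obtain ⟨B, hB⟩ := ih
      obtain ⟨m0, hm0⟩ := ext_complete A n k (treeF A n X k ++ [X k])
      obtain ⟨B', hB'⟩ := eventually_atTop.1 (take_apx_initSeg A m0)
      refine ⟨max (max B B') (k + 1), fun a ha t σ hat hσ τ hτ hp => ?_⟩
      obtain ⟨h1, h2⟩ := hB a (by omega) t σ hat hσ τ hτ hp
      obtain ⟨τ', h3, h4⟩ := treeG_of_le hτ (j := k + 1) (by omega)
      obtain ⟨ρ, b, h5, h6, h7⟩ := treeG_succ_eq_some h3
      rw [h1, Option.some_inj] at h5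
      subst h5
      have h8 := (h7.trans h4).trans hp
      rw [prefix_initSeg_iff] at h8
      have h9 : X k = b := by
        have := eq_initSeg_iff.1 h8.2 (treeF A n X k).length b (by simp)
        rw [hX, decX, ← treeF_decX, ← hX]; exact this
      constructor
      · rw [treeG, h1, Option.bind_some, h6, Option.bind_some, ← h9,
          hm0 _ (hB' t (by omega)), treeF]
      · rw [initSeg_succ, ← h2, h9]
        have h6' : σ[k]? = some b := h6
        rw [List.take_add_one, h6']; rfl
  have hdec : ∀ k, decF A n Y k = initSeg Y (decF A n Y k).length := by
    intro k
    obtain ⟨B, hB⟩ := key k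
    obtain ⟨t, σ, h1, h2, -, τ, h3, h4⟩ := acc_data (max B k)
    obtain ⟨h5, -⟩ := hB _ (le_max_left _ _) t σ h1 h2 τ h3 h4
    obtain ⟨τ', h6, h7⟩ := treeG_of_le h3 (j := k) (le_max_right _ _)
    rw [h5, Option.some_inj] at h6
    rw [← treeF_decX, ← hX, h6]
    exact (prefix_initSeg_iff.1 (h7.trans h4)).2
  have hYX : treeY A n X = Y := treeY_decX hdec
  refine ⟨fun k => ?_, ?_⟩
  · obtain ⟨B, hB⟩ := key k
    obtain ⟨B', hB'⟩ := eventually_atTop.1 (take_apx_initSeg A k)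
    obtain ⟨t, σ, h1, h2, hT, τ, h3, h4⟩ := acc_data (max (max B B') k)
    obtain ⟨-, h5⟩ := hB _ (by omega) t σ h1 h2 τ h3 h4
    have := hT.take hw k
    rwa [h5, List.take_take, min_eq_left (by omega), hB' t (by omega)] at this
  · ext j
    by_cases hj : j < n
    · rw [down_of_lt e A X hj, ← treeY_of_lt A X hj, hYX, hY, proj, if_pos hj]
    · obtain ⟨h1, h2⟩ := h.ready (j := j) (by omega)
      rw [← hY] at h1 h2
      obtain ⟨h3, h4⟩ := wait_treeF (e := e) (A := A) (X := X) (n := n) (j := j)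
        ⟨_, by rw [hYX]; exact h1⟩
      rw [hYX] at h3 h4
      have : wait e n j (treeF A n X (j + 1)) (initSeg A (treeF A n X (j + 1)).length) =
          (W j).unpair.2 := by
        refine le_antisymm (not_lt.1 fun hlt => h4 _ hlt h1) (not_lt.1 fun hlt => h2 _ hlt h3)
      rw [down, if_neg hj, this, hYX, hY, proj, if_neg hj, Nat.pair_unpair]

end Step

/-! ### The side condition coding the given closed set -/

section Side

open Filter

theorem jumpIter_zeroF_le_one (n i : ℕ) : jumpIter zeroF n i = 0 ∨ jumpIter zeroF n i = 1 := by
  cases n with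
  | zero => exact .inl rfl
  | succ n => exact jump_eq_zero_or_one _ i

theorem jump_entry {A : ℕ → ℕ} {i : ℕ} (h : A i = 0 ∨ A i = 1) : jump A (qV (i, 1)) = A i := by
  rcases h with h | h
  · rw [h, jump_eq_zero_iff, jump_qV, h]; omega
  · rw [h, jump_qV, h]

/-- The number at which the `k`-th jump of a set codes membership of `i`. -/
noncomputable def lift (k i : ℕ) : ℕ := (fun j => qV (j, 1))^[k] i

theorem primrec_lift {γ : Type*} [Primcodable γ] {k i : γ → ℕ} (hk : Primrec k)
    (hi : Primrec i) : Primrec fun x => lift (k x) (i x) :=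
  Primrec.nat_iterate hk hi (primrec_qV.comp (Primrec.pair Primrec.snd (Primrec.const 1)))

theorem jumpIter_lift (n k i : ℕ) :
    jumpIter zeroF (n + k) (lift k i) = jumpIter zeroF n i := by
  induction k with
  | zero => rfl
  | succ k ih =>
    rw [lift, Function.iterate_succ_apply', ← add_assoc, jumpIter,
      jump_entry (jumpIter_zeroF_le_one _ _)]
    exact ih

theorem omegaJump_zeroF (x : ℕ) : omegaJump zeroF x = jumpIter zeroF x.unpair.2 x.unpair.1 := by
  rw [omegaJump]
  rcases jumpIter_zeroF_le_one x.unpair.2 x.unpair.1 with h | h <;> simp [h]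

/-- The initial segment of `0^(ω)` of length at most `n` computed from a finite part of
`0^(n)`. -/
noncomputable def low (n : ℕ) (α : Str) : Str :=
  tab n fun x => α[lift (n - x.unpair.2) x.unpair.1]?

theorem primrec_low {γ : Type*} [Primcodable γ] {n : γ → ℕ} {α : γ → Str}
    (hn : Primrec n) (hα : Primrec α) : Primrec fun x => low (n x) (α x) := by
  have hu : Primrec fun y : γ × ℕ => y.2.unpair := Primrec.unpair.comp Primrec.snd
  exact primrec_tab hn (primrec_getElem (hα.comp Primrec.fst) (primrec_lift
    (Primrec.nat_sub.comp (hn.comp Primrec.fst) (Primrec.snd.comp hu)) (Primrec.fst.comp hu)))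

theorem jumpIter_lift_sub {n x : ℕ} (hx : x ≤ n) :
    jumpIter zeroF n (lift (n - x.unpair.2) x.unpair.1) = omegaJump zeroF x := by
  have h1 : x.unpair.2 ≤ x := Nat.unpair_right_le x
  have := jumpIter_lift x.unpair.2 (n - x.unpair.2) x.unpair.1
  rwa [show x.unpair.2 + (n - x.unpair.2) = n by omega, ← omegaJump_zeroF] at this

theorem low_initSeg (n s : ℕ) : low n (initSeg (jumpIter zeroF n) s) =
    initSeg (omegaJump zeroF) (low n (initSeg (jumpIter zeroF n) s)).length := by
  rw [eq_initSeg_iff]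
  intro i v hv
  have hi : i < (low n (initSeg (jumpIter zeroF n) s)).length := by
    by_contra hc
    rw [List.getElem?_eq_none (not_lt.1 hc)] at hv
    exact absurd hv (by simp)
  have hin : i < n := lt_of_lt_of_le hi (length_tab_le _ _)
  rw [low, getElem?_tab hi, getElem?_initSeg_eq_some] at hv
  rw [← jumpIter_lift_sub hin.le, hv.2]

theorem low_eventually (n : ℕ) : ∀ᶠ s in atTop,
    low n (initSeg (jumpIter zeroF n) s) = initSeg (omegaJump zeroF) n := by
  have h : ∀ᶠ s in atTop, ∀ x ∈ Finset.range n, lift (n - x.unpair.2) x.unpair.1 < s :=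
    (Finset.eventually_all _).2 fun x _ => eventually_gt_atTop _
  filter_upwards [h] with s hs
  have h1 : n ≤ (low n (initSeg (jumpIter zeroF n) s)).length :=
    le_length_tab le_rfl fun j hj => by
      rw [getElem?_initSeg_lt _ (hs j (by simpa using hj))]; rfl
  have h2 : (low n (initSeg (jumpIter zeroF n) s)).length = n := le_antisymm (length_tab_le _ _) h1
  rw [low_initSeg, h2]

/-- No computation of `c` of size at most `n` has rejected an initial segment of `ξ`. -/
def Side (c : Code) (n : ℕ) (α ξ : Str) : Prop :=
  ∀ s ≤ α.length, ∀ k ≤ n, ∀ t ≤ n, ¬ Code.evaln n c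
    (Nat.pair (encode ((low n (α.take s)).take t)) (encode (ξ.take k))) = some 0

theorem primrecPred_side (c : Code) :
    PrimrecPred fun x : ℕ × Str × Str => Side c x.1 x.2.1 x.2.2 := by
  refine primrecPred_forall_le (Primrec.list_length.comp (Primrec.fst.comp Primrec.snd))
    (primrecPred_forall_le (Primrec.fst.comp Primrec.fst) (primrecPred_forall_le
      (Primrec.fst.comp (Primrec.fst.comp Primrec.fst)) (.not (primrecPred_eq
        (primrec_evaln ?_ (Primrec.const c) (Primrec₂.natPair.comp (Primrec.encode.comp
          (primrec_take Primrec.snd (primrec_low ?_ (primrec_take ?_ ?_))))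
          (Primrec.encode.comp (primrec_take ?_ ?_)))) (Primrec.const _)))))
  · exact Primrec.fst.comp (Primrec.fst.comp (Primrec.fst.comp Primrec.fst))
  · exact Primrec.fst.comp (Primrec.fst.comp (Primrec.fst.comp Primrec.fst))
  · exact Primrec.snd.comp (Primrec.fst.comp Primrec.fst)
  · exact Primrec.fst.comp (Primrec.snd.comp (Primrec.fst.comp (Primrec.fst.comp Primrec.fst)))
  · exact Primrec.snd.comp Primrec.fst
  · exact Primrec.snd.comp (Primrec.snd.comp (Primrec.fst.comp (Primrec.fst.comp Primrec.fst)))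

theorem Side.take (c : Code) (n : ℕ) (α ξ : Str) (m : ℕ) (h : Side c n α ξ) :
    Side c n (α.take m) ξ := by
  intro s hs
  rw [List.length_take] at hs
  rw [List.take_take, min_eq_left (by omega)]
  exact h s (by omega)

theorem mem_paths_iff_side {T : Set Str} {c : OCode}
    (hc : ∀ σ : Str, evalo (omegaJump zeroF) c (encode σ) = Part.some (chi T σ)) (x : ℕ → ℕ) :
    x ∈ paths T ↔ ∀ n s, Side (tr c) n (initSeg (jumpIter zeroF n) s) (initSeg x n) := by
  constructor
  · intro hx n s s' hs' k hk t ht h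
    rw [take_initSeg_le x hk, take_initSeg_le _ (by simpa using hs'), low_initSeg, take_initSeg] at h
    have h1 := tr_sound _ _ _ _ _ (Code.evaln_sound (Option.mem_def.2 h))
    rw [hc, Part.mem_some_iff, chi, if_pos (hx k)] at h1
    exact zero_ne_one h1
  · intro h
    by_contra hx
    obtain ⟨k, hk⟩ : ∃ k, initSeg x k ∉ T := by simpa [paths] using hx
    have h1 : 0 ∈ evalo (omegaJump zeroF) c (encode (initSeg x k)) := by
      rw [hc, chi, if_neg hk]; exact Part.mem_some 0
    obtain ⟨t, ht⟩ := (tr_complete _ _ _ _ h1).exists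
    obtain ⟨n0, hn0⟩ := exists_evaln_of_mem ht
    set n := max n0 (max k t)
    obtain ⟨s, hs⟩ := (low_eventually n).exists
    refine h n s s (by simp) k (by omega) t (by omega) ?_
    rw [take_initSeg_le x (by omega), take_initSeg_le _ le_rfl, hs, take_initSeg_le _ (by omega)]
    exact hn0 n (by omega)

end Side

/-! ### The limit of the construction -/

section Limit

/-- The composition of `k` steps of the construction, ending at level `n`. -/
noncomputable def towerAux (e : Code) (x : ℕ → ℕ) : ℕ → ℕ → ℕ → ℕ
  | 0, _ => x
  | k + 1, n => down e (jumpIter zeroF n) n (towerAux e x k (n + 1))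

/-- The point of level `n` determined by `x`. -/
noncomputable def tower (e : Code) (x : ℕ → ℕ) (n j : ℕ) : ℕ := towerAux e x (j + 1) n j

theorem towerAux_succ (e : Code) (x : ℕ → ℕ) {k n j : ℕ} (h : j < n + k) :
    towerAux e x (k + 1) n j = towerAux e x k n j := by
  induction k generalizing n j with
  | zero => exact down_of_lt e _ x h
  | succ k ih =>
    rw [towerAux, towerAux]
    exact down_congr e _ n fun i hi => ih (by omega)

theorem towerAux_eq_tower (e : Code) (x : ℕ → ℕ) {k n j : ℕ} (h : j < n + k) :
    towerAux e x k n j = tower e x n j := by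
  have h1 : ∀ k' ≥ k, towerAux e x k' n j = towerAux e x k n j := fun k' hk' => by
    induction k', hk' using Nat.le_induction with
    | base => rfl
    | succ k' hk' ih => rw [towerAux_succ e x (by omega), ih]
  have h2 : ∀ k' ≥ j + 1, towerAux e x k' n j = towerAux e x (j + 1) n j := fun k' hk' => by
    induction k', hk' using Nat.le_induction with
    | base => rfl
    | succ k' hk' ih => rw [towerAux_succ e x (by omega), ih]
  rw [tower, ← h1 (max k (j + 1)) (by omega), h2 _ (by omega)]

theorem tower_succ (e : Code) (x : ℕ → ℕ) (n : ℕ) :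
    down e (jumpIter zeroF n) n (tower e x (n + 1)) = tower e x n := by
  ext j
  rw [← towerAux_eq_tower e x (k := j + 2) (by omega), towerAux]
  exact down_congr e _ n fun i hi => (towerAux_eq_tower e x (by omega)).symm

theorem tower_of_lt (e : Code) (x : ℕ → ℕ) {n j : ℕ} (h : j < n) : tower e x n j = x j := by
  rw [← towerAux_eq_tower e x (k := 0) (by omega)]; rfl

theorem eq_tower {e : Code} {x : ℕ → ℕ} {Z : ℕ → ℕ → ℕ}
    (h1 : ∀ n, down e (jumpIter zeroF n) n (Z (n + 1)) = Z n)
    (h2 : ∀ n, ∀ i < n, Z n i = x i) (n : ℕ) : Z n = tower e x n := by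
  have : ∀ k n j, j < n + k → Z n j = towerAux e x k n j := fun k => by
    induction k with
    | zero => intro n j hj; exact h2 n j hj
    | succ k ih =>
      intro n j hj
      rw [← h1, towerAux]
      exact down_congr e _ n fun i hi => ih _ _ (by omega)
  ext j
  exact this _ _ _ (by omega)

theorem towerAux_congr (e : Code) {x x' : ℕ → ℕ} {k n j : ℕ} (h : ∀ i ≤ j, x i = x' i) :
    towerAux e x k n j = towerAux e x' k n j := by
  induction k generalizing n j with
  | zero => exact h j le_rfl
  | succ k ih =>
    rw [towerAux, towerAux]
    exact down_congr e _ n fun i hi => ih fun i' hi' => h i' (by omega)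

theorem tower_injective {e : Code} {x x' : ℕ → ℕ} (h : tower e x 0 = tower e x' 0) : x = x' := by
  have : ∀ n, tower e x n = tower e x' n := fun n => by
    induction n with
    | zero => exact h
    | succ n ih => exact down_injective e _ n (by rw [tower_succ, tower_succ, ih])
  ext i
  rw [← tower_of_lt e x (Nat.lt_succ_self i), this, tower_of_lt e x' (Nat.lt_succ_self i)]

/-- The sequence of points obtained from `Y` by inverting the steps of the construction. -/
noncomputable def climb (Y : ℕ → ℕ) : ℕ → ℕ → ℕ
  | 0 => Y
  | n + 1 => decX (jumpIter zeroF n) n (proj n (climb Y n))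

theorem climb_tower (e : Code) (x : ℕ → ℕ) (n : ℕ) : climb (tower e x 0) n = tower e x n := by
  induction n with
  | zero => rfl
  | succ n ih => rw [climb, ih, ← tower_succ, proj_down, decX_treeY]

/-- The inverse of the limit map. -/
noncomputable def base (Y : ℕ → ℕ) (i : ℕ) : ℕ := climb Y (i + 1) i

theorem base_tower (e : Code) (x : ℕ → ℕ) : base (tower e x 0) = x := by
  ext i; rw [base, climb_tower, tower_of_lt e x (Nat.lt_succ_self i)]

variable {w : ℕ → Str → Str → Prop} {e : Code}

theorem lev_tower (hw : ∀ n α ξ m, w n α ξ → w n (α.take m) ξ)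
    (he : ∀ α n τ, e.eval (encode ((α, n, τ) : Str × ℕ × Str)) =
      Part.some (if Tree w e n α τ then 1 else 0)) {x : ℕ → ℕ}
    (hx : ∀ n s, w n (initSeg (jumpIter zeroF n) s) (initSeg x n)) (n : ℕ) :
    Lev w e (jumpIter zeroF n) n (tower e x n) := by
  intro m
  have h1 : ∀ n, m ≤ n → Tree w e n (initSeg (jumpIter zeroF n) m) (initSeg (tower e x n) m) := by
    intro n hn
    constructor
    · rw [length_initSeg]
      refine or_iff_not_imp_left.2 fun hm => ?_
      rw [take_initSeg_le _ (by omega), initSeg_congr fun i hi => tower_of_lt e x hi]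
      exact hx n m
    · intro j hj
      rw [length_initSeg] at hj
      exact .inl (by omega)
  have h2 : ∀ d n, m ≤ n + d →
      Tree w e n (initSeg (jumpIter zeroF n) m) (initSeg (tower e x n) m) := by
    intro d
    induction d with
    | zero => exact h1
    | succ d ih =>
      intro n hn
      rw [← tower_succ]
      refine tree_down hw he (ih (n + 1) (by omega)) ?_
      rw [initSeg_congr fun i hi => tower_of_lt e x (n := n + 1) (by omega)]
      exact hx n m
  exact h2 m n (by omega)

theorem lev_climb (hw : ∀ n α ξ m, w n α ξ → w n (α.take m) ξ)
    (he : ∀ α n τ, e.eval (encode ((α, n, τ) : Str × ℕ × Str)) =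
      Part.some (if Tree w e n α τ then 1 else 0)) {Y : ℕ → ℕ}
    (hY : Lev w e (jumpIter zeroF 0) 0 Y) (n : ℕ) :
    Lev w e (jumpIter zeroF n) n (climb Y n) := by
  induction n with
  | zero => exact hY
  | succ n ih => exact (ih.up hw he).1

theorem climb_eq_tower (hw : ∀ n α ξ m, w n α ξ → w n (α.take m) ξ)
    (he : ∀ α n τ, e.eval (encode ((α, n, τ) : Str × ℕ × Str)) =
      Part.some (if Tree w e n α τ then 1 else 0)) {Y : ℕ → ℕ}
    (hY : Lev w e (jumpIter zeroF 0) 0 Y) (n : ℕ) : climb Y n = tower e (base Y) n := by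
  have h1 : ∀ n, down e (jumpIter zeroF n) n (climb Y (n + 1)) = climb Y n :=
    fun n => ((lev_climb hw he hY n).up hw he).2
  refine eq_tower h1 (fun n i hi => ?_) n
  rw [base]
  induction n, hi using Nat.le_induction with
  | base => rfl
  | succ n hn ih => rw [← ih, ← h1 n, down_of_lt e _ _ (by omega)]

theorem bijOn_tower (hw : ∀ n α ξ m, w n α ξ → w n (α.take m) ξ)
    (he : ∀ α n τ, e.eval (encode ((α, n, τ) : Str × ℕ × Str)) =
      Part.some (if Tree w e n α τ then 1 else 0)) :
    Set.BijOn (fun x => tower e x 0)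
      {x | ∀ n s, w n (initSeg (jumpIter zeroF n) s) (initSeg x n)}
      {Y | Lev w e (jumpIter zeroF 0) 0 Y} := by
  refine ⟨fun x hx => lev_tower hw he hx 0, fun x _ x' _ h => tower_injective h, fun Y hY => ?_⟩
  refine ⟨base Y, fun n s => ?_, (climb_eq_tower hw he hY 0).symm⟩
  have h1 := (lev_climb hw he hY n (max n s)).1.resolve_left (by simp)
  have h2 := hw _ _ _ s h1
  rw [climb_eq_tower hw he hY n, take_initSeg_le _ (le_max_left _ _),
    take_initSeg_le _ (le_max_right _ _), initSeg_congr fun i hi => tower_of_lt e _ hi] at h2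
  exact h2

/-- The value of `F X` on an initial segment is determined by an initial segment of `X`. -/
def FinDet (F : (ℕ → ℕ) → ℕ → ℕ) : Prop :=
  ∀ X k, ∃ s, ∀ X', initSeg X' s = initSeg X s → initSeg (F X') k = initSeg (F X) k

theorem FinDet.comp {F G : (ℕ → ℕ) → ℕ → ℕ} (hF : FinDet F) (hG : FinDet G) :
    FinDet fun X => F (G X) := fun X k => by
  obtain ⟨s, hs⟩ := hF (G X) k
  obtain ⟨t, ht⟩ := hG X s
  exact ⟨t, fun X' h => hs _ (ht X' h)⟩

theorem finDet_of_lipschitz {F : (ℕ → ℕ) → ℕ → ℕ}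
    (h : ∀ X X' j, (∀ i ≤ j, X i = X' i) → F X j = F X' j) : FinDet F := fun X k =>
  ⟨k, fun X' hX => initSeg_congr fun i hi => h _ _ _ fun j hj => eq_of_initSeg_eq hX j (by omega)⟩

theorem FinDet.continuous {F : (ℕ → ℕ) → ℕ → ℕ} (hF : FinDet F) : Continuous F := by
  refine continuous_pi fun i => continuous_iff_continuousAt.2 fun X => ?_
  obtain ⟨s, hs⟩ := hF X (i + 1)
  rw [ContinuousAt, nhds_discrete ℕ, Filter.tendsto_pure]
  have h : ∀ᶠ X' in nhds X, ∀ j ∈ Finset.range s, X' j = X j := by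
    refine (Finset.eventually_all _).2 fun j _ => ?_
    have h' : ContinuousAt (fun X' : ℕ → ℕ => X' j) X := (continuous_apply j).continuousAt
    rwa [ContinuousAt, nhds_discrete ℕ, Filter.tendsto_pure] at h'
  filter_upwards [h] with X' hX'
  exact eq_of_initSeg_eq (hs X' (initSeg_congr fun j hj => hX' j (by simpa using hj))) i
    (Nat.lt_succ_self i)

theorem finDet_decX (A : ℕ → ℕ) (n : ℕ) : FinDet (decX A n) := by
  have h1 : ∀ Y k, ∃ s, ∀ Y', initSeg Y' s = initSeg Y s →
      ∀ j ≤ k, decF A n Y' j = decF A n Y j := by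
    intro Y k
    induction k with
    | zero => exact ⟨0, fun _ _ j hj => by obtain rfl : j = 0 := by omega
                                           rfl⟩
    | succ k ih =>
      obtain ⟨s, hs⟩ := ih
      refine ⟨max s ((decF A n Y k).length + 1), fun Y' h j hj => ?_⟩
      have h' : ∀ j ≤ k, decF A n Y' j = decF A n Y j := hs Y' (initSeg_congr fun i hi =>
        eq_of_initSeg_eq h i (by omega))
      rcases Nat.lt_or_ge j (k + 1) with hj' | hj'
      · exact h' j (by omega)
      · obtain rfl : j = k + 1 := by omega
        rw [decF, decF, h' k le_rfl, eq_of_initSeg_eq h _ (by omega)]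
  intro Y k
  obtain ⟨s, hs⟩ := h1 Y k
  refine ⟨max s (((Finset.range k).sup fun i => (decF A n Y i).length) + 1), fun Y' h =>
    initSeg_congr fun i hi => ?_⟩
  have h2 : (decF A n Y i).length ≤ (Finset.range k).sup fun i => (decF A n Y i).length :=
    Finset.le_sup (f := fun i => (decF A n Y i).length) (by simpa using hi)
  rw [decX, decX, hs Y' (initSeg_congr fun i hi => eq_of_initSeg_eq h i (by omega)) i (by omega)]
  exact eq_of_initSeg_eq h _ (by omega)

theorem finDet_climb (n : ℕ) : FinDet fun Y => climb Y n := by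
  induction n with
  | zero => exact fun Y k => ⟨k, fun _ h => h⟩
  | succ n ih =>
    have h : FinDet (proj n) := finDet_of_lipschitz fun X X' j hX => by
      rw [proj, proj, hX j le_rfl]
    exact ((finDet_decX _ n).comp h).comp ih

theorem continuous_base : Continuous base :=
  continuous_pi fun i => (continuous_apply i).comp (finDet_climb (i + 1)).continuous

theorem continuous_tower (e : Code) : Continuous fun x => tower e x 0 :=
  FinDet.continuous (F := fun x => tower e x 0)
    (finDet_of_lipschitz fun _ _ _ h => towerAux_congr e h)

theorem homeoOn_tower (hw : ∀ n α ξ m, w n α ξ → w n (α.take m) ξ)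
    (he : ∀ α n τ, e.eval (encode ((α, n, τ) : Str × ℕ × Str)) =
      Part.some (if Tree w e n α τ then 1 else 0)) :
    HomeoOn (fun x => tower e x 0)
      {x | ∀ n s, w n (initSeg (jumpIter zeroF n) s) (initSeg x n)}
      {Y | Lev w e (jumpIter zeroF 0) 0 Y} :=
  ⟨bijOn_tower hw he, (continuous_tower e).continuousOn, base,
    ⟨fun x _ => base_tower e x, fun _ hY => (climb_eq_tower hw he hY 0).symm⟩,
    continuous_base.continuousOn⟩

theorem isPi01_lev (hp : PrimrecPred fun x : ℕ × Str × Str => w x.1 x.2.1 x.2.2)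
    (hw : ∀ n α ξ m, w n α ξ → w n (α.take m) ξ) :
    IsPi01 {Y | Lev w e (jumpIter zeroF 0) 0 Y} := by
  refine ⟨{τ | Tree w e 0 (initSeg zeroF τ.length) τ}, ?_, ?_, ?_⟩
  · intro σ τ h hτ
    have := Tree.take hw hτ σ.length
    rwa [take_initSeg_le _ h.length_le, ← List.prefix_iff_eq_take.1 h] at this
  · have h1 : Primrec fun τ : Str => if Tree w e 0 (initSeg zeroF τ.length) τ then 1 else 0 :=
      Primrec.ite (primrecPred_tree hp (Primrec.const e) (Primrec.const 0)
        (primrec_initSeg_zeroF.comp Primrec.list_length) Primrec.id)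
        (Primrec.const 1) (Primrec.const 0)
    obtain ⟨c, hc⟩ := exists_ocode_of_computable h1.to_comp
    exact ⟨c, fun σ => by rw [hc]; rfl⟩
  · ext Y
    simp [paths, Lev, jumpIter]

end Limit

/-! ### Approximations of the points of the construction -/

section Reductions

open Filter

theorem Approx.comp {s : ℕ → Str} {F : Str → Str} {f g : ℕ → ℕ}
    (h : Approx (fun k => F (initSeg g k)) f) (hs : Approx s g) :
    Approx (fun k => F (s k)) f := by
  refine ⟨fun k => ?_, fun m => ?_⟩
  · have := h.1 (s k).length
    simp only at this
    rwa [← hs.1 k] at this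
  · obtain ⟨N, hN⟩ := eventually_atTop.1 (h.2 m)
    filter_upwards [hs.2 N] with k hk
    rw [hs.1 k]; exact hN _ hk

theorem approx_of_eq {s : ℕ → Str} {f : ℕ → ℕ} {N : ℕ → ℕ} (h : ∀ k, s k = initSeg f (N k))
    (hN : ∀ m, ∀ᶠ k in atTop, m ≤ N k) : Approx s f :=
  ⟨fun k => by rw [h, length_initSeg], fun m => (hN m).mono fun k hk => by simpa [h] using hk⟩

/-- The even part of a string. -/
noncomputable def evenS (σ : Str) : Str := tab σ.length fun i => σ[2 * i]?

/-- The odd part of a string. -/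
noncomputable def oddS (σ : Str) : Str := tab σ.length fun i => σ[2 * i + 1]?

/-- The join of two strings. -/
noncomputable def joinS (σ τ : Str) : Str :=
  tab (σ.length + τ.length) fun i => if i % 2 = 0 then σ[i / 2]? else τ[i / 2]?

theorem primrec_evenS : Primrec evenS :=
  primrec_tab Primrec.list_length (primrec_getElem Primrec.fst
    (Primrec.nat_mul.comp (Primrec.const 2) Primrec.snd))

theorem primrec_oddS : Primrec oddS :=
  primrec_tab Primrec.list_length (primrec_getElem Primrec.fst
    (Primrec.succ.comp (Primrec.nat_mul.comp (Primrec.const 2) Primrec.snd)))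

theorem primrec_joinS {γ : Type*} [Primcodable γ] {σ τ : γ → Str} (hσ : Primrec σ)
    (hτ : Primrec τ) : Primrec fun x => joinS (σ x) (τ x) := by
  have hd : Primrec fun y : γ × ℕ => y.2 / 2 :=
    Primrec.nat_div.comp Primrec.snd (Primrec.const 2)
  exact primrec_tab (Primrec.nat_add.comp (Primrec.list_length.comp hσ)
    (Primrec.list_length.comp hτ)) (Primrec.ite (primrecPred_eq (Primrec.nat_mod.comp
      Primrec.snd (Primrec.const 2)) (Primrec.const 0))
    (primrec_getElem (hσ.comp Primrec.fst) hd) (primrec_getElem (hτ.comp Primrec.fst) hd))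

theorem Approx.evenS {s : ℕ → Str} {A B : ℕ → ℕ} (h : Approx s (oplus A B)) :
    Approx (fun k => evenS (s k)) A := by
  have h0 : ∀ i, oplus A B (2 * i) = A i := fun i => by
    rw [oplus, if_pos (by omega), Nat.mul_div_cancel_left _ two_pos]
  refine approx_tab h.2 (fun k j v hv => ?_) fun j => ?_
  · rw [← h0]; exact h.sound hv
  · filter_upwards [h.complete (2 * j)] with k hk; simp [hk]

theorem Approx.oddS {s : ℕ → Str} {A B : ℕ → ℕ} (h : Approx s (oplus A B)) :
    Approx (fun k => oddS (s k)) B := by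
  have h0 : ∀ i, oplus A B (2 * i + 1) = B i := fun i => by
    rw [oplus, if_neg (by omega)]; congr 1; omega
  refine approx_tab h.2 (fun k j v hv => ?_) fun j => ?_
  · rw [← h0]; exact h.sound hv
  · filter_upwards [h.complete (2 * j + 1)] with k hk; simp [hk]

theorem Approx.joinS {s t : ℕ → Str} {A B : ℕ → ℕ} (hs : Approx s A) (ht : Approx t B) :
    Approx (fun k => joinS (s k) (t k)) (oplus A B) := by
  refine approx_tab (fun m => (hs.2 m).mono fun k hk => by omega) (fun k j v hv => ?_)
    fun j => ?_
  · rw [oplus]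
    split_ifs at hv ⊢
    · exact hs.sound hv
    · exact ht.sound hv
  · filter_upwards [hs.complete (j / 2), ht.complete (j / 2)] with k h1 h2
    split_ifs <;> simp [h1, h2]

/-- The `n`-th column of a string. -/
noncomputable def col (n : ℕ) (ω : Str) : Str := tab ω.length fun i => ω[Nat.pair i n]?

theorem primrec_col {γ : Type*} [Primcodable γ] {n : γ → ℕ} {ω : γ → Str} (hn : Primrec n)
    (hω : Primrec ω) : Primrec fun x => col (n x) (ω x) :=
  primrec_tab (Primrec.list_length.comp hω) (primrec_getElem (hω.comp Primrec.fst)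
    (Primrec₂.natPair.comp Primrec.snd (hn.comp Primrec.fst)))

theorem Approx.col {s : ℕ → Str} {O f : ℕ → ℕ} (h : Approx s O) {n : ℕ}
    (hf : ∀ i, O (Nat.pair i n) = f i) : Approx (fun k => col n (s k)) f := by
  refine approx_tab h.2 (fun k j v hv => ?_) fun j => ?_
  · rw [← hf]; exact h.sound hv
  · filter_upwards [h.complete (Nat.pair j n)] with k hk; simp [hk]

theorem Approx.col_zeroF {s : ℕ → Str} (h : Approx s (omegaJump zeroF)) (n : ℕ) :
    Approx (fun k => Harrington.col n (s k)) (jumpIter zeroF n) :=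
  h.col fun i => by rw [omegaJump_zeroF, Nat.unpair_pair]

theorem Approx.projS {s : ℕ → Str} {W : ℕ → ℕ} (h : Approx s W) (n : ℕ) :
    Approx (fun k => projS n (s k)) (proj n W) :=
  approx_of_eq (N := fun k => (s k).length) (fun k => by
    conv_lhs => rw [h.1 k, projS_initSeg]) h.2

/-- The string version of `down`. -/
noncomputable def downS (e : Code) (n : ℕ) (α β σ : Str) : Str :=
  tab σ.length fun j => if j < n then σ[j]? else (treeG n β (encS σ) (j + 1)).bind fun τ =>
    if τ.length ≤ α.length then some (Nat.pair (τ.getD j 0) (wait e n j τ (α.take τ.length)))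
    else none

theorem primrec_downS {γ : Type*} [Primcodable γ] {e : Code} {n : γ → ℕ} {α β σ : γ → Str}
    (hn : Primrec n) (hα : Primrec α) (hβ : Primrec β) (hσ : Primrec σ) :
    Primrec fun x => downS e (n x) (α x) (β x) (σ x) := by
  have hf : Primrec fun y : γ × ℕ => y.1 := Primrec.fst
  have hg : Primrec fun y : (γ × ℕ) × Str => y.1.1 := hf.comp Primrec.fst
  have hj : Primrec fun y : (γ × ℕ) × Str => y.1.2 := Primrec.snd.comp Primrec.fst
  have hl : Primrec fun y : (γ × ℕ) × Str => y.2.length := Primrec.list_length.comp Primrec.snd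
  refine primrec_tab (Primrec.list_length.comp hσ) (Primrec.ite
    (primrecPred_lt Primrec.snd (hn.comp hf)) (primrec_getElem (hσ.comp hf) Primrec.snd)
    (primrec_bind (primrec_treeG_encS (hn.comp hf) (hβ.comp hf) (hσ.comp hf)
      (Primrec.succ.comp Primrec.snd)) (Primrec.ite (primrecPred_le hl
        (Primrec.list_length.comp (hα.comp hg))) (Primrec.option_some.comp
          (Primrec₂.natPair.comp ((Primrec.list_getD 0).comp Primrec.snd hj)
            (primrec_wait (Primrec.const e) (hn.comp hg) hj Primrec.snd
              (primrec_take hl (hα.comp hg))))) (Primrec.const none))))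

theorem Approx.downS {a b s : ℕ → Str} {A X : ℕ → ℕ} (e : Code) (n : ℕ) (ha : Approx a A)
    (hb : Approx b (jump A)) (hs : Approx s X) :
    Approx (fun k => downS e n (a k) (b k) (s k)) (down e A n X) := by
  refine approx_tab hs.2 (fun k j v hv => ?_) fun j => ?_
  · rw [down]
    split_ifs at hv ⊢ with h
    · exact hs.sound hv
    · obtain ⟨τ, hτ, hv⟩ := Option.bind_eq_some_iff.1 hv
      rw [hb.1 k] at hτ
      obtain rfl := treeG_sound (fun j _ a hj => hs.sound hj) hτ
      split_ifs at hv with h1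
      rw [ha.1 k, take_initSeg_le _ h1] at hv
      exact Option.some_inj.1 hv
  · obtain ⟨m0, hm⟩ := treeG_complete A n X (j + 1)
    filter_upwards [hs.2 (j + 1), hb.exists_take m0, ha.2 (treeF A n X (j + 1)).length]
      with k h1 h2 h3
    have h4 : ∀ i < j + 1, encS (s k) i (treeF A n X i) = some (X i) := fun i hi => by
      rw [encS, hs.1 k, getElem?_initSeg_lt _ (by omega)]
    split_ifs
    · simpa using h1
    · rw [hm _ _ h2 h4, Option.bind_some, if_pos h3]; rfl

/-- The string version of `decX`. -/
noncomputable def upS (n : ℕ) (β υ : Str) : Str :=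
  tab υ.length fun k => (treeG n β (decS υ) k).bind fun τ => υ[τ.length]?

theorem primrec_upS {γ : Type*} [Primcodable γ] {n : γ → ℕ} {β υ : γ → Str}
    (hn : Primrec n) (hβ : Primrec β) (hυ : Primrec υ) :
    Primrec fun x => upS (n x) (β x) (υ x) := by
  have hf : Primrec fun y : γ × ℕ => y.1 := Primrec.fst
  exact primrec_tab (Primrec.list_length.comp hυ) (primrec_bind (primrec_treeG_decS
    (hn.comp hf) (hβ.comp hf) (hυ.comp hf) Primrec.snd) (primrec_getElem
      (hυ.comp (hf.comp Primrec.fst)) (Primrec.list_length.comp Primrec.snd)))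

theorem Approx.upS {b u : ℕ → Str} {A X : ℕ → ℕ} {n : ℕ} (hb : Approx b (jump A))
    (hu : Approx u (treeY A n X)) : Approx (fun k => upS n (b k) (u k)) X := by
  refine approx_tab hu.2 (fun k j v hv => ?_) fun j => ?_
  · obtain ⟨τ, hτ, hv⟩ := Option.bind_eq_some_iff.1 hv
    rw [hb.1 k] at hτ
    obtain rfl := treeG_sound (X := X) (fun j _ a hj => by
      rw [← treeY_length A n X j]; exact hu.sound hj) hτ
    rw [← treeY_length A n X j]; exact hu.sound hv
  · obtain ⟨m0, hm⟩ := treeG_complete A n X j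
    filter_upwards [hu.2 ((treeF A n X j).length + 1), hb.exists_take m0] with k h1 h2
    have h3 : ∀ i ≤ j, (u k)[(treeF A n X i).length]? = some (X i) := fun i hi => by
      have := (treeF_prefix A n X hi).length_le
      rw [hu.1 k, getElem?_initSeg_lt _ (by omega), treeY_length]
    rw [hm _ _ h2 fun i hi => h3 i hi.le, Option.bind_some, h3 j le_rfl]; rfl

/-- The string version of `towerAux`, ending at level `K - i` after `i` steps. -/
noncomputable def towerS (e : Code) (K : ℕ) (ω σ : Str) : ℕ → Str
  | 0 => σ
  | i + 1 => downS e (K - (i + 1)) (col (K - (i + 1)) ω) (col (K - i) ω) (towerS e K ω σ i)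

theorem primrec_towerS {γ : Type*} [Primcodable γ] (e : Code) {K i : γ → ℕ} {ω σ : γ → Str}
    (hK : Primrec K) (hω : Primrec ω) (hσ : Primrec σ) (hi : Primrec i) :
    Primrec fun x => towerS e (K x) (ω x) (σ x) (i x) := by
  refine (Primrec.nat_rec' (f := i) (g := σ) (h := fun x y => downS e (K x - (y.1 + 1))
    (col (K x - (y.1 + 1)) (ω x)) (col (K x - y.1) (ω x)) y.2) hi hσ ?_).of_eq fun x => ?_
  · have hk : Primrec fun y : γ × ℕ × Str => K y.1 - (y.2.1 + 1) := Primrec.nat_sub.comp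
      (hK.comp Primrec.fst) (Primrec.succ.comp (Primrec.fst.comp Primrec.snd))
    have hk' : Primrec fun y : γ × ℕ × Str => K y.1 - y.2.1 := Primrec.nat_sub.comp
      (hK.comp Primrec.fst) (Primrec.fst.comp Primrec.snd)
    have ho : Primrec fun y : γ × ℕ × Str => ω y.1 := hω.comp Primrec.fst
    exact primrec_downS hk (primrec_col hk ho) (primrec_col hk' ho)
      (Primrec.snd.comp Primrec.snd)
  · induction i x with
    | zero => rfl
    | succ j ih => simp only at ih ⊢; rw [towerS, ← ih]

theorem Approx.towerS {o s : ℕ → Str} {x : ℕ → ℕ} (ho : Approx o (omegaJump zeroF))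
    (hs : Approx s x) (e : Code) {K i : ℕ} (hi : i ≤ K) :
    Approx (fun k => towerS e K (o k) (s k) i) (towerAux e x i (K - i)) := by
  induction i with
  | zero => exact hs
  | succ i ih =>
    have h1 := ho.col_zeroF (K - i)
    have h2 := ih (by omega)
    rw [show K - i = K - (i + 1) + 1 by omega] at h1 h2
    have := (ho.col_zeroF (K - (i + 1))).downS e (K - (i + 1)) h1 h2
    simp only [Harrington.towerS, towerAux]
    rwa [show K - i = K - (i + 1) + 1 by omega]

/-- The string version of `climb`. -/
noncomputable def climbS (ω υ : Str) : ℕ → Str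
  | 0 => υ
  | n + 1 => upS n (col (n + 1) ω) (projS n (climbS ω υ n))

theorem primrec_climbS {γ : Type*} [Primcodable γ] {n : γ → ℕ} {ω υ : γ → Str}
    (hω : Primrec ω) (hυ : Primrec υ) (hn : Primrec n) :
    Primrec fun x => climbS (ω x) (υ x) (n x) := by
  refine (Primrec.nat_rec' (f := n) (g := υ) (h := fun x y => upS y.1 (col (y.1 + 1) (ω x))
    (projS y.1 y.2)) hn hυ ?_).of_eq fun x => ?_
  · have hk : Primrec fun y : γ × ℕ × Str => y.2.1 := Primrec.fst.comp Primrec.snd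
    exact primrec_upS hk (primrec_col (Primrec.succ.comp hk) (hω.comp Primrec.fst))
      (primrec_projS hk (Primrec.snd.comp Primrec.snd))
  · induction n x with
    | zero => rfl
    | succ j ih => simp only at ih ⊢; rw [climbS, ← ih]

theorem Approx.climbS {o u : ℕ → Str} {e : Code} {x : ℕ → ℕ} (ho : Approx o (omegaJump zeroF))
    (hu : Approx u (tower e x 0)) (n : ℕ) :
    Approx (fun k => climbS (o k) (u k) n) (tower e x n) := by
  induction n with
  | zero => exact hu
  | succ n ih =>
    have h1 := ih.projS n
    rw [← tower_succ, proj_down] at h1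
    exact Approx.upS (ho.col_zeroF (n + 1)) h1

theorem exists_ocode_tower (e : Code) : ∃ c : OCode, ∀ x : ℕ → ℕ,
    computesFn (oplus x (omegaJump zeroF)) c (oplus (tower e x 0) (omegaJump zeroF)) := by
  suffices h : ∃ c, ∀ x ∈ Set.univ, computesFn _ c _ from h.imp fun c hc x => hc x trivial
  refine exists_ocode_of_approx
    (g := fun x => oplus x (omegaJump zeroF))
    (f := fun x => oplus (tower e x 0) (omegaJump zeroF))
    (S := fun ρ => joinS (tab (evenS ρ).length fun m =>
      (towerS e (m + 1) (oddS ρ) (evenS ρ) (m + 1))[m]?) (oddS ρ)) ?_ fun x _ => ?_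
  · have hm : Primrec fun y : Str × ℕ => y.2 + 1 := Primrec.succ.comp Primrec.snd
    have h1 : Primrec fun y : Str × ℕ =>
        (towerS e (y.2 + 1) (oddS y.1) (evenS y.1) (y.2 + 1))[y.2]? :=
      primrec_getElem (primrec_towerS e hm (primrec_oddS.comp Primrec.fst)
        (primrec_evenS.comp Primrec.fst) hm) Primrec.snd
    exact (primrec_joinS (primrec_tab (f := fun ρ m =>
      (towerS e (m + 1) (oddS ρ) (evenS ρ) (m + 1))[m]?)
      (Primrec.list_length.comp primrec_evenS) h1) primrec_oddS).to_comp
  · have h := approx_initSeg (oplus x (omegaJump zeroF))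
    refine Approx.joinS (approx_tab h.evenS.2 (fun k j v hv => ?_) fun j => ?_) h.oddS
    · have := (h.oddS.towerS h.evenS e (le_refl (j + 1))).sound hv
      rwa [Nat.sub_self] at this
    · filter_upwards [(h.oddS.towerS h.evenS e (le_refl (j + 1))).complete j] with k hk
      simp [hk]

theorem exists_ocode_base (e : Code) : ∃ c : OCode, ∀ x : ℕ → ℕ,
    computesFn (oplus (tower e x 0) (omegaJump zeroF)) c (oplus x (omegaJump zeroF)) := by
  suffices h : ∃ c, ∀ x ∈ Set.univ, computesFn _ c _ from h.imp fun c hc x => hc x trivial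
  refine exists_ocode_of_approx
    (g := fun x => oplus (tower e x 0) (omegaJump zeroF))
    (f := fun x => oplus x (omegaJump zeroF))
    (S := fun ρ => joinS (tab (evenS ρ).length fun m =>
      (climbS (oddS ρ) (evenS ρ) (m + 1))[m]?) (oddS ρ)) ?_ fun x _ => ?_
  · have h1 : Primrec fun y : Str × ℕ => (climbS (oddS y.1) (evenS y.1) (y.2 + 1))[y.2]? :=
      primrec_getElem (primrec_climbS (primrec_oddS.comp Primrec.fst)
        (primrec_evenS.comp Primrec.fst) (Primrec.succ.comp Primrec.snd)) Primrec.snd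
    exact (primrec_joinS (primrec_tab (f := fun ρ m =>
      (climbS (oddS ρ) (evenS ρ) (m + 1))[m]?)
      (Primrec.list_length.comp primrec_evenS) h1) primrec_oddS).to_comp
  · have h := approx_initSeg (oplus (tower e x 0) (omegaJump zeroF))
    refine Approx.joinS (approx_tab h.evenS.2 (fun k j v hv => ?_) fun j => ?_) h.oddS
    · have := (h.oddS.climbS h.evenS (j + 1)).sound hv
      rwa [tower_of_lt e x (Nat.lt_succ_self j)] at this
    · filter_upwards [(h.oddS.climbS h.evenS (j + 1)).complete j] with k hk
      simp [hk]

end Reductions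

/-! ### Iterating the jump -/

section Iterate

open Filter

/-- The partial recursive function with index `p` is defined at some initial segment of `g`. -/
def DomEv (g : ℕ → ℕ) (p : ℕ) : Prop :=
  ∃ t, ((Denumerable.ofNat Code p).eval (encode (initSeg g t))).Dom

theorem Approx.exists_halts_iff {s : ℕ → Str} {f : ℕ → ℕ} (h : Approx s f) (k : ℕ) :
    (∃ t, Halts k (s t)) ↔ jump f k = 1 := by
  rw [jump_eq_one_iff_halts]
  constructor
  · rintro ⟨t, ht⟩; exact ⟨_, h.1 t ▸ ht⟩
  · rintro ⟨m, hm⟩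
    obtain ⟨t, ht⟩ := (h.2 m).exists
    exact ⟨t, hm.mono (h.1 t ▸ initSeg_prefix f ht)⟩

/-- If questions about partial recursive functions evaluated along `g n` are answered from
`g (n + 1)`, then `g n` uniformly computes the `n`-th jump of any function computed by `g 0`. -/
theorem exists_jumpIter_approx {S : Str → Str} {ans : ℕ → Str → ℕ → Option ℕ} (hS : Primrec S)
    (ha : Primrec fun x : ℕ × Str × ℕ => ans x.1 x.2.1 x.2.2) :
    ∃ ψ : ℕ → Str → Str, Primrec (fun x : ℕ × Str => ψ x.1 x.2) ∧
      ∀ (g : ℕ → ℕ → ℕ) (f : ℕ → ℕ), Approx (fun k => S (initSeg (g 0) k)) f →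
        (∀ n p s v, ans n (initSeg (g (n + 1)) s) p = some v →
          v = if DomEv (g n) p then 1 else 0) →
        (∀ n p, ∀ᶠ s in atTop, (ans n (initSeg (g (n + 1)) s) p).isSome) →
        ∀ n, Approx (fun k => ψ n (initSeg (g n) k)) (jumpIter f n) := by
  let idx : ℕ → ℕ → ℕ := fun d k => encode (Code.curry (Denumerable.ofNat Code d) k)
  have hidx : Primrec fun y : ℕ × ℕ => idx y.1 y.2 := Primrec.encode.comp
    (Code.primrec₂_curry.comp ((Primrec.ofNat Code).comp Primrec.fst) Primrec.snd)
  have hV0 : PrimrecPred fun x : Unit × ℕ × Str => Halts x.2.1 (S x.2.2) := primrecPred_halts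
    (Primrec.fst.comp Primrec.snd) (hS.comp (Primrec.snd.comp Primrec.snd))
  obtain ⟨p0, -, hp0⟩ := exists_index (V := fun (_ : Unit) (y : ℕ × Str) => Halts y.1 (S y.2)) hV0
  have hnext : Primrec fun y : (ℕ × ℕ) × Str =>
      tab y.2.length fun j => ans y.1.2 y.2 (idx y.1.1 j) := by
    refine primrec_tab (f := fun (y : (ℕ × ℕ) × Str) j => ans y.1.2 y.2 (idx y.1.1 j))
      (Primrec.list_length.comp Primrec.snd) ?_
    have h1 : Primrec fun z : ((ℕ × ℕ) × Str) × ℕ => z.1.1 := Primrec.fst.comp Primrec.fst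
    exact ha.comp (Primrec.pair (Primrec.snd.comp h1) (Primrec.pair
      (Primrec.snd.comp Primrec.fst) (hidx.comp (Primrec.pair (Primrec.fst.comp h1)
        Primrec.snd))))
  have hV1 : PrimrecPred fun x : (ℕ × ℕ) × ℕ × Str =>
      Halts x.2.1 (tab x.2.2.length fun j => ans x.1.2 x.2.2 (idx x.1.1 j)) :=
    primrecPred_halts (Primrec.fst.comp Primrec.snd)
      (hnext.comp (Primrec.pair Primrec.fst (Primrec.snd.comp Primrec.snd)))
  obtain ⟨p1, hp1, hp1'⟩ := exists_index (V := fun (x : ℕ × ℕ) (y : ℕ × Str) =>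
    Halts y.1 (tab y.2.length fun j => ans x.2 y.2 (idx x.1 j))) hV1
  let d : ℕ → ℕ := fun n => Nat.rec (p0 ()) (fun n d => p1 (d, n)) n
  have hd : Primrec d := Primrec.nat_rec₁ (f := fun n d => p1 (d, n)) _
    (hp1.comp (Primrec.pair Primrec.snd Primrec.fst))
  let ψ : ℕ → Str → Str := fun n σ =>
    if n = 0 then S σ else tab σ.length fun j => ans (n - 1) σ (idx (d (n - 1)) j)
  have hψ : Primrec fun x : ℕ × Str => ψ x.1 x.2 := by
    have h1 : Primrec fun x : ℕ × Str => x.1 - 1 := Primrec.pred.comp Primrec.fst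
    exact Primrec.ite (primrecPred_eq Primrec.fst (Primrec.const 0)) (hS.comp Primrec.snd)
      (hnext.comp (Primrec.pair (Primrec.pair (hd.comp h1) h1) Primrec.snd))
  have inv : ∀ n k (ρ : Str), ((Denumerable.ofNat Code (idx (d n) k)).eval (encode ρ)).Dom ↔
      Halts k (ψ n ρ) := by
    intro n k ρ
    simp only [idx, Denumerable.ofNat_encode, Code.eval_curry]
    have h : Nat.pair k (encode ρ) = encode (k, ρ) := by simp
    rw [h]
    cases n with
    | zero => exact hp0 () (k, ρ)
    | succ n => exact hp1' (d n, n) (k, ρ)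
  refine ⟨ψ, hψ, fun g f h0 h1 h2 n => ?_⟩
  induction n with
  | zero => exact h0
  | succ n ih =>
    have key : ∀ k, jump (jumpIter f n) k = if DomEv (g n) (idx (d n) k) then 1 else 0 := by
      intro k
      have h3 : DomEv (g n) (idx (d n) k) ↔ jump (jumpIter f n) k = 1 := by
        rw [← ih.exists_halts_iff k]
        exact exists_congr fun t => inv n k _
      split_ifs with h
      · exact h3.1 h
      · rw [jump_eq_zero_iff, ← h3]; exact h
    refine approx_tab (approx_initSeg _).2 (fun s k v hv => ?_) fun k => h2 n _
    rw [h1 n _ s v hv]; exact key k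

/-- The `m`-th value of the `ω`-jump, read off from the approximations of the iterated jumps. -/
theorem approx_omega {f : ℕ → ℕ} {s : ℕ → ℕ → Str} {N : ℕ → ℕ}
    (hN : ∀ m, ∀ᶠ k in atTop, m ≤ N k) (h : ∀ n, Approx (s n) (jumpIter f n)) :
    Approx (fun k => tab (N k) fun m => (s m.unpair.2 k)[m.unpair.1]?.map
      fun v => if v = 0 then 0 else 1) (omegaJump f) := by
  refine approx_tab hN (fun k m v hv => ?_) fun m => ?_
  · obtain ⟨a, ha, rfl⟩ := Option.map_eq_some_iff.1 hv
    rw [omegaJump, (h _).sound ha]; simp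
  · filter_upwards [(h m.unpair.2).complete m.unpair.1] with k hk
    simp [hk]

theorem primrec_omega {γ : Type*} [Primcodable γ] {s : γ → ℕ → Str} {N : γ → ℕ}
    (hN : Primrec N) (hs : Primrec fun x : γ × ℕ => s x.1 x.2) :
    Primrec fun x => tab (N x) fun m => (s x m.unpair.2)[m.unpair.1]?.map
      fun v => if v = 0 then 0 else 1 := by
  have hu : Primrec fun y : γ × ℕ => y.2.unpair := Primrec.unpair.comp Primrec.snd
  have h1 : Primrec fun y : γ × ℕ => s y.1 y.2.unpair.2 :=
    hs.comp (Primrec.pair Primrec.fst (Primrec.snd.comp hu))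
  have h2 : Primrec₂ fun (_ : γ × ℕ) (v : ℕ) => if v = 0 then 0 else 1 :=
    Primrec.ite (primrecPred_eq Primrec.snd (Primrec.const 0)) (Primrec.const 0)
      (Primrec.const 1)
  exact primrec_tab hN (Primrec.option_map (primrec_getElem h1 (Primrec.fst.comp hu)) h2)

/-! ### The `ω`-jump computes its base and `0^(ω)` -/

/-- The initial segment of `Y` computed from an initial segment of `Y^(ω)`. -/
noncomputable def rootS (ω : Str) : Str := tab ω.length fun i =>
  if leastLt ω.length (fun v => ω[Nat.pair (qV (i, v)) 1]? = some 1) < ω.length then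
    some (leastLt ω.length fun v => ω[Nat.pair (qV (i, v)) 1]? = some 1) else none

theorem primrec_rootS : Primrec rootS := by
  have h1 : Primrec fun y : Str × ℕ => y.1.length := Primrec.list_length.comp Primrec.fst
  have h2 : Primrec fun z : (Str × ℕ) × ℕ => z.1.1[Nat.pair (qV (z.1.2, z.2)) 1]? :=
    primrec_getElem (Primrec.fst.comp Primrec.fst) (Primrec₂.natPair.comp (primrec_qV.comp
      (Primrec.pair (Primrec.snd.comp Primrec.fst) Primrec.snd)) (Primrec.const 1))
  have h3 : Primrec fun y : Str × ℕ =>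
      leastLt y.1.length fun v => y.1[Nat.pair (qV (y.2, v)) 1]? = some 1 :=
    primrec_leastLt (p := fun (y : Str × ℕ) v => y.1[Nat.pair (qV (y.2, v)) 1]? = some 1) h1
      (primrecPred_eq h2 (Primrec.const (some 1)))
  exact primrec_tab (f := fun ω i =>
    if leastLt ω.length (fun v => ω[Nat.pair (qV (i, v)) 1]? = some 1) < ω.length then
      some (leastLt ω.length fun v => ω[Nat.pair (qV (i, v)) 1]? = some 1) else none)
    Primrec.list_length (Primrec.ite (primrecPred_lt h3 h1) (Primrec.option_some.comp h3)
      (Primrec.const none))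

theorem omegaJump_pair_succ (Y : ℕ → ℕ) (i n : ℕ) :
    omegaJump Y (Nat.pair i (n + 1)) = jumpIter Y (n + 1) i := by
  rw [omegaJump, Nat.unpair_pair]
  rcases jump_eq_zero_or_one (jumpIter Y n) i with h | h <;> simp [jumpIter, h]

theorem Approx.rootS {s : ℕ → Str} {Y : ℕ → ℕ} (h : Approx s (omegaJump Y)) :
    Approx (fun k => rootS (s k)) Y := by
  have h1 : ∀ i v, omegaJump Y (Nat.pair (qV (i, v)) 1) = 1 ↔ Y i = v := fun i v => by
    rw [omegaJump_pair_succ Y _ 0]; exact jump_qV Y i v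
  refine approx_tab h.2 (fun k i v hv => ?_) fun i => ?_
  · split_ifs at hv with h2
    rw [← Option.some_inj.1 hv, ← h1]
    exact h.sound (leastLt_spec h2)
  · filter_upwards [h.2 (Y i + 1), h.complete (Nat.pair (qV (i, Y i)) 1)] with k h2 h3
    rw [(h1 i _).2 rfl] at h3
    have := leastLt_le_of (N := (s k).length)
      (p := fun v => (s k)[Nat.pair (qV (i, v)) 1]? = some 1) h3
    rw [if_pos (by omega)]; rfl

/-- The `n`-th jump of `Y`, as approximated by `Y^(ω)`. -/
noncomputable def iterS (n : ℕ) (ω : Str) : Str := if n = 0 then rootS ω else col n ω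

theorem primrec_iterS {γ : Type*} [Primcodable γ] {n : γ → ℕ} {ω : γ → Str} (hn : Primrec n)
    (hω : Primrec ω) : Primrec fun x => iterS (n x) (ω x) :=
  Primrec.ite (primrecPred_eq hn (Primrec.const 0)) (primrec_rootS.comp hω) (primrec_col hn hω)

theorem Approx.iterS {s : ℕ → Str} {Y : ℕ → ℕ} (h : Approx s (omegaJump Y)) (n : ℕ) :
    Approx (fun k => iterS n (s k)) (jumpIter Y n) := by
  cases n with
  | zero => exact h.rootS
  | succ n => exact h.col fun i => omegaJump_pair_succ Y i n

theorem exists_ocode_of_omegaJump : ∃ c : OCode, ∀ Y : ℕ → ℕ,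
    computesFn (omegaJump Y) c (oplus Y (omegaJump zeroF)) := by
  obtain ⟨q, hq, hq'⟩ := exists_domIndex
  obtain ⟨ψ, hψ, h⟩ := exists_jumpIter_approx (S := fun σ => initSeg zeroF σ.length)
    (ans := fun _ σ p => σ[q p]?) (primrec_initSeg_zeroF.comp Primrec.list_length)
    (primrec_getElem (Primrec.fst.comp Primrec.snd) (hq.comp (Primrec.snd.comp Primrec.snd)))
  have hs : Primrec fun x : Str × ℕ => ψ x.2 (iterS x.2 x.1) :=
    hψ.comp (Primrec.pair Primrec.snd (primrec_iterS Primrec.snd Primrec.fst))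
  obtain ⟨c, hc⟩ := exists_ocode_of_approx (D := Set.univ) (g := omegaJump)
    (f := fun Y => oplus Y (omegaJump zeroF))
    (primrec_joinS primrec_rootS (primrec_omega (s := fun ω n => ψ n (iterS n ω))
      Primrec.list_length hs)).to_comp fun Y _ => by
      have hω := approx_initSeg (omegaJump Y)
      refine hω.rootS.joinS (approx_omega
        (s := fun n k => ψ n (iterS n (initSeg (omegaJump Y) k))) hω.2 fun n => ?_)
      have hJ := h (jumpIter Y) zeroF (by simpa using approx_initSeg zeroF)
        (fun n p s v hv => ?_) fun n p => ?_
      · exact (hJ n).comp (hω.iterS n)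
      · rw [← (getElem?_initSeg_eq_some.1 hv).2, jumpIter]
        have h1 := hq' (jumpIter Y n) p
        split_ifs with h2
        · exact h1.2 h2
        · rw [jump_eq_zero_iff, h1]; exact h2
      · exact ((approx_initSeg _).complete (q p)).mono fun s hs =>
          Option.isSome_iff_exists.2 ⟨_, hs⟩
  exact ⟨c, fun Y => hc Y trivial⟩

end Iterate

/-! ### The `ω`-jump of the constructed points -/

section Omega

open Filter

/-- The string of first components. -/
def fstS (σ : Str) : Str := σ.map fun x => x.unpair.1

/-- The string of second components. -/
def sndS (σ : Str) : Str := σ.map fun x => x.unpair.2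

/-- The string of pairs of entries of two strings. -/
noncomputable def pairS (σ τ : Str) : Str :=
  tab σ.length fun j => σ[j]?.bind fun x => τ[j]?.map fun y => Nat.pair x y

theorem primrec_fstS : Primrec fstS :=
  primrec_map Primrec.id (Primrec.fst.comp (Primrec.unpair.comp Primrec.snd))

theorem primrec_sndS : Primrec sndS :=
  primrec_map Primrec.id (Primrec.snd.comp (Primrec.unpair.comp Primrec.snd))

theorem primrec_pairS {γ : Type*} [Primcodable γ] {σ τ : γ → Str} (hσ : Primrec σ)
    (hτ : Primrec τ) : Primrec fun x => pairS (σ x) (τ x) := by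
  have hf : Primrec fun y : γ × ℕ => y.1 := Primrec.fst
  have h1 : Primrec fun z : (γ × ℕ) × ℕ => (τ z.1.1)[z.1.2]? :=
    primrec_getElem (hτ.comp (hf.comp Primrec.fst)) (Primrec.snd.comp Primrec.fst)
  have h2 : Primrec₂ fun (z : (γ × ℕ) × ℕ) (y : ℕ) => Nat.pair z.2 y :=
    Primrec₂.natPair.comp (Primrec.snd.comp Primrec.fst) Primrec.snd
  exact primrec_tab (Primrec.list_length.comp hσ) (primrec_bind
    (primrec_getElem (hσ.comp hf) Primrec.snd) (Primrec.option_map h1 h2))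

theorem fstS_initSeg (X A : ℕ → ℕ) (s : ℕ) :
    fstS (initSeg (fun k => Nat.pair (X k) (A k)) s) = initSeg X s := by
  simp [fstS, initSeg, Function.comp_def]

theorem sndS_initSeg (X A : ℕ → ℕ) (s : ℕ) :
    sndS (initSeg (fun k => Nat.pair (X k) (A k)) s) = initSeg A s := by
  simp [sndS, initSeg, Function.comp_def]

theorem Approx.pairS {s t : ℕ → Str} {X A : ℕ → ℕ} (hs : Approx s X) (ht : Approx t A) :
    Approx (fun k => pairS (s k) (t k)) fun k => Nat.pair (X k) (A k) := by
  refine approx_tab hs.2 (fun k j v hv => ?_) fun j => ?_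
  · obtain ⟨x, hx, hv⟩ := Option.bind_eq_some_iff.1 hv
    obtain ⟨y, hy, rfl⟩ := Option.map_eq_some_iff.1 hv
    rw [hs.sound hx, ht.sound hy]
  · filter_upwards [hs.complete j, ht.complete j] with k h1 h2
    simp [h1, h2]

/-- Recovers a point of level `n`, paired with the oracle, from its projection. -/
noncomputable def restoreS (e : Code) (n : ℕ) (υ α : Str) : Str :=
  pairS (tab υ.length fun j => if j < n then υ[j]? else υ[j]?.bind fun y =>
    if wait e n j υ α ≤ υ.length then some (Nat.pair y (wait e n j υ α)) else none) α

theorem primrec_restoreS {γ : Type*} [Primcodable γ] {e : γ → Code} {n : γ → ℕ} {υ α : γ → Str}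
    (he : Primrec e) (hn : Primrec n) (hυ : Primrec υ) (hα : Primrec α) :
    Primrec fun x => restoreS (e x) (n x) (υ x) (α x) := by
  have hf : Primrec fun y : γ × ℕ => y.1 := Primrec.fst
  have h1 : Primrec fun y : γ × ℕ => (υ y.1)[y.2]? := primrec_getElem (hυ.comp hf) Primrec.snd
  have h2 : Primrec fun y : γ × ℕ => wait (e y.1) (n y.1) y.2 (υ y.1) (α y.1) :=
    primrec_wait (he.comp hf) (hn.comp hf) Primrec.snd (hυ.comp hf) (hα.comp hf)
  have h3 : Primrec fun z : (γ × ℕ) × ℕ => z.1 := Primrec.fst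
  exact primrec_pairS (primrec_tab (Primrec.list_length.comp hυ) (Primrec.ite
    (primrecPred_lt Primrec.snd (hn.comp hf)) h1 (primrec_bind h1 (Primrec.ite
      (primrecPred_le (h2.comp h3) (Primrec.list_length.comp (hυ.comp (hf.comp h3))))
      (Primrec.option_some.comp (Primrec₂.natPair.comp Primrec.snd (h2.comp h3)))
      (Primrec.const none))))) hα

theorem approx_restoreS {w : ℕ → Str → Str → Prop} {e : Code} {A W : ℕ → ℕ} {n : ℕ}
    (h : Lev w e A n W) :
    Approx (fun t => restoreS e n (initSeg (proj n W) t) (initSeg A t))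
      fun k => Nat.pair (W k) (A k) := by
  refine Approx.pairS (approx_tab (approx_initSeg _).2 (fun t j v hv => ?_) fun j => ?_)
    (approx_initSeg A)
  · by_cases hj : j < n
    · rw [if_pos hj] at hv
      rw [← (getElem?_initSeg_eq_some.1 hv).2, proj, if_pos hj]
    · rw [if_neg hj] at hv
      obtain ⟨y, hy, hv⟩ := Option.bind_eq_some_iff.1 hv
      split_ifs at hv with h1
      have hy' := (getElem?_initSeg_eq_some.1 hy).2
      rw [proj, if_neg hj] at hy'
      obtain ⟨h2, h3⟩ := h.ready (j := j) (by omega)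
      have h4 := leastLt_spec (Nat.lt_succ_of_le h1)
      have h5 : wait e n j (initSeg (proj n W) t) (initSeg A t) = (W j).unpair.2 := by
        rw [length_initSeg] at h1
        refine le_antisymm ?_ ?_
        · by_contra hc
          refine not_of_lt_leastLt (not_le.1 hc) ?_
          rwa [take_initSeg_le _ (by omega), take_initSeg_le _ (by omega)]
        · by_contra hc
          refine h3 _ (not_le.1 hc) ?_
          rwa [← wait, take_initSeg_le _ h1, take_initSeg_le _ h1] at h4
      rw [h5, ← hy', Nat.pair_unpair] at hv
      exact Option.some_inj.1 hv
  · filter_upwards [eventually_ge_atTop (max (j + 1) (W j).unpair.2)] with t ht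
    rw [getElem?_initSeg_lt _ (by omega)]
    by_cases hj : j < n
    · rw [if_pos hj]; rfl
    · have h1 : wait e n j (initSeg (proj n W) t) (initSeg A t) ≤ (W j).unpair.2 := by
        refine leastLt_le_of ?_
        rw [take_initSeg_le _ (by omega), take_initSeg_le _ (by omega)]
        exact (h.ready (by omega)).1
      rw [if_neg hj, Option.bind_some, if_pos (by rw [length_initSeg]; omega)]; rfl

theorem Approx.domEv_iff {s : ℕ → Str} {g : ℕ → ℕ} (h : Approx s g) (p : ℕ) :
    (∃ t, ∃ r ≤ (s t).length,
      (Code.evaln t (Denumerable.ofNat Code p) (encode ((s t).take r))).isSome) ↔ DomEv g p := by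
  constructor
  · rintro ⟨t, r, hr, h1⟩
    rw [h.1 t, take_initSeg_le _ hr] at h1
    exact ⟨r, dom_of_isSome_evaln h1⟩
  · rintro ⟨r, hr⟩
    obtain ⟨t, h1, h2⟩ := ((eventually_isSome_evaln hr).and (h.2 r)).exists
    refine ⟨t, r, h2, ?_⟩
    rwa [h.1 t, take_initSeg_le _ h2]

/-- Questions about computations from a point of level `n` can be translated into questions
about computations from its projection. -/
theorem exists_projIndex (e : Code) : ∃ P : ℕ × ℕ → ℕ, Primrec P ∧
    ∀ {w : ℕ → Str → Str → Prop} {A W : ℕ → ℕ} {n : ℕ} (p : ℕ), Lev w e A n W →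
      ((∃ s, EvA A (P (n, p)) (initSeg (proj n W) s)) ↔
        DomEv (fun k => Nat.pair (W k) (A k)) p) := by
  have hV : PrimrecPred fun x : (ℕ × ℕ) × Str × Str =>
      ∃ r ≤ (restoreS e x.1.1 x.2.1 x.2.2).length,
        (Code.evaln x.2.1.length (Denumerable.ofNat Code x.1.2)
          (encode ((restoreS e x.1.1 x.2.1 x.2.2).take r))).isSome := by
    have hr : Primrec fun x : (ℕ × ℕ) × Str × Str => restoreS e x.1.1 x.2.1 x.2.2 :=
      primrec_restoreS (Primrec.const e) (Primrec.fst.comp Primrec.fst)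
        (Primrec.fst.comp Primrec.snd) (Primrec.snd.comp Primrec.snd)
    have hf : Primrec fun y : ((ℕ × ℕ) × Str × Str) × ℕ => y.1 := Primrec.fst
    exact primrecPred_exists_le (Primrec.list_length.comp hr) (primrecPred_isSome (primrec_evaln
      (Primrec.list_length.comp (Primrec.fst.comp (Primrec.snd.comp hf)))
      ((Primrec.ofNat Code).comp (Primrec.snd.comp (Primrec.fst.comp hf)))
      (Primrec.encode.comp (primrec_take Primrec.snd (hr.comp hf)))))
  obtain ⟨P, hP, h⟩ := exists_index (V := fun (x : ℕ × ℕ) (y : Str × Str) =>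
    ∃ r ≤ (restoreS e x.1 y.1 y.2).length, (Code.evaln y.1.length (Denumerable.ofNat Code x.2)
      (encode ((restoreS e x.1 y.1 y.2).take r))).isSome) hV
  refine ⟨P, hP, fun {w A W n} p hL => ?_⟩
  rw [exists_evA_iff, ← (approx_restoreS hL).domEv_iff p]
  refine exists_congr fun t => ?_
  rw [h (n, p) (initSeg (proj n W) t, initSeg A t)]
  simp only [length_initSeg]

theorem exists_ocode_omegaJump {w : ℕ → Str → Str → Prop} {e : Code}
    (hw : ∀ n α ξ m, w n α ξ → w n (α.take m) ξ)
    (he : ∀ α n τ, e.eval (encode ((α, n, τ) : Str × ℕ × Str)) =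
      Part.some (if Tree w e n α τ then 1 else 0)) :
    ∃ c : OCode, ∀ x ∈ {x | ∀ n s, w n (initSeg (jumpIter zeroF n) s) (initSeg x n)},
      computesFn (oplus (tower e x 0) (omegaJump zeroF)) c (omegaJump (tower e x 0)) := by
  obtain ⟨P, hP, hPi⟩ := exists_projIndex e
  have hans : Primrec fun x : ℕ × Str × ℕ =>
      (treeG x.1 (sndS x.2.1) (encS (fstS x.2.1)) (x.1 + P (x.1, x.2.2) + 1)).bind fun τ =>
        (sndS x.2.1)[qD (P (x.1, x.2.2), τ)]? := by
    have h1 : Primrec fun x : ℕ × Str × ℕ => P (x.1, x.2.2) :=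
      hP.comp (Primrec.pair Primrec.fst (Primrec.snd.comp Primrec.snd))
    have h2 : Primrec fun x : ℕ × Str × ℕ => sndS x.2.1 :=
      primrec_sndS.comp (Primrec.fst.comp Primrec.snd)
    have h3 : Primrec fun x : ℕ × Str × ℕ => fstS x.2.1 :=
      primrec_fstS.comp (Primrec.fst.comp Primrec.snd)
    have h4 : Primrec fun x : ℕ × Str × ℕ =>
        treeG x.1 (sndS x.2.1) (encS (fstS x.2.1)) (x.1 + P (x.1, x.2.2) + 1) :=
      primrec_treeG_encS Primrec.fst h2 h3 (Primrec.succ.comp (Primrec.nat_add.comp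
        Primrec.fst h1))
    have h5 : Primrec fun y : (ℕ × Str × ℕ) × Str =>
        (sndS y.1.2.1)[qD (P (y.1.1, y.1.2.2), y.2)]? :=
      primrec_getElem (h2.comp Primrec.fst) (primrec_qD.comp (Primrec.pair
        (h1.comp Primrec.fst) Primrec.snd))
    exact primrec_bind h4 h5
  obtain ⟨ψ, hψ, h⟩ := exists_jumpIter_approx (ans := fun n σ p =>
    (treeG n (sndS σ) (encS (fstS σ)) (n + P (n, p) + 1)).bind fun τ =>
      (sndS σ)[qD (P (n, p), τ)]?) primrec_fstS hans
  have hs : Primrec fun y : Str × ℕ =>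
      ψ y.2 (pairS (climbS (oddS y.1) (evenS y.1) y.2) (col y.2 (oddS y.1))) :=
    hψ.comp (Primrec.pair Primrec.snd (primrec_pairS (primrec_climbS
      (primrec_oddS.comp Primrec.fst) (primrec_evenS.comp Primrec.fst) Primrec.snd)
      (primrec_col Primrec.snd (primrec_oddS.comp Primrec.fst))))
  refine exists_ocode_of_approx (g := fun x => oplus (tower e x 0) (omegaJump zeroF))
    (f := fun x => omegaJump (tower e x 0))
    (primrec_omega (s := fun ρ n => ψ n (pairS (climbS (oddS ρ) (evenS ρ) n) (col n (oddS ρ))))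
      Primrec.list_length hs).to_comp fun x hx => ?_
  have hρ := approx_initSeg (oplus (tower e x 0) (omegaJump zeroF))
  refine approx_omega (s := fun n k => ψ n (pairS
    (climbS (oddS (initSeg (oplus (tower e x 0) (omegaJump zeroF)) k))
      (evenS (initSeg (oplus (tower e x 0) (omegaJump zeroF)) k)) n)
    (col n (oddS (initSeg (oplus (tower e x 0) (omegaJump zeroF)) k))))) hρ.2 fun n => ?_
  have hg : ∀ n p, DomEv (fun k => Nat.pair (tower e x n k) (jumpIter zeroF n k)) p ↔
      EvA (jumpIter zeroF n) (P (n, p))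
        (treeF (jumpIter zeroF n) n (tower e x (n + 1)) (n + P (n, p) + 1)) := by
    intro n p
    rw [← hPi p (lev_tower hw he hx n), ← tower_succ, proj_down]
    refine ⟨evA_treeF_of_exists, fun h1 => ⟨(treeF (jumpIter zeroF n) n
      (tower e x (n + 1)) (n + P (n, p) + 1)).length, ?_⟩⟩
    rwa [treeF_eq_initSeg] at h1
  refine (h (fun n k => Nat.pair (tower e x n k) (jumpIter zeroF n k)) (tower e x 0) ?_ ?_ ?_
    n).comp ((hρ.oddS.climbS hρ.evenS n).pairS (hρ.oddS.col_zeroF n))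
  · simp only [fstS_initSeg]; exact approx_initSeg _
  · intro n p s v hv
    rw [fstS_initSeg, sndS_initSeg] at hv
    obtain ⟨τ, hτ, hv⟩ := Option.bind_eq_some_iff.1 hv
    obtain rfl := treeG_sound (X := tower e x (n + 1))
      (fun j _ a hj => (getElem?_initSeg_eq_some.1 hj).2) hτ
    rw [← (getElem?_initSeg_eq_some.1 hv).2]
    split_ifs with h1
    · exact (jump_qD _ _ _).2 ((hg n p).1 h1)
    · exact jump_qD_zero.2 fun h2 => h1 ((hg n p).2 h2)
  · intro n p
    obtain ⟨m0, hm⟩ := treeG_complete (jumpIter zeroF n) n (tower e x (n + 1))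
      (n + P (n, p) + 1)
    filter_upwards [eventually_ge_atTop (max m0 (n + P (n, p) + 1)), eventually_gt_atTop
      (qD (P (n, p), treeF (jumpIter zeroF n) n (tower e x (n + 1)) (n + P (n, p) + 1)))]
      with s h1 h2
    have h3 := hm (initSeg (jumpIter zeroF (n + 1)) s) (encS (initSeg (tower e x (n + 1)) s))
      (take_initSeg_le _ (by omega)) fun j hj => getElem?_initSeg_lt _ (by omega)
    rw [fstS_initSeg, sndS_initSeg, h3, Option.bind_some, getElem?_initSeg_lt _ h2]
    rfl

end Omega

end JumpInversion

/-- **Lemma.**  For every `Π^{0,0^{(ω)}}_1` set `P_ω` there are a `Π⁰₁` set `P₀` and a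
homeomorphism `H : P_ω → P₀` with `X ⊕ 0^{(ω)} ≡_T H(X) ⊕ 0^{(ω)} ≡_T H(X)^{(ω)}`
uniformly for all `X ∈ P_ω`. -/
theorem pi01_omega_jump_inversion (P : Set (ℕ → ℕ))
    (hP : IsPi01In (omegaJump zeroF) P) :
    ∃ (P₀ : Set (ℕ → ℕ)) (H : (ℕ → ℕ) → (ℕ → ℕ)), IsPi01 P₀ ∧ HomeoOn H P P₀ ∧
      UnifEquivOn P (fun X => oplus X (omegaJump zeroF))
        (fun X => oplus (H X) (omegaJump zeroF)) ∧
      UnifEquivOn P (fun X => oplus (H X) (omegaJump zeroF))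
        (fun X => omegaJump (H X)) := by
  obtain ⟨T, -, ⟨c, hc⟩, rfl⟩ := hP
  have hw := Side.take (tr c)
  obtain ⟨e, he⟩ := exists_treeCode (primrecPred_side (tr c))
  have hT : paths T =
      {x | ∀ n s, Side (tr c) n (initSeg (jumpIter zeroF n) s) (initSeg x n)} :=
    Set.ext fun x => mem_paths_iff_side hc x
  obtain ⟨c1, h1⟩ := exists_ocode_base e
  obtain ⟨c2, h2⟩ := exists_ocode_tower e
  obtain ⟨c3, h3⟩ := exists_ocode_of_omegaJump
  obtain ⟨c4, h4⟩ := exists_ocode_omegaJump hw he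
  rw [hT]
  exact ⟨_, fun x => tower e x 0, isPi01_lev (primrecPred_side _) hw, homeoOn_tower hw he,
    ⟨c1, c2, fun x _ => ⟨h1 x, h2 x⟩⟩, ⟨c3, c4, fun x hx => ⟨h3 _, h4 x hx⟩⟩⟩

end Harrington
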